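/- Let M be a weight sequence such that m_k^{1/k}→∞, such that there exists C≥1 with Γ̄_m(Ct) ≤ Γ̲_m(t) for all t>0, and such that mg(M,M)<∞. Let U ⊆ ℝ^d be open and let j be a positive integer. If f : U → ℂ is a function such that f^j and f^{j+1} belong to the Beurling Denjoy–Carleman class E^{(M)}(U), then f belongs to E^{(M)}(U). -/

import Mathlib

open Set Filter Topology Metric
open scoped ENNReal NNReal Topology

noncomputable section

namespace JorisPaper

/-- The sequence `m` with `m_k = M_k / k!`. -/
def lc (M : ℕ → ℝ) (k : ℕ) : ℝ := M k / (Nat.factorial k : ℝ)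

/-- A weight sequence: positive, log-convex, `M_0 = 1 ≤ M_1`, `M_k^{1/k} → ∞`. -/
structure IsWeightSeq (M : ℕ → ℝ) : Prop where
  pos : ∀ k, 0 < M k
  first : M 0 = 1
  one_le : 1 ≤ M 1
  logconvex : ∀ k, 1 ≤ k → M k ^ 2 ≤ M (k - 1) * M (k + 1)
  root : Filter.Tendsto (fun k : ℕ => M k ^ ((1 : ℝ) / (k : ℝ))) atTop atTop

/-- `m_k^{1/k} → ∞`. -/
def RootsTendsto (m : ℕ → ℝ) : Prop :=
  Filter.Tendsto (fun k : ℕ => m k ^ ((1 : ℝ) / (k : ℝ))) atTop atTop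

/-- `h_m(t) = inf_k m_k t^k` for `t > 0`, and `0` for `t ≤ 0`. -/
def hfn (m : ℕ → ℝ) (t : ℝ) : ℝ := if t ≤ 0 then 0 else ⨅ k : ℕ, m k * t ^ k

/-- `Γ̄_m(t) = min {k | h_m(t) = m_k t^k}`. -/
def GammaUpper (m : ℕ → ℝ) (t : ℝ) : ℕ := sInf {k : ℕ | hfn m t = m k * t ^ k}

/-- `Γ̲_m(t) = min {k | m_{k+1}/m_k ≥ 1/t}`. -/
def GammaLower (m : ℕ → ℝ) (t : ℝ) : ℕ := sInf {k : ℕ | 1 / t ≤ m (k + 1) / m k}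

/-- `mg(M,N) = sup_{j+k ≥ 1} (M_{j+k}/(N_j N_k))^{1/(j+k)}`, as an extended real. -/
def mg (M N : ℕ → ℝ) : ℝ≥0∞ :=
  ⨆ (j : ℕ) (k : ℕ) (_ : 1 ≤ j + k),
    ENNReal.ofReal ((M (j + k) / (N j * N k)) ^ (((j : ℝ) + (k : ℝ))⁻¹))

/-- A weight matrix: a totally ordered (pointwise) family of weight sequences. -/
structure IsWeightMatrix (W : Set (ℕ → ℝ)) : Prop where
  weight : ∀ M ∈ W, IsWeightSeq M
  ordered : ∀ M ∈ W, ∀ N ∈ W, (∀ k, M k ≤ N k) ∨ (∀ k, N k ≤ M k)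

/-- R-admissible weight matrix. -/
structure RAdmissible (W : Set (ℕ → ℝ)) : Prop where
  matrix : IsWeightMatrix W
  roots : ∀ M ∈ W, RootsTendsto (lc M)
  gamma : ∀ M ∈ W, ∃ N ∈ W, ∃ C : ℝ, 1 ≤ C ∧
    ∀ t : ℝ, 0 < t → GammaUpper (lc N) (C * t) ≤ GammaLower (lc M) t
  mgrowth : ∀ M ∈ W, ∃ N ∈ W, mg M N < ⊤

/-- B-admissible weight matrix. -/
structure BAdmissible (W : Set (ℕ → ℝ)) : Prop where
  matrix : IsWeightMatrix W
  roots : ∀ M ∈ W, RootsTendsto (lc M)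
  gamma : ∀ M ∈ W, ∃ N ∈ W, ∃ C : ℝ, 1 ≤ C ∧
    ∀ t : ℝ, 0 < t → GammaUpper (lc M) (C * t) ≤ GammaLower (lc N) t
  mgrowth : ∀ M ∈ W, ∃ N ∈ W, mg N M < ⊤

/-- `‖f‖^M_{K,ρ} < ∞` (derivatives taken within `U`). -/
def SeqBoundedOn {E F : Type*} [NormedAddCommGroup E] [NormedSpace ℝ E]
    [NormedAddCommGroup F] [NormedSpace ℝ F]
    (M : ℕ → ℝ) (ρ : ℝ) (f : E → F) (U K : Set E) : Prop :=
  ∃ C : ℝ, ∀ x ∈ K, ∀ k : ℕ, ‖iteratedFDerivWithin ℝ k f U x‖ ≤ C * ρ ^ k * M k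

/-- `f ∈ B^M_ρ(V)`: smooth on `V` with global bounds `‖f‖^M_{V,ρ} < ∞`. -/
def GlobalClass {E F : Type*} [NormedAddCommGroup E] [NormedSpace ℝ E]
    [NormedAddCommGroup F] [NormedSpace ℝ F]
    (M : ℕ → ℝ) (ρ : ℝ) (f : E → F) (V : Set E) : Prop :=
  ContDiffOn ℝ (⊤ : ℕ∞) f V ∧ SeqBoundedOn M ρ f V V

/-- The Roumieu class `E^{{W}}(U)`. -/
def Roumieu {E F : Type*} [NormedAddCommGroup E] [NormedSpace ℝ E]
    [NormedAddCommGroup F] [NormedSpace ℝ F]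
    (W : Set (ℕ → ℝ)) (U : Set E) (f : E → F) : Prop :=
  ContDiffOn ℝ (⊤ : ℕ∞) f U ∧
    ∀ K ⊆ U, IsCompact K → ∃ M ∈ W, ∃ ρ : ℝ, 0 < ρ ∧ SeqBoundedOn M ρ f U K

/-- The Beurling class `E^{(W)}(U)`. -/
def Beurling {E F : Type*} [NormedAddCommGroup E] [NormedSpace ℝ E]
    [NormedAddCommGroup F] [NormedSpace ℝ F]
    (W : Set (ℕ → ℝ)) (U : Set E) (f : E → F) : Prop :=
  ContDiffOn ℝ (⊤ : ℕ∞) f U ∧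
    ∀ K ⊆ U, IsCompact K → ∀ M ∈ W, ∀ ρ : ℝ, 0 < ρ → SeqBoundedOn M ρ f U K

/-- The open ellipse `Ω_ε` with vertices `±cosh ε` and co-vertices `±i sinh ε`. -/
def Omega (ε : ℝ) : Set ℂ :=
  {z : ℂ | (z.re / Real.cosh ε) ^ 2 + (z.im / Real.sinh ε) ^ 2 < 1}

/-- `V_U = ⋃_{x ∈ U} (x + 𝔹)`. -/
def VU {E : Type*} [NormedAddCommGroup E] [NormedSpace ℝ E] (U : Set E) : Set E :=
  ⋃ x ∈ U, Metric.closedBall x 1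

/-- A weight function in the sense of Braun–Meise–Taylor. -/
structure IsWeightFunction (ω : ℝ → ℝ) : Prop where
  cont : ContinuousOn ω (Ici 0)
  mono : MonotoneOn ω (Ici 0)
  nonneg : ∀ t, 0 ≤ t → 0 ≤ ω t
  bigO : (fun t => ω (2 * t)) =O[atTop] ω
  littleO : ω =o[atTop] (fun t => t)
  logLittleO : Real.log =o[atTop] ω
  convex : ConvexOn ℝ (Ici 0) (fun t => ω (Real.exp t))

/-- The Young conjugate `φ*_ω(s) = sup_{t ≥ 0} (s t - ω(e^t))`. -/
def youngConj (ω : ℝ → ℝ) (s : ℝ) : ℝ :=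
  sSup {y : ℝ | ∃ t : ℝ, 0 ≤ t ∧ y = s * t - ω (Real.exp t)}

/-- The Roumieu class `E^{{ω}}(U)` for a weight function `ω`. -/
def RoumieuW {E F : Type*} [NormedAddCommGroup E] [NormedSpace ℝ E]
    [NormedAddCommGroup F] [NormedSpace ℝ F]
    (ω : ℝ → ℝ) (U : Set E) (f : E → F) : Prop :=
  ContDiffOn ℝ (⊤ : ℕ∞) f U ∧
    ∀ K ⊆ U, IsCompact K → ∃ C : ℝ, 0 < C ∧ ∃ ρ : ℝ, 0 < ρ ∧
      ∀ x ∈ K, ∀ k : ℕ, ‖iteratedFDerivWithin ℝ k f U x‖ ≤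
        C * Real.exp ((1 / ρ) * youngConj ω (ρ * k))

/-- The Beurling class `E^{(ω)}(U)` for a weight function `ω`. -/
def BeurlingW {E F : Type*} [NormedAddCommGroup E] [NormedSpace ℝ E]
    [NormedAddCommGroup F] [NormedSpace ℝ F]
    (ω : ℝ → ℝ) (U : Set E) (f : E → F) : Prop :=
  ContDiffOn ℝ (⊤ : ℕ∞) f U ∧
    ∀ K ⊆ U, IsCompact K → ∀ ρ : ℝ, 0 < ρ → ∃ C : ℝ, 0 < C ∧
      ∀ x ∈ K, ∀ k : ℕ, ‖iteratedFDerivWithin ℝ k f U x‖ ≤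
        C * Real.exp ((1 / ρ) * youngConj ω (ρ * k))

/-- The two-constants estimate on the upper half disc of radius one. -/
lemma two_constants_half {g : ℂ → ℂ} {A η : ℝ} (hη : 0 < η) (hηA : η ≤ A)
    (hg : DifferentiableOn ℂ g (ball 0 2)) (hA : ∀ z ∈ ball (0 : ℂ) 2, ‖g z‖ ≤ A)
    (hr : ∀ x : ℝ, |x| < 2 → ‖g x‖ ≤ η) {z : ℂ} (hz : ‖z‖ < 1 / 8) (him : 0 < z.im) :
    ‖g z‖ ≤ Real.sqrt (A * η) := by
  have hApos : 0 < A := hη.trans_le hηA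
  set L : ℝ := Real.log (A / η) with hL
  have hL0 : 0 ≤ L := Real.log_nonneg (by rwa [le_div_iff₀ hη, one_mul])
  have hexpL : Real.exp L = A / η := Real.exp_log (by positivity)
  set e : ℂ → ℂ := fun w => Complex.exp (L * (1 + 2 * Complex.I * w - w ^ 2)) with he
  have hnorm : ∀ w, ‖e w‖ = Real.exp (L * (1 - 2 * w.im - (w.re ^ 2 - w.im ^ 2))) := by
    intro w
    simp only [he, Complex.norm_exp]
    congr 1
    simp [pow_two]
    left; ring
  set V : Set ℂ := {w | ‖w‖ < 1 ∧ 0 < w.im} with hV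
  have hVopen : IsOpen V :=
    (isOpen_lt continuous_norm continuous_const).inter
      (isOpen_lt continuous_const Complex.continuous_im)
  have hVcl : closure V ⊆ {w | ‖w‖ ≤ 1 ∧ 0 ≤ w.im} := by
    refine closure_minimal (fun w hw => ⟨hw.1.le, hw.2.le⟩) ?_
    exact (isClosed_le continuous_norm continuous_const).inter
      (isClosed_le continuous_const Complex.continuous_im)
  have hsub : closure V ⊆ ball (0 : ℂ) 2 := fun w hw => by
    have := (hVcl hw).1
    simp only [mem_ball, dist_zero_right]; linarith
  have hdiff : DiffContOnCl ℂ (fun w => g w * e w) V := by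
    apply DifferentiableOn.diffContOnCl
    refine (hg.mono hsub).mul ?_
    have : Differentiable ℂ e := by fun_prop
    exact this.differentiableOn
  have hbdd : Bornology.IsBounded V :=
    Metric.isBounded_ball.subset (fun w hw => by simpa using hw.1 : V ⊆ ball (0 : ℂ) 1)
  have hfr : ∀ w ∈ frontier V, ‖g w * e w‖ ≤ A := by
    intro w hw
    have hwc := frontier_subset_closure hw
    have hwV : w ∉ V := by
      rw [hVopen.frontier_eq] at hw
      exact hw.2
    obtain ⟨h1, h2⟩ := hVcl hwc
    have hw2 := hsub hwc
    rw [norm_mul, hnorm]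
    have hsq : w.re ^ 2 + w.im ^ 2 = ‖w‖ ^ 2 := by
      rw [← Complex.normSq_eq_norm_sq, Complex.normSq_apply]; ring
    rcases h2.eq_or_lt with h0 | h0
    · have hwr : w = (w.re : ℂ) := by
        apply Complex.ext <;> simp [← h0]
      have h3 : ‖g w‖ ≤ η := by
        rw [hwr]
        apply hr
        have := Complex.abs_re_le_norm w
        linarith
      have h4 : Real.exp (L * (1 - 2 * w.im - (w.re ^ 2 - w.im ^ 2))) ≤ A / η := by
        rw [← hexpL]
        apply Real.exp_le_exp.mpr
        rw [← h0]
        nlinarith [sq_nonneg w.re]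
      calc _ ≤ η * (A / η) := by gcongr
        _ = A := by field_simp
    · have h1' : ‖w‖ = 1 := by
        by_contra hne
        exact hwV ⟨lt_of_le_of_ne h1 hne, h0⟩
      have h3 : Real.exp (L * (1 - 2 * w.im - (w.re ^ 2 - w.im ^ 2))) ≤ 1 := by
        rw [Real.exp_le_one_iff]
        have : w.im ≤ 1 := by
          have := Complex.abs_im_le_norm w
          have := le_abs_self w.im
          linarith
        rw [h1'] at hsq
        have : 1 - 2 * w.im - (w.re ^ 2 - w.im ^ 2) ≤ 0 := by nlinarith
        exact mul_nonpos_of_nonneg_of_nonpos hL0 this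
      calc _ ≤ A * 1 := mul_le_mul (hA w hw2) h3 (Real.exp_pos _).le hApos.le
        _ = A := mul_one A
  have hzV : z ∈ V := ⟨by linarith, him⟩
  have key := Complex.norm_le_of_forall_mem_frontier_norm_le hbdd hdiff hfr (subset_closure hzV)
  rw [norm_mul, hnorm] at key
  have hlow : Real.exp (L / 2) ≤ Real.exp (L * (1 - 2 * z.im - (z.re ^ 2 - z.im ^ 2))) := by
    apply Real.exp_le_exp.mpr
    have h1 := Complex.abs_im_le_norm z
    have h2 := le_abs_self z.im
    have h3 : z.re ^ 2 ≤ (1 / 8) ^ 2 := by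
      rw [sq_le_sq]
      have := Complex.abs_re_le_norm z
      rw [abs_of_pos (by norm_num : (0 : ℝ) < 1 / 8)]; linarith
    nlinarith [sq_nonneg z.im]
  have hhalf : Real.exp (L / 2) * Real.sqrt (A * η) = A := by
    have : Real.exp (L / 2) = Real.sqrt (A / η) := by
      rw [← hexpL, Real.exp_half]
    rw [this, ← Real.sqrt_mul (by positivity), show A / η * (A * η) = A ^ 2 by field_simp,
      Real.sqrt_sq hApos.le]
  have h5 : ‖g z‖ * Real.exp (L / 2) ≤ A := le_trans (by gcongr) key
  have h6 : ‖g z‖ * Real.exp (L / 2) ≤ Real.sqrt (A * η) * Real.exp (L / 2) := by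
    linarith [mul_comm (Real.exp (L / 2)) (Real.sqrt (A * η))]
  exact le_of_mul_le_mul_right h6 (Real.exp_pos _)

/-- A holomorphic function on a disc that is bounded by `A` and by `η` on the real diameter is
bounded by `√(A η)` on a smaller disc. -/
lemma two_constants {g : ℂ → ℂ} {A η R : ℝ} (hR : 0 < R) (hη : 0 < η) (hηA : η ≤ A)
    (hg : DifferentiableOn ℂ g (ball 0 R)) (hA : ∀ z ∈ ball (0 : ℂ) R, ‖g z‖ ≤ A)
    (hr : ∀ x : ℝ, |x| < R → ‖g x‖ ≤ η) {z : ℂ} (hz : ‖z‖ < R / 16) :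
    ‖g z‖ ≤ Real.sqrt (A * η) := by
  have scaled : ∀ c : ℝ, |c| = R / 2 → ∀ w : ℂ, ‖w‖ < 1 / 8 → 0 < w.im →
      ‖g (c * w)‖ ≤ Real.sqrt (A * η) := by
    intro c hc w hw him
    have hmaps : ∀ w ∈ ball (0 : ℂ) 2, (c : ℂ) * w ∈ ball (0 : ℂ) R := by
      intro w hw
      simp only [mem_ball, dist_zero_right, norm_mul, Complex.norm_real, Real.norm_eq_abs, hc]
        at hw ⊢
      nlinarith
    refine two_constants_half (g := fun w => g (c * w)) hη hηA ?_ (fun w hw => hA _ (hmaps w hw))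
      ?_ hw him
    · exact hg.comp (by fun_prop) hmaps
    · intro x hx
      have := hr (c * x) (by rw [abs_mul, hc]; nlinarith)
      simpa using this
  have hRc : (R : ℂ) ≠ 0 := by exact_mod_cast hR.ne'
  rcases lt_trichotomy z.im 0 with h | h | h
  · have := scaled (-(R / 2)) (by rw [abs_neg, abs_of_pos (by positivity)])
      ((-(2 / R) : ℝ) * z) (by
        rw [norm_mul, Complex.norm_real, Real.norm_eq_abs, abs_neg, abs_of_pos (by positivity)]
        rw [div_mul_eq_mul_div, div_lt_iff₀ hR]; linarith) (by
        rw [Complex.im_ofReal_mul]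
        have : 0 < 2 / R := by positivity
        nlinarith)
    convert this using 3
    push_cast; field_simp
  · have hzr : z = (z.re : ℂ) := by apply Complex.ext <;> simp [h]
    rw [hzr]
    have h1 := Complex.abs_re_le_norm z
    refine (hr _ (by linarith)).trans (Real.le_sqrt_of_sq_le ?_)
    nlinarith
  · have := scaled (R / 2) (by rw [abs_of_pos (by positivity)])
      ((2 / R : ℝ) * z) (by
        rw [norm_mul, Complex.norm_real, Real.norm_eq_abs, abs_of_pos (by positivity)]
        rw [div_mul_eq_mul_div, div_lt_iff₀ hR]; linarith) (by
        rw [Complex.im_ofReal_mul]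
        have : 0 < 2 / R := by positivity
        nlinarith)
    convert this using 3
    push_cast; field_simp

section DbarEstimates

open MeasureTheory ComplexConjugate

/-- The Wirtinger derivative `∂u/∂z̄`. -/
def dbar (u : ℂ → ℂ) (z : ℂ) : ℂ :=
  (fderiv ℝ u z 1 + Complex.I * fderiv ℝ u z Complex.I) / 2

lemma dbar_mul {u v : ℂ → ℂ} {z : ℂ} (hu : DifferentiableAt ℝ u z)
    (hv : DifferentiableAt ℝ v z) :
    dbar (fun w => u w * v w) z = dbar u z * v z + u z * dbar v z := by
  have h := (hu.hasFDerivAt.mul hv.hasFDerivAt).fderiv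
  simp only [dbar]
  rw [show (fun w => u w * v w) = u * v from rfl, h]
  simp only [add_apply, smul_apply, smul_eq_mul]
  ring

lemma dbar_holomorphic {p : ℂ → ℂ} {z : ℂ} (hp : DifferentiableAt ℂ p z) : dbar p z = 0 := by
  have h := (hp.hasDerivAt.hasFDerivAt.restrictScalars ℝ).fderiv
  simp only [dbar]
  rw [h]
  simp only [ContinuousLinearMap.coe_restrictScalars', ContinuousLinearMap.toSpanSingleton_apply,
    smul_eq_mul]
  linear_combination (deriv p z) / 2 * Complex.I_sq

lemma dbar_conj_holomorphic {p : ℂ → ℂ} {z : ℂ} (hp : DifferentiableAt ℂ p z) :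
    dbar (fun w => conj (p w)) z = conj (deriv p z) := by
  have h := (Complex.conjCLE.toContinuousLinearMap.hasFDerivAt.comp z
    (hp.hasDerivAt.hasFDerivAt.restrictScalars ℝ)).fderiv
  simp only [dbar]
  rw [show (fun w => conj (p w)) = (Complex.conjCLE.toContinuousLinearMap ∘ p) from rfl, h]
  simp
  linear_combination -(conj (deriv p z)) / 2 * Complex.I_sq

lemma dbar_rpow {w : ℂ → ℝ} {z : ℂ} (hw : DifferentiableAt ℝ w z) (h0 : w z ≠ 0) (γ : ℝ) :
    dbar (fun ζ => ((w ζ ^ γ : ℝ) : ℂ)) z =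
      ((γ * w z ^ (γ - 1) : ℝ) : ℂ) * dbar (fun ζ => (w ζ : ℂ)) z := by
  have h1 := (Complex.ofRealCLM.hasFDerivAt.comp z
    (hw.hasFDerivAt.rpow_const (p := γ) (Or.inl h0))).fderiv
  have h2 := (Complex.ofRealCLM.hasFDerivAt.comp z hw.hasFDerivAt).fderiv
  simp only [dbar]
  rw [show (fun ζ => ((w ζ ^ γ : ℝ) : ℂ)) = (Complex.ofRealCLM ∘ fun ζ => w ζ ^ γ) from rfl, h1,
    show (fun ζ => (w ζ : ℂ)) = (Complex.ofRealCLM ∘ w) from rfl, h2]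
  simp
  ring

lemma continuous_dbar {u : ℂ → ℂ} (hu : ContDiff ℝ 1 u) : Continuous (dbar u) := by
  have h := hu.continuous_fderiv one_ne_zero
  unfold dbar
  fun_prop

lemma hasCompactSupport_dbar {u : ℂ → ℂ} (hs : HasCompactSupport u) :
    HasCompactSupport (dbar u) := by
  refine (hs.fderiv ℝ).mono ?_
  intro z hz
  contrapose! hz
  simp only [Function.mem_support, ne_eq, not_not] at hz ⊢
  simp [dbar, hz]

lemma integral_fderiv_apply_eq_zero {u : ℂ → ℂ} (hu : ContDiff ℝ 1 u) (hs : HasCompactSupport u)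
    (v : ℂ) : ∫ z, fderiv ℝ u z v = 0 := by
  have hc : Continuous fun z => fderiv ℝ u z v :=
    (hu.continuous_fderiv one_ne_zero).clm_apply continuous_const
  have hi : Integrable fun z => fderiv ℝ u z v := by
    refine hc.integrable_of_hasCompactSupport ((hs.fderiv ℝ).mono ?_)
    intro z hz
    contrapose! hz
    simp only [Function.mem_support, ne_eq, not_not] at hz ⊢
    simp [hz]
  have hu' : Integrable u := hu.continuous.integrable_of_hasCompactSupport hs
  have := integral_mul_fderiv_eq_neg_fderiv_mul_of_integrable (μ := (volume : Measure ℂ))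
    (f := fun _ : ℂ => (1 : ℂ)) (g := u) (v := v) (by simp) (by simpa using hi)
    (by simpa using hu') (fun x _ => by fun_prop)
    (fun x _ => hu.differentiable one_ne_zero x)
  simpa using this

lemma integral_dbar_eq_zero {u : ℂ → ℂ} (hu : ContDiff ℝ 1 u) (hs : HasCompactSupport u) :
    ∫ z, dbar u z = 0 := by
  have hi : ∀ v, Integrable fun z => fderiv ℝ u z v := fun v => by
    have hc : Continuous fun z => fderiv ℝ u z v :=
      (hu.continuous_fderiv one_ne_zero).clm_apply continuous_const
    refine hc.integrable_of_hasCompactSupport ((hs.fderiv ℝ).mono ?_)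
    intro z hz
    contrapose! hz
    simp only [Function.mem_support, ne_eq, not_not] at hz ⊢
    simp [hz]
  unfold dbar
  rw [integral_div, integral_add (hi 1) ((hi _).const_mul _), integral_const_mul,
    integral_fderiv_apply_eq_zero hu hs, integral_fderiv_apply_eq_zero hu hs]
  simp

lemma integral_dbar_div_self {u : ℂ → ℂ} (hu : ContDiff ℝ 1 u) (hs : HasCompactSupport u) :
    ∫ z, dbar u z / z = -(Real.pi * u 0) := by
  obtain ⟨R, hR⟩ := hs.isCompact.isBounded.subset_ball (0 : ℂ)
  set e : ℝ → ℂ := fun θ => Real.cos θ + Real.sin θ * Complex.I with he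
  have he_norm : ∀ θ, ‖e θ‖ = 1 := fun θ => by
    have : e θ = Complex.exp (θ * Complex.I) := by
      rw [Complex.exp_mul_I]; simp [he]
    rw [this, Complex.norm_exp_ofReal_mul_I]
  have hez : ∀ θ, e θ ≠ 0 := fun θ h => by simpa [h] using he_norm θ
  have hec : Continuous e := by fun_prop
  have hDc := hu.continuous_fderiv one_ne_zero
  set Ψ₁ : ℝ × ℝ → ℂ := fun q => fderiv ℝ u (q.1 * e q.2) (e q.2) with hΨ₁
  set Ψ₂ : ℝ × ℝ → ℂ := fun q => fderiv ℝ u (q.1 * e q.2) (Complex.I * e q.2) with hΨ₂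
  have hΨ₁c : Continuous Ψ₁ := by
    apply Continuous.clm_apply
    · exact hDc.comp (by fun_prop)
    · fun_prop
  have hΨ₂c : Continuous Ψ₂ := by
    apply Continuous.clm_apply
    · exact hDc.comp (by fun_prop)
    · fun_prop
  have hzero : ∀ q : ℝ × ℝ, R ≤ |q.1| → fderiv ℝ u (q.1 * e q.2) = 0 := by
    intro q hq
    by_contra hne
    have h1 : (q.1 * e q.2 : ℂ) ∈ tsupport u :=
      support_fderiv_subset ℝ hne
    have := hR h1
    simp only [mem_ball, dist_zero_right, norm_mul, Complex.norm_real, he_norm, mul_one,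
      Real.norm_eq_abs] at this
    linarith
  set T : Set (ℝ × ℝ) := Ioi (0 : ℝ) ×ˢ Ioo (-Real.pi) Real.pi with hT
  have hint : ∀ Ψ : ℝ × ℝ → ℂ, Continuous Ψ → (∀ q : ℝ × ℝ, R ≤ |q.1| → Ψ q = 0) →
      IntegrableOn Ψ T := by
    intro Ψ hc h0
    have h1 : IntegrableOn Ψ (Icc (-R) R ×ˢ Icc (-Real.pi) Real.pi) :=
      hc.continuousOn.integrableOn_compact (isCompact_Icc.prod isCompact_Icc)
    refine h1.of_forall_sdiff_eq_zero (measurableSet_Ioi.prod measurableSet_Ioo) ?_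
    rintro ⟨r, θ⟩ ⟨⟨hr, hθ⟩, hq⟩
    refine h0 _ ?_
    by_contra hlt
    exact hq ⟨abs_le.mp (not_le.mp hlt).le, hθ.1.le, hθ.2.le⟩
  have hi₁ : IntegrableOn Ψ₁ T := hint Ψ₁ hΨ₁c fun q hq => by simp [hΨ₁, hzero q hq]
  have hi₂ : IntegrableOn Ψ₂ T := hint Ψ₂ hΨ₂c fun q hq => by simp [hΨ₂, hzero q hq]
  have hTprod : ((volume : Measure ℝ).restrict (Ioi 0)).prod
      ((volume : Measure ℝ).restrict (Ioo (-Real.pi) Real.pi)) =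
      (volume : Measure (ℝ × ℝ)).restrict T := by
    rw [Measure.prod_restrict]; rfl
  have hI₁ : ∫ q in T, Ψ₁ q = -(2 * Real.pi * u 0) := by
    rw [IntegrableOn, ← hTprod] at hi₁
    rw [← hTprod, integral_prod_symm _ hi₁]
    have : ∀ θ : ℝ, ∫ r in Ioi (0 : ℝ), Ψ₁ (r, θ) = -u 0 := by
      intro θ
      have hd : ∀ r : ℝ, HasDerivAt (fun r : ℝ => u (r * e θ)) (Ψ₁ (r, θ)) r := by
        intro r
        have h1 : HasDerivAt (fun r : ℝ => (r * e θ : ℂ)) (e θ) r := by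
          simpa using (Complex.ofRealCLM.hasDerivAt (x := r)).mul_const (e θ)
        exact (hu.differentiable one_ne_zero _).hasFDerivAt.comp_hasDerivAt r h1
      have hcd : ContDiff ℝ 1 (fun r : ℝ => u (r * e θ)) :=
        hu.comp (Complex.ofRealCLM.contDiff.mul contDiff_const)
      have hcs : HasCompactSupport (fun r : ℝ => u (r * e θ)) := by
        refine HasCompactSupport.intro (isCompact_Icc (a := -R) (b := R)) fun r hr => ?_
        by_contra hne
        have := hR (subset_tsupport _ hne)
        simp only [mem_ball, dist_zero_right, norm_mul, Complex.norm_real, he_norm, mul_one,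
          Real.norm_eq_abs] at this
        exact hr (abs_le.mp this.le)
      have h2 := hcs.integral_Ioi_deriv_eq hcd 0
      rw [show deriv (fun r : ℝ => u (r * e θ)) = fun r => Ψ₁ (r, θ) from
        funext fun r => (hd r).deriv] at h2
      simpa using h2
    have hvol : ((volume : Measure ℝ).restrict (Ioo (-Real.pi) Real.pi)).real univ =
        2 * Real.pi := by
      rw [measureReal_restrict_apply_univ, Real.volume_real_Ioo_of_le (by linarith [Real.pi_pos])]
      ring
    simp only [this, integral_const, hvol, Complex.real_smul]
    push_cast
    ring
  have hI₂ : ∫ q in T, Ψ₂ q = 0 := by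
    rw [IntegrableOn, ← hTprod] at hi₂
    rw [← hTprod, integral_prod _ hi₂]
    have : ∀ r ∈ Ioi (0 : ℝ), ∫ θ in Ioo (-Real.pi) Real.pi, Ψ₂ (r, θ) = 0 := by
      intro r hr
      have hr0 : (r : ℂ) ≠ 0 := by exact_mod_cast (ne_of_gt hr)
      have hd : ∀ θ : ℝ, HasDerivAt (fun θ : ℝ => u (r * e θ)) (r * Ψ₂ (r, θ)) θ := by
        intro θ
        have h1 : HasDerivAt e (Complex.I * e θ) θ := by
          have hcos := (Real.hasDerivAt_cos θ).ofReal_comp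
          have hsin := ((Real.hasDerivAt_sin θ).ofReal_comp).mul_const Complex.I
          refine (hcos.add hsin).congr_deriv ?_
          simp only [he]
          push_cast
          linear_combination -(Complex.sin θ) * Complex.I_sq
        have h2 : HasDerivAt (fun θ : ℝ => (r * e θ : ℂ)) (r * (Complex.I * e θ)) θ :=
          h1.const_mul _
        have h3 := (hu.differentiable one_ne_zero _).hasFDerivAt.comp_hasDerivAt θ h2
        refine h3.congr_deriv ?_
        have := (fderiv ℝ u (r * e θ)).map_smul r (Complex.I * e θ)
        simpa using this
      have hc : Continuous fun θ : ℝ => r * Ψ₂ (r, θ) := by fun_prop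
      have h2 := intervalIntegral.integral_eq_sub_of_hasDerivAt (a := -Real.pi) (b := Real.pi)
        (fun θ _ => hd θ) (hc.intervalIntegrable _ _)
      rw [intervalIntegral.integral_const_mul,
        intervalIntegral.integral_of_le (by linarith [Real.pi_pos]),
        integral_Ioc_eq_integral_Ioo] at h2
      have h3 : (r : ℂ) * ∫ θ in Ioo (-Real.pi) Real.pi, Ψ₂ (r, θ) = 0 := by
        rw [h2]; simp [he]
      exact (mul_eq_zero.mp h3).resolve_left hr0
    rw [setIntegral_congr_fun measurableSet_Ioi this]
    simp
  rw [← Complex.integral_comp_polarCoord_symm]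
  have hpt : ∀ q ∈ T, q.1 • (dbar u (Complex.polarCoord.symm q) / Complex.polarCoord.symm q) =
      (1 / 2 : ℂ) * (Ψ₁ q + Complex.I * Ψ₂ q) := by
    rintro ⟨r, θ⟩ ⟨hr, -⟩
    have hr0 : (r : ℂ) ≠ 0 := by exact_mod_cast (ne_of_gt hr)
    rw [Complex.polarCoord_symm_apply]
    change r • (dbar u (r * e θ) / (r * e θ)) = (1 / 2 : ℂ) *
      (fderiv ℝ u (r * e θ) (e θ) + Complex.I * fderiv ℝ u (r * e θ) (Complex.I * e θ))
    set D := fderiv ℝ u (r * e θ) with hD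
    have h1 : D (e θ) = Real.cos θ * D 1 + Real.sin θ * D Complex.I := by
      have : e θ = Real.cos θ • (1 : ℂ) + Real.sin θ • Complex.I := by simp [he]
      rw [this, map_add, map_smul, map_smul]; simp
    have h2 : D (Complex.I * e θ) = -Real.sin θ * D 1 + Real.cos θ * D Complex.I := by
      have : Complex.I * e θ = (-Real.sin θ) • (1 : ℂ) + Real.cos θ • Complex.I := by
        simp [he]
        linear_combination (Complex.sin θ) * Complex.I_sq
      rw [this, map_add, map_smul, map_smul]; simp
    rw [h1, h2, Complex.real_smul, dbar, ← hD]
    have hsq : (Real.cos θ : ℂ) ^ 2 + (Real.sin θ : ℂ) ^ 2 = 1 := by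
      exact_mod_cast Real.cos_sq_add_sin_sq θ
    have hez' := hez θ
    field_simp
    simp only [he]
    have hI := Complex.I_sq
    generalize (Real.cos θ : ℂ) = c at *
    generalize (Real.sin θ : ℂ) = s at *
    generalize D 1 = a
    generalize D Complex.I = b
    linear_combination -(a + Complex.I * b) * hsq + (a * s ^ 2 - b * c * s) * hI
  have hTm : MeasurableSet T := measurableSet_Ioi.prod measurableSet_Ioo
  rw [show polarCoord.target = T from rfl, setIntegral_congr_fun hTm hpt, integral_const_mul,
    integral_add hi₁ (hi₂.const_mul _), integral_const_mul, hI₁, hI₂]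
  ring

/-- The Cauchy–Pompeiu formula for compactly supported functions. -/
lemma integral_dbar_div_sub {u : ℂ → ℂ} (hu : ContDiff ℝ 1 u) (hs : HasCompactSupport u) (z : ℂ) :
    ∫ ζ, dbar u ζ / (ζ - z) = -(Real.pi * u z) := by
  have h := integral_dbar_div_self (u := fun ζ => u (ζ + z))
    (hu.comp (contDiff_id.add contDiff_const))
    (hs.comp_homeomorph (Homeomorph.addRight z))
  have hd : ∀ ζ, dbar (fun ζ => u (ζ + z)) ζ = dbar u (ζ + z) := fun ζ => by
    simp [dbar, fderiv_comp_add_right]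
  simp only [hd, zero_add] at h
  rw [← h, ← integral_add_right_eq_self (fun ζ => dbar u ζ / (ζ - z)) z]
  simp

/-- `|p|² + σ²`. -/
def regSq (p : ℂ → ℂ) (σ : ℝ) (z : ℂ) : ℝ := ‖p z‖ ^ 2 + σ ^ 2

lemma sq_le_regSq (p : ℂ → ℂ) (σ : ℝ) (z : ℂ) : σ ^ 2 ≤ regSq p σ z := by
  unfold regSq; nlinarith [sq_nonneg ‖p z‖]

lemma regSq_pos (p : ℂ → ℂ) {σ : ℝ} (hσ : 0 < σ) (z : ℂ) : 0 < regSq p σ z :=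
  (by positivity : 0 < σ ^ 2).trans_le (sq_le_regSq p σ z)

lemma contDiff_real_of_holomorphic {p : ℂ → ℂ} (hp : Differentiable ℂ p) {n : ℕ∞} :
    ContDiff ℝ n p :=
  (hp.contDiff (n := n)).restrict_scalars ℝ

lemma contDiff_regSq {p : ℂ → ℂ} (hp : Differentiable ℂ p) (σ : ℝ) :
    ContDiff ℝ 1 (regSq p σ) := by
  have := contDiff_real_of_holomorphic hp (n := 1)
  exact (this.norm_sq ℝ).add contDiff_const

lemma contDiff_regSq_rpow {p : ℂ → ℂ} (hp : Differentiable ℂ p) {σ : ℝ} (hσ : 0 < σ) (γ : ℝ) :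
    ContDiff ℝ 1 (fun z => regSq p σ z ^ γ) :=
  (contDiff_regSq hp σ).rpow_const_of_ne fun z => (regSq_pos p hσ z).ne'

lemma contDiff_ofReal_regSq_rpow {p : ℂ → ℂ} (hp : Differentiable ℂ p) {σ : ℝ} (hσ : 0 < σ)
    (γ : ℝ) : ContDiff ℝ 1 (fun z => ((regSq p σ z ^ γ : ℝ) : ℂ)) :=
  Complex.ofRealCLM.contDiff.comp (contDiff_regSq_rpow hp hσ γ)

lemma contDiff_conj {p : ℂ → ℂ} (hp : Differentiable ℂ p) :
    ContDiff ℝ 1 (fun z => conj (p z)) :=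
  Complex.conjCLE.contDiff.comp (contDiff_real_of_holomorphic hp (n := 1))

lemma dbar_regSq_rpow {p : ℂ → ℂ} (hp : Differentiable ℂ p) {σ : ℝ} (hσ : 0 < σ) (γ : ℝ) (z : ℂ) :
    dbar (fun ζ => ((regSq p σ ζ ^ γ : ℝ) : ℂ)) z =
      ((γ * regSq p σ z ^ (γ - 1) : ℝ) : ℂ) * (p z * conj (deriv p z)) := by
  rw [dbar_rpow ((contDiff_regSq hp σ).differentiable one_ne_zero z) (regSq_pos p hσ z).ne']
  congr 1
  have h1 : (fun ζ => (regSq p σ ζ : ℂ)) = fun ζ => p ζ * conj (p ζ) + (σ ^ 2 : ℂ) := by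
    funext ζ
    rw [Complex.mul_conj, Complex.normSq_eq_norm_sq]
    simp [regSq]
  have h2 : dbar (fun ζ => p ζ * conj (p ζ) + (σ ^ 2 : ℂ)) z =
      dbar (fun ζ => p ζ * conj (p ζ)) z := by
    unfold dbar; rw [fderiv_add_const]
  have hpr : DifferentiableAt ℝ p z :=
    (contDiff_real_of_holomorphic hp (n := 1)).differentiable one_ne_zero z
  rw [h1, h2, dbar_mul hpr ((contDiff_conj hp).differentiable one_ne_zero z),
    dbar_holomorphic (hp z), dbar_conj_holomorphic (hp z)]
  ring

/-- A Caccioppoli type estimate for the subharmonic function `(|p|² + σ²)^α`. -/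
lemma integral_energy_le {p : ℂ → ℂ} (hp : Differentiable ℂ p) {χ : ℂ → ℝ}
    (hχ : ContDiff ℝ 1 χ) (hχs : HasCompactSupport χ) {σ α : ℝ} (hσ : 0 < σ) (hα : 0 < α)
    (hα1 : α ≤ 1) :
    ∫ z, χ z ^ 2 * ‖deriv p z‖ ^ 2 * regSq p σ z ^ (α - 1) ≤
      4 / α ^ 2 * ∫ z, ‖dbar (fun ζ => (χ ζ : ℂ)) z‖ ^ 2 * regSq p σ z ^ α := by
  set W := regSq p σ with hW
  set X : ℂ → ℂ := fun ζ => (χ ζ : ℂ) with hX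
  have hXc : ContDiff ℝ 1 X := Complex.ofRealCLM.contDiff.comp hχ
  have hXs : HasCompactSupport X := hχs.comp_left (g := ((↑) : ℝ → ℂ)) Complex.ofReal_zero
  have hdp : Differentiable ℂ (deriv p) := fun z =>
    (hp.analyticAt z).deriv.differentiableAt
  have hdpc : ContDiff ℝ 1 (deriv p) := contDiff_real_of_holomorphic hdp (n := 1)
  have hWpos : ∀ z, 0 < W z := regSq_pos p hσ
  have hWc : ∀ γ : ℝ, Continuous fun z => W z ^ γ := fun γ =>
    (contDiff_regSq_rpow hp hσ γ).continuous
  set Y : ℂ → ℂ := fun z => conj (p z) * ((W z ^ (α - 1) : ℝ) : ℂ) with hY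
  have hYc : ContDiff ℝ 1 Y := (contDiff_conj hp).mul (contDiff_ofReal_regSq_rpow hp hσ _)
  set V : ℂ → ℂ := fun z => (X z * X z) * (deriv p z * Y z) with hV
  have hXXc : ContDiff ℝ 1 fun z => X z * X z := hXc.mul hXc
  have hVc : ContDiff ℝ 1 V := hXXc.mul (hdpc.mul hYc)
  have hVs : HasCompactSupport V := (hXs.mul_right).mul_right
  have hd1 : ∀ {u : ℂ → ℂ}, ContDiff ℝ 1 u → ∀ z, DifferentiableAt ℝ u z :=
    fun h z => h.differentiable one_ne_zero z
  have hdV : ∀ z, dbar V z = 2 * X z * dbar X z * (deriv p z * Y z) +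
      ((χ z ^ 2 * ‖deriv p z‖ ^ 2 *
        (W z ^ (α - 1) + (α - 1) * W z ^ (α - 1 - 1) * ‖p z‖ ^ 2) : ℝ) : ℂ) := by
    intro z
    rw [hV, dbar_mul (hd1 hXXc z) (hd1 (hdpc.mul hYc) z), dbar_mul (hd1 hXc z) (hd1 hXc z),
      dbar_mul (hd1 hdpc z) (hd1 hYc z), dbar_holomorphic (hdp z), hY,
      dbar_mul (hd1 (contDiff_conj hp) z) (hd1 (contDiff_ofReal_regSq_rpow hp hσ _) z),
      dbar_conj_holomorphic (hp z), dbar_regSq_rpow hp hσ]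
    have e1 : (‖deriv p z‖ : ℂ) ^ 2 = deriv p z * conj (deriv p z) := by
      rw [Complex.mul_conj, Complex.normSq_eq_norm_sq]; push_cast; rfl
    have e2 : (‖p z‖ : ℂ) ^ 2 = p z * conj (p z) := by
      rw [Complex.mul_conj, Complex.normSq_eq_norm_sq]; push_cast; rfl
    push_cast
    rw [e1, e2, ← hW]
    simp only [hX]
    ring
  set N₁ : ℂ → ℝ := fun z => χ z ^ 2 * ‖deriv p z‖ ^ 2 * W z ^ (α - 1) with hN₁
  set N₂ : ℂ → ℝ := fun z => ‖dbar X z‖ ^ 2 * W z ^ α with hN₂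
  have hpt : ∀ z, α / 2 * N₁ z - 2 / α * N₂ z ≤ (dbar V z).re := by
    intro z
    have hpW : ‖p z‖ ^ 2 ≤ W z := by
      rw [hW, regSq]; nlinarith [sq_nonneg σ]
    have hs1 : W z ^ (α - 1) = W z ^ (α - 1 - 1) * W z := by
      rw [← Real.rpow_add_one (hWpos z).ne']; ring_nf
    have hs2 : W z ^ α = W z ^ (α - 1) * W z := by
      rw [← Real.rpow_add_one (hWpos z).ne']; ring_nf
    have hw2 : 0 < W z ^ (α - 1 - 1) := Real.rpow_pos_of_pos (hWpos z) _
    have hw1 : 0 < W z ^ (α - 1) := Real.rpow_pos_of_pos (hWpos z) _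
    have hT : α * N₁ z ≤ χ z ^ 2 * ‖deriv p z‖ ^ 2 *
        (W z ^ (α - 1) + (α - 1) * W z ^ (α - 1 - 1) * ‖p z‖ ^ 2) := by
      have : α * W z ^ (α - 1) ≤
          W z ^ (α - 1) + (α - 1) * W z ^ (α - 1 - 1) * ‖p z‖ ^ 2 := by
        have h3 : (1 - α) * W z ^ (α - 1 - 1) * ‖p z‖ ^ 2 ≤
            (1 - α) * W z ^ (α - 1 - 1) * W z := by
          have : 0 ≤ 1 - α := by linarith
          gcongr
        nlinarith
      calc α * N₁ z = χ z ^ 2 * ‖deriv p z‖ ^ 2 * (α * W z ^ (α - 1)) := by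
            simp only [hN₁]; ring
        _ ≤ _ := by gcongr
    have hS : ‖2 * X z * dbar X z * (deriv p z * Y z)‖ ≤ α / 2 * N₁ z + 2 / α * N₂ z := by
      have h4 : ‖2 * X z * dbar X z * (deriv p z * Y z)‖ =
          2 * (|χ z| * ‖deriv p z‖) * (‖dbar X z‖ * ‖p z‖) * W z ^ (α - 1) := by
        simp only [hX, hY, norm_mul, Complex.norm_real, RCLike.norm_conj, Real.norm_eq_abs,
          abs_of_pos hw1]
        simp
        ring
      rw [h4]
      set a := |χ z| * ‖deriv p z‖ with ha
      set b := ‖dbar X z‖ * ‖p z‖ with hb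
      have h5 : 2 * a * b ≤ α / 2 * a ^ 2 + 2 / α * b ^ 2 := by
        have h6 : 0 ≤ (α * a - 2 * b) ^ 2 / (2 * α) := by positivity
        have h7 : (α * a - 2 * b) ^ 2 / (2 * α) = α / 2 * a ^ 2 + 2 / α * b ^ 2 - 2 * a * b := by
          field_simp; ring
        linarith
      have h8 : a ^ 2 * W z ^ (α - 1) = N₁ z := by
        simp only [hN₁, ha, mul_pow, sq_abs]
      have h9 : b ^ 2 * W z ^ (α - 1) ≤ N₂ z := by
        simp only [hN₂, hb, mul_pow, hs2]
        calc ‖dbar X z‖ ^ 2 * ‖p z‖ ^ 2 * W z ^ (α - 1)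
            ≤ ‖dbar X z‖ ^ 2 * W z * W z ^ (α - 1) := by gcongr
          _ = _ := by ring
      calc 2 * a * b * W z ^ (α - 1)
          ≤ (α / 2 * a ^ 2 + 2 / α * b ^ 2) * W z ^ (α - 1) := by gcongr
        _ = α / 2 * N₁ z + 2 / α * (b ^ 2 * W z ^ (α - 1)) := by rw [← h8]; ring
        _ ≤ _ := by gcongr
    rw [hdV, Complex.add_re, Complex.ofReal_re]
    have h10 := (abs_le.mp ((Complex.abs_re_le_norm _).trans hS)).1
    linarith
  have hi₁ : Integrable N₁ := by
    refine Continuous.integrable_of_hasCompactSupport ?_ ?_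
    · exact ((hχ.continuous.pow 2).mul (hdpc.continuous.norm.pow 2)).mul (hWc _)
    · refine hχs.mono fun z hz => ?_
      contrapose! hz
      simp only [Function.mem_support, not_not] at hz ⊢
      simp [hN₁, hz]
  have hi₂ : Integrable N₂ := by
    refine Continuous.integrable_of_hasCompactSupport ?_ ?_
    · exact ((continuous_dbar hXc).norm.pow 2).mul (hWc _)
    · refine (hasCompactSupport_dbar hXs).mono fun z hz => ?_
      contrapose! hz
      simp only [Function.mem_support, not_not] at hz ⊢
      simp [hN₂, hz]
  have hiV : Integrable (dbar V) :=
    (continuous_dbar hVc).integrable_of_hasCompactSupport (hasCompactSupport_dbar hVs)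
  have hmono := integral_mono ((hi₁.const_mul (α / 2)).sub (hi₂.const_mul (2 / α))) hiV.re hpt
  have hre : ∫ z, RCLike.re (dbar V z) = 0 := by
    rw [integral_re hiV, integral_dbar_eq_zero hVc hVs]; simp
  rw [hre] at hmono
  simp only [Pi.sub_apply] at hmono
  rw [integral_sub (hi₁.const_mul _) (hi₂.const_mul _), integral_const_mul,
    integral_const_mul] at hmono
  have h11 : α / 2 * ∫ z, N₁ z ≤ 2 / α * ∫ z, N₂ z := by linarith
  calc ∫ z, N₁ z = 2 / α * (α / 2 * ∫ z, N₁ z) := by field_simp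
    _ ≤ 2 / α * (2 / α * ∫ z, N₂ z) := by gcongr
    _ = _ := by ring

/-- The Cauchy transform of a density vanishing on a disc is holomorphic on a smaller disc. -/
lemma differentiableOn_cauchyTransform {k : ℂ → ℂ} (hk : Continuous k) (hs : HasCompactSupport k)
    {c : ℝ} (hc : 0 < c) (h0 : ∀ ζ ∈ ball (0 : ℂ) (2 * c), k ζ = 0) :
    DifferentiableOn ℂ (fun z => ∫ ζ, k ζ / (ζ - z)) (ball 0 c) ∧
      ∀ z ∈ ball (0 : ℂ) c, ‖∫ ζ, k ζ / (ζ - z)‖ ≤ c⁻¹ * ∫ ζ, ‖k ζ‖ := by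
  have hki : Integrable k := hk.integrable_of_hasCompactSupport hs
  have hdist : ∀ z ∈ ball (0 : ℂ) c, ∀ ζ, k ζ ≠ 0 → c ≤ ‖ζ - z‖ := by
    intro z hz ζ hζ
    have h1 : ζ ∉ ball (0 : ℂ) (2 * c) := fun h => hζ (h0 ζ h)
    simp only [mem_ball, dist_zero_right, not_lt] at h1 hz
    linarith [norm_sub_norm_le ζ z]
  have hbd : ∀ z ∈ ball (0 : ℂ) c, ∀ ζ, ‖k ζ / (ζ - z)‖ ≤ c⁻¹ * ‖k ζ‖ := by
    intro z hz ζ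
    by_cases h : k ζ = 0
    · simp [h]
    · rw [norm_div, div_eq_inv_mul]
      gcongr
      exact hdist z hz ζ h
  have hmeas : ∀ z : ℂ, AEStronglyMeasurable (fun ζ => k ζ / (ζ - z)) volume := fun z =>
    (hk.measurable.div (measurable_id.sub_const z)).aestronglyMeasurable
  constructor
  · intro z hz
    have hder := hasDerivAt_integral_of_dominated_loc_of_deriv_le (𝕜 := ℂ) (μ := volume)
      (F := fun z ζ => k ζ / (ζ - z)) (F' := fun z ζ => k ζ / (ζ - z) ^ 2) (x₀ := z)
      (s := ball 0 c) (bound := fun ζ => (c ^ 2)⁻¹ * ‖k ζ‖) (isOpen_ball.mem_nhds hz)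
      (Eventually.of_forall fun z => hmeas z)
      ((hki.norm.const_mul c⁻¹).mono' (hmeas z) (Eventually.of_forall (hbd z hz)))
      ((hk.measurable.div ((measurable_id.sub_const z).pow_const 2)).aestronglyMeasurable)
      (Eventually.of_forall fun ζ z hz => by
        by_cases h : k ζ = 0
        · simp [h]
        · rw [norm_div, div_eq_inv_mul, norm_pow]
          gcongr
          exact hdist z hz ζ h)
      (hki.norm.const_mul _)
      (Eventually.of_forall fun ζ z hz => by
        by_cases h : k ζ = 0
        · simp only [h, zero_div]; exact hasDerivAt_const z 0
        · have hne : ζ - z ≠ 0 := fun h1 => by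
            have := hdist z hz ζ h
            rw [h1, norm_zero] at this
            linarith
          have := ((hasDerivAt_id z).const_sub ζ).inv hne |>.const_mul (k ζ)
          simp only [div_eq_mul_inv]
          refine this.congr_deriv ?_
          simp [div_eq_mul_inv])
    exact hder.2.differentiableAt.differentiableWithinAt
  · intro z hz
    rw [← integral_const_mul]
    exact norm_integral_le_of_norm_le (hki.norm.const_mul _) (Eventually.of_forall (hbd z hz))

lemma exists_integral_norm_rpow_bound {q : ℝ} (hq : q < 2) :
    ∃ I : ℝ, 0 ≤ I ∧ ∀ z ∈ ball (0 : ℂ) 1,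
      IntegrableOn (fun ζ : ℂ => (‖ζ - z‖⁻¹) ^ q) (ball 0 1) ∧
      ∫ ζ in ball (0 : ℂ) 1, (‖ζ - z‖⁻¹) ^ q ≤ I := by
  have h1 : Integrable (fun ζ : ℂ => (Iio (2 : ℝ)).indicator (fun r => (r⁻¹) ^ q) ‖ζ‖) := by
    rw [integrable_fun_norm_addHaar (μ := (volume : Measure ℂ))
      (f := (Iio (2 : ℝ)).indicator (fun r => (r⁻¹) ^ q))]
    have h2 : IntegrableOn (fun r : ℝ => r ^ (1 - q)) (Ioo 0 2) :=
      (intervalIntegral.integrableOn_Ioo_rpow_iff (by norm_num)).mpr (by linarith)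
    have h3 : IntegrableOn (fun r : ℝ => r ^ (Module.finrank ℝ ℂ - 1) •
        (Iio (2 : ℝ)).indicator (fun r => (r⁻¹) ^ q) r) (Ioo 0 2) := by
      refine h2.congr_fun (fun r hr => ?_) measurableSet_Ioo
      have hr0 : 0 < r := hr.1
      simp only [Complex.finrank_real_complex, indicator_of_mem (show r ∈ Iio (2 : ℝ) from hr.2),
        smul_eq_mul]
      rw [Real.inv_rpow hr0.le, Real.rpow_sub hr0, Real.rpow_one]
      simp [div_eq_mul_inv]
    refine h3.of_forall_sdiff_eq_zero measurableSet_Ioi ?_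
    rintro r ⟨hr, hr2⟩
    have : r ∉ Iio (2 : ℝ) := fun h => hr2 ⟨hr, h⟩
    simp [indicator_of_notMem this]
  have hnn : ∀ ζ : ℂ, 0 ≤ (Iio (2 : ℝ)).indicator (fun r => (r⁻¹) ^ q) ‖ζ‖ := fun ζ =>
    indicator_apply_nonneg fun _ => by positivity
  refine ⟨∫ ζ : ℂ, (Iio (2 : ℝ)).indicator (fun r => (r⁻¹) ^ q) ‖ζ‖,
    integral_nonneg hnn, fun z hz => ?_⟩
  have h4 := h1.comp_sub_right z
  have h5 : EqOn (fun ζ : ℂ => (Iio (2 : ℝ)).indicator (fun r => (r⁻¹) ^ q) ‖ζ - z‖)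
      (fun ζ : ℂ => (‖ζ - z‖⁻¹) ^ q) (ball 0 1) := by
    intro ζ hζ
    have : ‖ζ - z‖ ∈ Iio (2 : ℝ) := by
      simp only [mem_ball, dist_zero_right] at hζ hz
      exact (norm_sub_le _ _).trans_lt (by linarith)
    simp [indicator_of_mem this]
  refine ⟨h4.integrableOn.congr_fun h5 measurableSet_ball, ?_⟩
  rw [← setIntegral_congr_fun measurableSet_ball h5]
  exact (setIntegral_le_integral h4 (Eventually.of_forall fun ζ => hnn _)).trans_eq
    (integral_sub_right_eq_self
      (fun ζ : ℂ => (Iio (2 : ℝ)).indicator (fun r => (r⁻¹) ^ q) ‖ζ‖) z)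

lemma exists_integral_mul_inv_norm_le {ε : ℝ} (hε : 0 < ε) :
    ∃ I : ℝ, 0 ≤ I ∧ ∀ τ : ℂ → ℝ, Continuous τ → HasCompactSupport τ → (∀ ζ, 0 ≤ τ ζ) →
      (∀ ζ ∉ ball (0 : ℂ) 1, τ ζ = 0) → ∀ N : ℝ, (∀ ζ, τ ζ ≤ N) → ∀ z ∈ ball (0 : ℂ) 1,
        Integrable (fun ζ => τ ζ * ‖ζ - z‖⁻¹) ∧
          ∫ ζ, τ ζ * ‖ζ - z‖⁻¹ ≤ N ^ ε * (∫ ζ, τ ζ ^ 2) + I := by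
  set q : ℝ := (2 + ε) / (1 + ε) with hq
  have hq2 : q < 2 := by rw [hq, div_lt_iff₀ (by positivity)]; linarith
  have hpq : (2 + ε).HolderConjugate q := by
    rw [Real.holderConjugate_iff_eq_conjExponent (by linarith)]
    rw [hq]; congr 1; ring
  obtain ⟨I, hI, hIb⟩ := exists_integral_norm_rpow_bound hq2
  refine ⟨I, hI, fun τ hc hs h0 hsupp N hN z hz => ?_⟩
  have hN0 : 0 ≤ N := (h0 0).trans (hN 0)
  obtain ⟨hi, hle⟩ := hIb z hz
  set κ : ℂ → ℝ := (ball (0 : ℂ) 1).indicator (fun ζ => (‖ζ - z‖⁻¹) ^ q) with hκ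
  have hκi : Integrable κ := hi.integrable_indicator measurableSet_ball
  have hκI : ∫ ζ, κ ζ ≤ I := by rwa [hκ, integral_indicator measurableSet_ball]
  have hτi : Integrable (fun ζ => τ ζ ^ 2) := by
    refine (hc.pow 2).integrable_of_hasCompactSupport (hs.mono fun ζ hζ => ?_)
    intro h; apply hζ; simp [h]
  have hbound : ∀ ζ, τ ζ * ‖ζ - z‖⁻¹ ≤ N ^ ε * τ ζ ^ 2 + κ ζ := by
    intro ζ
    by_cases hζ : ζ ∈ ball (0 : ℂ) 1
    · rw [hκ, indicator_of_mem hζ]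
      have hy := Real.young_inequality_of_nonneg (h0 ζ) (inv_nonneg.2 (norm_nonneg (ζ - z))) hpq
      have h1 : τ ζ ^ (2 + ε) ≤ N ^ ε * τ ζ ^ 2 := by
        rcases (h0 ζ).eq_or_lt with h | h
        · rw [← h, Real.zero_rpow (by positivity)]; simp
        · rw [Real.rpow_add h, mul_comm]
          gcongr
          · exact hN ζ
          · norm_num
      have h2 : τ ζ ^ (2 + ε) / (2 + ε) ≤ τ ζ ^ (2 + ε) :=
        div_le_self (Real.rpow_nonneg (h0 ζ) _) (by linarith)
      have h3 : (‖ζ - z‖⁻¹) ^ q / q ≤ (‖ζ - z‖⁻¹) ^ q :=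
        div_le_self (by positivity) hpq.symm.lt.le
      linarith
    · rw [hκ, indicator_of_notMem hζ, hsupp ζ hζ]; simp
  have hgi : Integrable (fun ζ => N ^ ε * τ ζ ^ 2 + κ ζ) := (hτi.const_mul _).add hκi
  have hint : Integrable (fun ζ => τ ζ * ‖ζ - z‖⁻¹) := by
    refine hgi.mono' ?_ (Eventually.of_forall fun ζ => ?_)
    · exact (hc.measurable.mul (by fun_prop)).aestronglyMeasurable
    · rw [Real.norm_of_nonneg (mul_nonneg (h0 ζ) (by positivity))]; exact hbound ζ
  refine ⟨hint, (integral_mono hint hgi hbound).trans ?_⟩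
  rw [integral_add (hτi.const_mul _) hκi, integral_const_mul]
  linarith

lemma dbar_quotient {p q : ℂ → ℂ} (hp : Differentiable ℂ p) (hq : Differentiable ℂ q)
    {σ : ℝ} (hσ : 0 < σ) (z : ℂ) :
    dbar (fun ζ => conj (p ζ) * q ζ * ((regSq p σ ζ ^ (-1 : ℝ) : ℝ) : ℂ)) z =
      q z * conj (deriv p z) * ((σ ^ 2 * regSq p σ z ^ (-2 : ℝ) : ℝ) : ℂ) := by
  have hW := regSq_pos p hσ z
  have h1 : DifferentiableAt ℝ (fun ζ => conj (p ζ)) z :=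
    (contDiff_conj hp).differentiable one_ne_zero z
  have h2 : DifferentiableAt ℝ q z := (hq z).restrictScalars ℝ
  have h3 : DifferentiableAt ℝ (fun ζ => ((regSq p σ ζ ^ (-1 : ℝ) : ℝ) : ℂ)) z :=
    (contDiff_ofReal_regSq_rpow hp hσ (-1)).differentiable one_ne_zero z
  have h12 : DifferentiableAt ℝ (fun ζ => conj (p ζ) * q ζ) z := h1.mul h2
  rw [dbar_mul h12 h3, dbar_mul h1 h2, dbar_holomorphic (hq z),
    dbar_conj_holomorphic (hp z), dbar_regSq_rpow hp hσ]
  have h4 : regSq p σ z ^ (-1 : ℝ) = regSq p σ z * regSq p σ z ^ (-2 : ℝ) := by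
    rw [← Real.rpow_one_add' hW.le (by norm_num)]; norm_num
  rw [show (-1 : ℝ) - 1 = -2 by norm_num, h4]
  have h5 : ((regSq p σ z : ℝ) : ℂ) = p z * conj (p z) + (σ : ℂ) ^ 2 := by
    rw [Complex.mul_conj, Complex.normSq_eq_norm_sq]
    simp [regSq]
  push_cast
  rw [h5]
  ring

lemma norm_deriv_le_of_bound {p : ℂ → ℂ} (hp : Differentiable ℂ p) {A : ℝ}
    (hpA : ∀ z ∈ ball (0 : ℂ) 1, ‖p z‖ ≤ A) {z : ℂ} (hz : z ∈ ball (0 : ℂ) (1 / 2)) :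
    ‖deriv p z‖ ≤ 2 * A := by
  have := Complex.norm_deriv_le_of_forall_mem_sphere_norm_le (c := z) (R := 1 / 2) (C := A)
    (f := p) (by norm_num) hp.diffContOnCl (fun w hw => hpA w (by
      rw [mem_sphere, dist_eq_norm] at hw
      rw [mem_ball_zero_iff] at hz ⊢
      have := norm_add_le (w - z) z
      rw [sub_add_cancel] at this
      linarith))
  linarith

lemma exists_holomorphic_near_quotient {β A K : ℝ} (hβ : 0 < β) (hβ1 : β ≤ 1) (hA : 1 ≤ A)
    (hK : 0 ≤ K) :
    ∃ C : ℝ, 0 ≤ C ∧ ∀ σ : ℝ, 0 < σ → σ ≤ 1 → ∀ p q : ℂ → ℂ, Differentiable ℂ p →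
      Differentiable ℂ q → (∀ z ∈ ball (0 : ℂ) 1, ‖p z‖ ≤ A) →
      (∀ z ∈ ball (0 : ℂ) (1 / 16), ‖q z‖ ≤ K * regSq p σ z ^ ((1 + β) / 2)) →
      ∃ F : ℂ → ℂ, DifferentiableOn ℂ F (ball 0 (1 / 80)) ∧
        ∀ z ∈ ball (0 : ℂ) (1 / 80), ‖F z‖ ≤ C ∧
          ‖conj (p z) * q z * ((regSq p σ z ^ (-1 : ℝ) : ℝ) : ℂ) - F z‖ ≤ C * σ ^ (β / 4) := by
  let χ : ContDiffBump (0 : ℂ) := ⟨1 / 40, 1 / 20, by norm_num, by norm_num⟩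
  have hχ : ContDiff ℝ 1 χ := χ.contDiff
  have hχs : HasCompactSupport χ := χ.hasCompactSupport
  set X : ℂ → ℂ := fun ζ => (χ ζ : ℂ) with hX
  have hXc : ContDiff ℝ 1 X := Complex.ofRealCLM.contDiff.comp hχ
  have hXs : HasCompactSupport X := hχs.comp_left Complex.ofReal_zero
  have hdXc : Continuous (dbar X) := continuous_dbar hXc
  have hdXs : HasCompactSupport (dbar X) := hasCompactSupport_dbar hXs
  have hχ0 : ∀ ζ ∉ ball (0 : ℂ) (1 / 20), χ ζ = 0 := fun ζ hζ => by
    have := χ.support_eq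
    by_contra h
    exact hζ (this ▸ h : ζ ∈ ball (0 : ℂ) χ.rOut)
  have hdX0 : ∀ ζ ∉ ball (0 : ℂ) (1 / 16), dbar X ζ = 0 := by
    intro ζ hζ
    have h : X =ᶠ[𝓝 ζ] fun _ => 0 := by
      have : (closedBall (0 : ℂ) (1 / 20))ᶜ ∈ 𝓝 ζ :=
        isClosed_closedBall.isOpen_compl.mem_nhds fun h => hζ (by
          simp only [mem_closedBall, mem_ball] at h ⊢; linarith)
      filter_upwards [this] with w hw
      simp [hX, hχ0 w fun h => hw (ball_subset_closedBall h)]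
    simp [dbar, h.fderiv_eq]
  have hdX1 : ∀ ζ ∈ ball (0 : ℂ) (2 * (1 / 80)), dbar X ζ = 0 := by
    intro ζ hζ
    have h : X =ᶠ[𝓝 ζ] fun _ => 1 := by
      filter_upwards [isOpen_ball.mem_nhds hζ] with w hw
      have : w ∈ closedBall (0 : ℂ) χ.rIn := by
        simp only [mem_ball, mem_closedBall, χ] at hw ⊢; linarith
      simp [hX, χ.one_of_mem_closedBall this]
    simp [dbar, h.fderiv_eq]
  set α : ℝ := β / 2 with hα
  obtain ⟨I, hI, hIb⟩ := exists_integral_mul_inv_norm_le (ε := β / 4) (by positivity)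
  set S₁ : ℝ := ∫ ζ, ‖dbar X ζ‖ with hS₁
  set S₂ : ℝ := ∫ ζ, ‖dbar X ζ‖ ^ 2 with hS₂
  have hS₁0 : 0 ≤ S₁ := integral_nonneg fun ζ => norm_nonneg _
  have hS₂0 : 0 ≤ S₂ := integral_nonneg fun ζ => by positivity
  set L : ℝ := 4 / α ^ 2 * (2 * A ^ 2 * S₂) with hL
  have hL0 : 0 ≤ L := by positivity
  set C₁ : ℝ := 80 * (2 * K * A ^ 2 * S₁) with hC₁
  set C₂ : ℝ := K * (2 * A * L + I) with hC₂
  have hC₁0 : 0 ≤ C₁ := by positivity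
  have hC₂0 : 0 ≤ C₂ := by positivity
  refine ⟨C₁ + C₂, by positivity, fun σ hσ hσ1 p q hp hq hpA hqW => ?_⟩
  set W := regSq p σ with hW
  have hWpos : ∀ z, 0 < W z := regSq_pos p hσ
  have hWσ : ∀ z, σ ^ 2 ≤ W z := sq_le_regSq p σ
  have hWA : ∀ z ∈ ball (0 : ℂ) 1, W z ≤ 2 * A ^ 2 := fun z hz => by
    have h1 := hpA z hz
    have h2 : ‖p z‖ ^ 2 ≤ A ^ 2 := by gcongr
    have h3 : σ ^ 2 ≤ A ^ 2 := by gcongr; linarith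
    simp only [hW, regSq]; linarith
  have hWγ : ∀ z ∈ ball (0 : ℂ) 1, ∀ γ : ℝ, 0 ≤ γ → γ ≤ 1 → W z ^ γ ≤ 2 * A ^ 2 := by
    intro z hz γ h0 h1
    calc W z ^ γ ≤ (2 * A ^ 2) ^ γ := Real.rpow_le_rpow (hWpos z).le (hWA z hz) h0
      _ ≤ (2 * A ^ 2) ^ (1 : ℝ) := Real.rpow_le_rpow_of_exponent_le (by nlinarith) h1
      _ = _ := Real.rpow_one _
  set F₁ : ℂ → ℂ := fun ζ => conj (p ζ) * q ζ * ((W ζ ^ (-1 : ℝ) : ℝ) : ℂ) with hF₁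
  have hF₁c : ContDiff ℝ 1 F₁ :=
    ((contDiff_conj hp).mul (contDiff_real_of_holomorphic hq (n := 1))).mul
      (contDiff_ofReal_regSq_rpow hp hσ (-1))
  have hsub : ball (0 : ℂ) (1 / 16) ⊆ ball 0 1 := ball_subset_ball (by norm_num)
  have hF₁b : ∀ z ∈ ball (0 : ℂ) (1 / 16), ‖F₁ z‖ ≤ 2 * K * A ^ 2 := by
    intro z hz
    have hw := hWpos z
    have hpW : ‖p z‖ ≤ W z ^ (1 / 2 : ℝ) := by
      rw [← Real.sqrt_eq_rpow]
      exact Real.le_sqrt_of_sq_le (by simp only [hW, regSq]; nlinarith [sq_nonneg σ])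
    have h1 : ‖F₁ z‖ = ‖p z‖ * ‖q z‖ * W z ^ (-1 : ℝ) := by
      simp only [hF₁, norm_mul, RCLike.norm_conj, Complex.norm_real,
        Real.norm_of_nonneg (Real.rpow_nonneg hw.le _)]
    rw [h1]
    calc ‖p z‖ * ‖q z‖ * W z ^ (-1 : ℝ)
        ≤ W z ^ (1 / 2 : ℝ) * (K * W z ^ ((1 + β) / 2)) * W z ^ (-1 : ℝ) := by
          gcongr; exact hqW z hz
      _ = K * (W z ^ (1 / 2 : ℝ) * W z ^ ((1 + β) / 2) * W z ^ (-1 : ℝ)) := by ring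
      _ = K * W z ^ (β / 2) := by
          rw [← Real.rpow_add hw, ← Real.rpow_add hw]; congr 2; ring
      _ ≤ K * (2 * A ^ 2) := by
          gcongr; exact hWγ z (hsub hz) _ (by positivity) (by linarith)
      _ = _ := by ring
  set T : ℂ → ℝ := fun ζ => χ ζ * ‖deriv p ζ‖ * W ζ ^ ((α - 1) / 2) with hT
  have hdp : Continuous (deriv p) := by
    have := hp.contDiff (n := 1)
    exact this.continuous_deriv le_rfl
  have hTc : Continuous T :=
    ((χ.continuous.mul hdp.norm)).mul (contDiff_regSq_rpow hp hσ _).continuous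
  have hTs : HasCompactSupport T := (hχs.mul_right).mul_right
  have hT0 : ∀ ζ, 0 ≤ T ζ := fun ζ =>
    mul_nonneg (mul_nonneg χ.nonneg (norm_nonneg _)) (Real.rpow_nonneg (hWpos ζ).le _)
  have hTsupp : ∀ ζ ∉ ball (0 : ℂ) 1, T ζ = 0 := fun ζ hζ => by
    simp [hT, hχ0 ζ fun h => hζ (ball_subset_ball (by norm_num) h)]
  have hTN : ∀ ζ, T ζ ≤ 2 * A * σ⁻¹ := by
    intro ζ
    by_cases hζ : ζ ∈ ball (0 : ℂ) (1 / 20)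
    · have h1 : ‖deriv p ζ‖ ≤ 2 * A :=
        norm_deriv_le_of_bound hp hpA (ball_subset_ball (by norm_num) hζ)
      have h2 : W ζ ^ ((α - 1) / 2) ≤ σ⁻¹ := by
        calc W ζ ^ ((α - 1) / 2) ≤ (σ ^ 2) ^ ((α - 1) / 2) :=
              Real.rpow_le_rpow_of_nonpos (by positivity) (hWσ ζ) (by linarith)
          _ = σ ^ (α - 1) := by
              rw [← Real.rpow_natCast, ← Real.rpow_mul hσ.le]; congr 1; push_cast; ring
          _ ≤ σ ^ (-1 : ℝ) := Real.rpow_le_rpow_of_exponent_ge hσ hσ1 (by linarith [hα])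
          _ = σ⁻¹ := Real.rpow_neg_one σ
      calc T ζ ≤ 1 * (2 * A) * σ⁻¹ := by
            simp only [hT]
            have := χ.le_one (x := ζ)
            have := χ.nonneg (x := ζ)
            have := Real.rpow_nonneg (hWpos ζ).le ((α - 1) / 2)
            gcongr
        _ = _ := by ring
    · rw [hT]; simp only [hχ0 ζ hζ]; simp; positivity
  have hTsq : ∫ ζ, T ζ ^ 2 ≤ L := by
    have h1 : ∀ ζ, T ζ ^ 2 = χ ζ ^ 2 * ‖deriv p ζ‖ ^ 2 * W ζ ^ (α - 1) := by
      intro ζ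
      simp only [hT, mul_pow]
      rw [← Real.rpow_natCast (W ζ ^ _), ← Real.rpow_mul (hWpos ζ).le]
      congr 2; push_cast; ring
    simp only [h1]
    refine (integral_energy_le hp hχ hχs hσ (by positivity) (by linarith)).trans ?_
    rw [hL]
    gcongr
    rw [hS₂, ← integral_const_mul]
    refine integral_mono_of_nonneg (Eventually.of_forall fun ζ => ?_) ?_
      (Eventually.of_forall fun ζ => ?_)
    · exact mul_nonneg (by positivity) (Real.rpow_nonneg (hWpos ζ).le _)
    · refine Integrable.const_mul ?_ _
      refine (hdXc.norm.pow 2).integrable_of_hasCompactSupport (hdXs.mono fun ζ hζ => ?_)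
      intro h; apply hζ; simp [h]
    · by_cases hζ : ζ ∈ ball (0 : ℂ) (1 / 16)
      · change ‖dbar X ζ‖ ^ 2 * W ζ ^ α ≤ 2 * A ^ 2 * ‖dbar X ζ‖ ^ 2
        rw [mul_comm]
        gcongr
        exact hWγ ζ (hsub hζ) _ (by positivity) (by linarith)
      · change ‖dbar X ζ‖ ^ 2 * W ζ ^ α ≤ 2 * A ^ 2 * ‖dbar X ζ‖ ^ 2
        simp [hdX0 ζ hζ]
  have hdF : ∀ ζ, ‖X ζ * dbar F₁ ζ‖ ≤ K * σ ^ (β / 2) * T ζ := by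
    intro ζ
    by_cases hζ : ζ ∈ ball (0 : ℂ) (1 / 20)
    · have hζ' : ζ ∈ ball (0 : ℂ) (1 / 16) := ball_subset_ball (by norm_num) hζ
      have hw := hWpos ζ
      have h1 : ‖X ζ * dbar F₁ ζ‖ =
          χ ζ * (‖q ζ‖ * ‖deriv p ζ‖ * (σ ^ 2 * W ζ ^ (-2 : ℝ))) := by
        rw [hF₁, hW, dbar_quotient hp hq hσ ζ]
        simp only [hX, norm_mul, RCLike.norm_conj, Complex.norm_real]
        rw [Real.norm_of_nonneg χ.nonneg, Real.norm_of_nonneg (sq_nonneg σ),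
          Real.norm_of_nonneg (Real.rpow_nonneg (regSq_pos p hσ ζ).le _)]
      have h2 : σ ^ 2 * W ζ ^ (β / 4 - 1) ≤ σ ^ (β / 2) := by
        have h3 : W ζ ^ (β / 4 - 1) ≤ (σ ^ 2) ^ (β / 4 - 1) :=
          Real.rpow_le_rpow_of_nonpos (by positivity) (hWσ ζ) (by linarith)
        calc σ ^ 2 * W ζ ^ (β / 4 - 1) ≤ σ ^ 2 * (σ ^ 2) ^ (β / 4 - 1) := by gcongr
          _ = σ ^ (β / 2) := by
              rw [← Real.rpow_natCast, ← Real.rpow_mul hσ.le, ← Real.rpow_add hσ]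
              congr 1; push_cast; ring
      have hpow : W ζ ^ ((1 + β) / 2) * W ζ ^ (-2 : ℝ) =
          W ζ ^ (β / 4 - 1) * W ζ ^ ((α - 1) / 2) := by
        rw [← Real.rpow_add hw, ← Real.rpow_add hw]; congr 1; rw [hα]; ring
      have hχn := χ.nonneg (x := ζ)
      have hwn := Real.rpow_nonneg hw.le ((α - 1) / 2)
      rw [h1]
      calc χ ζ * (‖q ζ‖ * ‖deriv p ζ‖ * (σ ^ 2 * W ζ ^ (-2 : ℝ)))
          ≤ χ ζ * (K * W ζ ^ ((1 + β) / 2) * ‖deriv p ζ‖ * (σ ^ 2 * W ζ ^ (-2 : ℝ))) := by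
            gcongr; exact hqW ζ hζ'
        _ = χ ζ * K * ‖deriv p ζ‖ * σ ^ 2 * (W ζ ^ ((1 + β) / 2) * W ζ ^ (-2 : ℝ)) := by ring
        _ = K * (σ ^ 2 * W ζ ^ (β / 4 - 1)) * (χ ζ * ‖deriv p ζ‖ * W ζ ^ ((α - 1) / 2)) := by
            rw [hpow]; ring
        _ ≤ K * σ ^ (β / 2) * T ζ := by
            simp only [hT]; gcongr
    · have : X ζ = 0 := by simp [hX, hχ0 ζ hζ]
      rw [this]; simp
      exact mul_nonneg (by positivity) (hT0 ζ)
  set k : ℂ → ℂ := fun ζ => dbar X ζ * F₁ ζ with hk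
  have hkc : Continuous k := hdXc.mul hF₁c.continuous
  have hks : HasCompactSupport k := hdXs.mul_right
  obtain ⟨hGd, hGb⟩ := differentiableOn_cauchyTransform hkc hks (c := 1 / 80) (by norm_num)
    (fun ζ hζ => by simp [hk, hdX1 ζ hζ])
  have hpi : (1 : ℝ) ≤ Real.pi := by linarith [Real.two_le_pi]
  have hpi1 : ‖(-(Real.pi : ℂ)⁻¹)‖ ≤ 1 := by
    rw [norm_neg, norm_inv, Complex.norm_real, Real.norm_of_nonneg (by linarith)]
    exact inv_le_one_of_one_le₀ hpi
  refine ⟨fun z => -(Real.pi : ℂ)⁻¹ * ∫ ζ, k ζ / (ζ - z), hGd.const_mul _, fun z hz => ⟨?_, ?_⟩⟩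
  · have h1 : ∫ ζ, ‖k ζ‖ ≤ 2 * K * A ^ 2 * S₁ := by
      rw [hS₁, ← integral_const_mul]
      refine integral_mono_of_nonneg (Eventually.of_forall fun ζ => norm_nonneg _)
        ((hdXc.integrable_of_hasCompactSupport hdXs).norm.const_mul _)
        (Eventually.of_forall fun ζ => ?_)
      by_cases hζ : ζ ∈ ball (0 : ℂ) (1 / 16)
      · simp only [hk, norm_mul]
        rw [mul_comm]
        gcongr
        exact hF₁b ζ hζ
      · simp [hk, hdX0 ζ hζ]
    rw [norm_mul]
    calc _ ≤ 1 * ((1 / 80 : ℝ)⁻¹ * ∫ ζ, ‖k ζ‖) := by gcongr; exact hGb z hz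
      _ ≤ 1 * ((1 / 80 : ℝ)⁻¹ * (2 * K * A ^ 2 * S₁)) := by gcongr
      _ = C₁ := by rw [hC₁]; ring
      _ ≤ C₁ + C₂ := by linarith
  · obtain ⟨hTi, hTb⟩ := hIb T hTc hTs hT0 hTsupp _ hTN z (ball_subset_ball (by norm_num) hz)
    have hu : ContDiff ℝ 1 (fun ζ => X ζ * F₁ ζ) := hXc.mul hF₁c
    have hPom := integral_dbar_div_sub hu hXs.mul_right z
    have hdu : ∀ ζ, dbar (fun ζ => X ζ * F₁ ζ) ζ = k ζ + X ζ * dbar F₁ ζ := fun ζ =>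
      dbar_mul (hXc.differentiable one_ne_zero ζ) (hF₁c.differentiable one_ne_zero ζ)
    have hXz : X z = 1 := by
      have : z ∈ closedBall (0 : ℂ) χ.rIn := by
        simp only [mem_ball, mem_closedBall, χ] at hz ⊢; linarith
      simp [hX, χ.one_of_mem_closedBall this]
    have hb : ∀ ζ, ‖X ζ * dbar F₁ ζ / (ζ - z)‖ ≤
        K * σ ^ (β / 2) * (T ζ * ‖ζ - z‖⁻¹) := fun ζ => by
      rw [norm_div, div_eq_mul_inv, ← mul_assoc]
      gcongr
      exact hdF ζ
    have hbi : Integrable (fun ζ => K * σ ^ (β / 2) * (T ζ * ‖ζ - z‖⁻¹)) := hTi.const_mul _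
    have hi₂ : Integrable (fun ζ => X ζ * dbar F₁ ζ / (ζ - z)) := by
      refine hbi.mono' ?_ (Eventually.of_forall hb)
      have : Continuous (fun ζ => X ζ * dbar F₁ ζ) :=
        hXc.continuous.mul (continuous_dbar hF₁c)
      exact (this.measurable.div (by fun_prop)).aestronglyMeasurable
    have hi₁ : Integrable (fun ζ => k ζ / (ζ - z)) := by
      refine ((hkc.integrable_of_hasCompactSupport hks).norm.const_mul 80).mono'
        (hkc.measurable.div (by fun_prop)).aestronglyMeasurable (Eventually.of_forall fun ζ => ?_)
      by_cases hζ : ζ ∈ ball (0 : ℂ) (2 * (1 / 80))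
      · simp [hk, hdX1 ζ hζ]
      · have : (1 / 80 : ℝ) ≤ ‖ζ - z‖ := by
          simp only [mem_ball, dist_zero_right, not_lt] at hζ hz
          have := norm_sub_norm_le ζ z
          linarith
        rw [norm_div, div_eq_inv_mul]
        gcongr
        exact (inv_anti₀ (by norm_num) this).trans_eq (by norm_num)
    have hsplit : -(Real.pi * (X z * F₁ z) : ℂ) =
        (∫ ζ, k ζ / (ζ - z)) + ∫ ζ, X ζ * dbar F₁ ζ / (ζ - z) := by
      rw [← hPom, ← integral_add hi₁ hi₂]
      congr 1; funext ζ; rw [hdu, add_div]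
    have hpi0 : (Real.pi : ℂ) ≠ 0 := by exact_mod_cast Real.pi_ne_zero
    have hdiff : F₁ z - -(Real.pi : ℂ)⁻¹ * ∫ ζ, k ζ / (ζ - z) =
        -(Real.pi : ℂ)⁻¹ * ∫ ζ, X ζ * dbar F₁ ζ / (ζ - z) := by
      rw [hXz, one_mul] at hsplit
      have h1 := congrArg (fun w => -(Real.pi : ℂ)⁻¹ * w) hsplit
      have h2 : -(Real.pi : ℂ)⁻¹ * -(Real.pi * F₁ z) = F₁ z := by field_simp
      rw [h2] at h1
      rw [h1]; ring
    change ‖F₁ z - -(Real.pi : ℂ)⁻¹ * ∫ ζ, k ζ / (ζ - z)‖ ≤ _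
    rw [hdiff, norm_mul]
    have hNpow : (2 * A * σ⁻¹) ^ (β / 4) ≤ 2 * A * σ ^ (-(β / 4)) := by
      rw [Real.mul_rpow (by positivity) (by positivity), Real.inv_rpow hσ.le, Real.rpow_neg hσ.le]
      gcongr
      calc (2 * A) ^ (β / 4) ≤ (2 * A) ^ (1 : ℝ) :=
            Real.rpow_le_rpow_of_exponent_le (by linarith) (by linarith)
        _ = 2 * A := Real.rpow_one _
    have hσ4 : σ ^ (β / 2) * σ ^ (-(β / 4)) = σ ^ (β / 4) := by
      rw [← Real.rpow_add hσ]; congr 1; ring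
    have hσ2 : σ ^ (β / 2) ≤ σ ^ (β / 4) :=
      Real.rpow_le_rpow_of_exponent_ge hσ hσ1 (by linarith)
    calc _ ≤ 1 * ∫ ζ, K * σ ^ (β / 2) * (T ζ * ‖ζ - z‖⁻¹) := by
          gcongr; exact norm_integral_le_of_norm_le hbi (Eventually.of_forall hb)
      _ = K * σ ^ (β / 2) * ∫ ζ, T ζ * ‖ζ - z‖⁻¹ := by rw [one_mul, integral_const_mul]
      _ ≤ K * σ ^ (β / 2) * (2 * A * σ ^ (-(β / 4)) * L + I) := by
          gcongr
          refine hTb.trans ?_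
          have : 0 ≤ ∫ ζ, T ζ ^ 2 := integral_nonneg fun ζ => by positivity
          gcongr
      _ = K * (2 * A * L * (σ ^ (β / 2) * σ ^ (-(β / 4))) + I * σ ^ (β / 2)) := by ring
      _ ≤ K * (2 * A * L * σ ^ (β / 4) + I * σ ^ (β / 4)) := by rw [hσ4]; gcongr
      _ = C₂ * σ ^ (β / 4) := by rw [hC₂]; ring
      _ ≤ (C₁ + C₂) * σ ^ (β / 4) := by gcongr; linarith

lemma norm_pow_sub_pow_le_of_norm_le {x y : ℂ} {B : ℝ} (hx : ‖x‖ ≤ B) (hy : ‖y‖ ≤ B) (n : ℕ) :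
    ‖x ^ (n + 1) - y ^ (n + 1)‖ ≤ (n + 1) * B ^ n * ‖x - y‖ := by
  have hB : 0 ≤ B := (norm_nonneg x).trans hx
  induction n with
  | zero => simp
  | succ n ih =>
    have h : x ^ (n + 1 + 1) - y ^ (n + 1 + 1) =
        x * (x ^ (n + 1) - y ^ (n + 1)) + (x - y) * y ^ (n + 1) := by ring
    rw [h]
    calc _ ≤ ‖x‖ * ‖x ^ (n + 1) - y ^ (n + 1)‖ + ‖x - y‖ * ‖y‖ ^ (n + 1) := by
          refine (norm_add_le _ _).trans ?_
          rw [norm_mul, norm_mul, norm_pow]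
      _ ≤ B * ((n + 1) * B ^ n * ‖x - y‖) + ‖x - y‖ * B ^ (n + 1) := by gcongr
      _ = _ := by push_cast; ring

/-- If `φ ^ j` and `φ ^ (j + 1)` are approximated on an interval by bounded holomorphic functions,
then `φ` itself is approximated by a bounded holomorphic function on a smaller interval. -/
lemma exists_holomorphic_approx_of_pow {j : ℕ} (hj : 1 ≤ j) :
    ∃ θ : ℝ, 0 < θ ∧ ∀ A : ℝ, 1 ≤ A → ∃ A' : ℝ, 0 ≤ A' ∧
      ∀ η : ℝ, 0 < η → η ≤ 1 → ∀ p q : ℂ → ℂ, Differentiable ℂ p → Differentiable ℂ q →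
        (∀ z ∈ ball (0 : ℂ) 1, ‖p z‖ ≤ A) → (∀ z ∈ ball (0 : ℂ) 1, ‖q z‖ ≤ A) →
        ∀ φ : ℝ → ℂ, (∀ x : ℝ, |x| < 1 → ‖φ x ^ j - p x‖ ≤ A * η) →
          (∀ x : ℝ, |x| < 1 → ‖φ x ^ (j + 1) - q x‖ ≤ A * η) →
          ∃ F : ℂ → ℂ, DifferentiableOn ℂ F (ball 0 (1 / 80)) ∧
            (∀ z ∈ ball (0 : ℂ) (1 / 80), ‖F z‖ ≤ A') ∧
            ∀ x : ℝ, |x| < 1 / 80 → ‖φ x - F x‖ ≤ A' * η ^ θ := by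
  have hj0 : (0 : ℝ) < j := by exact_mod_cast hj
  have hj1 : (1 : ℝ) ≤ j := by exact_mod_cast hj
  have hjne : j ≠ 0 := by omega
  set β : ℝ := 1 / j with hβ
  have hβ0 : 0 < β := by positivity
  have hβ1 : β ≤ 1 := by rw [hβ, div_le_one hj0]; exact hj1
  refine ⟨1 / (8 * j * (j + 1)), by positivity, fun A hA => ?_⟩
  have hA0 : 0 < A := by linarith
  set K : ℝ := (2 * j + 1) * (2 * A) ^ (j + 1) with hK
  have hKpos : 0 < K := by positivity
  obtain ⟨C, hC, hmain⟩ := exists_holomorphic_near_quotient hβ0 hβ1 hA (K := 1 + K) (by positivity)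
  refine ⟨C + (3 * A ^ 2 + (1 + A)), by positivity, fun η hη hη1 p q hp hq hpA hqA φ h1 h2 => ?_⟩
  set σ : ℝ := η ^ (1 / (2 * (j + 1)) : ℝ) with hσdef
  have hσ : 0 < σ := Real.rpow_pos_of_pos hη _
  have hσ1 : σ ≤ 1 := Real.rpow_le_one hη.le hη1 (by positivity)
  have hσpow : σ ^ (j + 1) = Real.sqrt η := by
    rw [hσdef, ← Real.rpow_natCast, ← Real.rpow_mul hη.le, Real.sqrt_eq_rpow]
    congr 1; push_cast; field_simp
  have hησ : η = σ ^ (2 * (j + 1)) := by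
    rw [mul_comm, pow_mul, hσpow, Real.sq_sqrt hη.le]
  have hησ2 : η ≤ σ ^ 2 := by
    rw [hησ]; exact pow_le_pow_of_le_one hσ.le hσ1 (by omega)
  have hησ1 : η ≤ σ := hησ2.trans (by nlinarith)
  have hφj : ∀ x : ℝ, |x| < 1 → ‖φ x ^ j‖ ≤ 2 * A := fun x hx => by
    have := norm_add_le (φ x ^ j - p x) (p x)
    rw [sub_add_cancel] at this
    have h3 := hpA x (by simpa using hx)
    have h4 := h1 x hx
    nlinarith
  have hφj1 : ∀ x : ℝ, |x| < 1 → ‖φ x ^ (j + 1)‖ ≤ 2 * A := fun x hx => by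
    have := norm_add_le (φ x ^ (j + 1) - q x) (q x)
    rw [sub_add_cancel] at this
    have h3 := hqA x (by simpa using hx)
    have h4 := h2 x hx
    nlinarith
  have h2A : (1 : ℝ) ≤ 2 * A := by linarith
  have hEreal : ∀ x : ℝ, |x| < 1 → ‖q x ^ j - p x ^ (j + 1)‖ ≤ K * η := by
    intro x hx
    have hpx : ‖p x‖ ≤ 2 * A := (hpA x (by simpa using hx)).trans (by linarith)
    have hqx : ‖q x‖ ≤ 2 * A := (hqA x (by simpa using hx)).trans (by linarith)
    obtain ⟨i, rfl⟩ : ∃ i, j = i + 1 := ⟨j - 1, by omega⟩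
    have e1 := norm_pow_sub_pow_le_of_norm_le (hφj1 x hx) hqx i
    have e2 := norm_pow_sub_pow_le_of_norm_le (hφj x hx) hpx (i + 1)
    have e3 : q x ^ (i + 1) - p x ^ (i + 1 + 1) =
        ((φ x ^ (i + 1)) ^ (i + 1 + 1) - p x ^ (i + 1 + 1)) -
          ((φ x ^ (i + 1 + 1)) ^ (i + 1) - q x ^ (i + 1)) := by ring
    rw [e3]
    refine (norm_sub_le _ _).trans ?_
    have e4 : (2 * A) ^ i ≤ (2 * A) ^ (i + 1) := pow_le_pow_right₀ h2A (by omega)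
    calc _ ≤ (((i + 1 : ℕ) : ℝ) + 1) * (2 * A) ^ (i + 1) * (A * η) +
          (i + 1) * (2 * A) ^ (i + 1) * (A * η) := by
          refine add_le_add (e2.trans ?_) (e1.trans ?_)
          · gcongr; exact h1 x hx
          · gcongr; exact h2 x hx
      _ = (2 * ((i + 1 : ℕ) : ℝ) + 1) * (2 * A) ^ (i + 1) * (A * η) := by push_cast; ring
      _ ≤ (2 * ((i + 1 : ℕ) : ℝ) + 1) * (2 * A) ^ (i + 1) * (2 * A * η) := by gcongr; linarith
      _ = K * η := by rw [hK]; ring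
  have hEball : ∀ z ∈ ball (0 : ℂ) 1, ‖q z ^ j - p z ^ (j + 1)‖ ≤ K := by
    intro z hz
    refine (norm_sub_le _ _).trans ?_
    rw [norm_pow, norm_pow]
    have hpx : ‖p z‖ ≤ 2 * A := (hpA z hz).trans (by linarith)
    have hqx : ‖q z‖ ≤ 2 * A := (hqA z hz).trans (by linarith)
    calc _ ≤ (2 * A) ^ j + (2 * A) ^ (j + 1) := by gcongr
      _ ≤ (2 * A) ^ (j + 1) + (2 * A) ^ (j + 1) := by gcongr; omega
      _ ≤ K := by rw [hK]; nlinarith [pow_pos (by linarith : 0 < 2 * A) (j + 1)]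
  have hE : ∀ z ∈ ball (0 : ℂ) (1 / 16), ‖q z ^ j - p z ^ (j + 1)‖ ≤ K * σ ^ (j + 1) := by
    intro z hz
    have hd : Differentiable ℂ (fun z => q z ^ j - p z ^ (j + 1)) := (hq.pow j).sub (hp.pow (j + 1))
    have := two_constants (g := fun z => q z ^ j - p z ^ (j + 1)) (A := K) (η := K * η) (R := 1)
      one_pos (by positivity) (by nlinarith) hd.differentiableOn hEball hEreal
      (z := z) (by simpa using hz)
    refine this.trans_eq ?_
    rw [hσpow, show K * (K * η) = K ^ 2 * η by ring, Real.sqrt_mul (by positivity),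
      Real.sqrt_sq hKpos.le]
  set W := regSq p σ with hW
  have hWpos : ∀ z, 0 < W z := regSq_pos p hσ
  set w : ℂ → ℝ := fun z => Real.sqrt (W z) with hw
  have hwpos : ∀ z, 0 < w z := fun z => Real.sqrt_pos.2 (hWpos z)
  have hσw : ∀ z, σ ≤ w z := fun z => Real.le_sqrt_of_sq_le (sq_le_regSq p σ z)
  have hpw : ∀ z, ‖p z‖ ≤ w z := fun z => Real.le_sqrt_of_sq_le (by
    simp only [hW, regSq]; nlinarith [sq_nonneg σ])
  have hw2 : ∀ z, w z ^ 2 = W z := fun z => Real.sq_sqrt (hWpos z).le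
  have hqW : ∀ z ∈ ball (0 : ℂ) (1 / 16), ‖q z‖ ≤ (1 + K) * W z ^ ((1 + β) / 2) := by
    intro z hz
    have hWz := hWpos z
    have hwz := hwpos z
    have hpow : (W z ^ ((1 + β) / 2)) ^ j = w z ^ (j + 1) := by
      rw [← Real.rpow_natCast, ← Real.rpow_mul hWz.le, hw]
      simp only
      rw [Real.sqrt_eq_rpow, ← Real.rpow_natCast, ← Real.rpow_mul hWz.le]
      congr 1; rw [hβ]; push_cast; field_simp
    refine le_of_pow_le_pow_left₀ hjne (by positivity) ?_
    rw [mul_pow, hpow, ← norm_pow]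
    have e1 := norm_add_le (q z ^ j - p z ^ (j + 1)) (p z ^ (j + 1))
    rw [sub_add_cancel] at e1
    calc ‖q z ^ j‖ ≤ K * σ ^ (j + 1) + ‖p z‖ ^ (j + 1) := by
          refine e1.trans ?_
          rw [norm_pow]
          gcongr
          exact hE z hz
      _ ≤ K * w z ^ (j + 1) + w z ^ (j + 1) := by
          gcongr
          · exact hσw z
          · exact hpw z
      _ = (1 + K) * w z ^ (j + 1) := by ring
      _ ≤ (1 + K) ^ j * w z ^ (j + 1) := by
          gcongr
          exact le_self_pow₀ (by linarith) hjne
  obtain ⟨F, hFd, hF⟩ := hmain σ hσ hσ1 p q hp hq hpA hqW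
  refine ⟨F, hFd, fun z hz => (hF z hz).1.trans (by nlinarith [sq_nonneg A]), fun x hx => ?_⟩
  have hx1 : |x| < 1 := by linarith
  have hθ : η ^ (1 / (8 * j * (j + 1)) : ℝ) = σ ^ (β / 4) := by
    rw [hσdef, ← Real.rpow_mul hη.le]
    congr 1; rw [hβ]; field_simp; norm_num
  have hwx := hwpos x
  have hσβ : σ ^ β ≤ σ ^ (β / 4) := Real.rpow_le_rpow_of_exponent_ge hσ hσ1 (by linarith)
  have hσβ1 : σ ≤ σ ^ (β / 4) := by
    have := Real.rpow_le_rpow_of_exponent_ge hσ hσ1 (show β / 4 ≤ 1 by linarith)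
    rwa [Real.rpow_one] at this
  have hφA_two : ‖φ x‖ ≤ 2 * A := by
    refine le_of_pow_le_pow_left₀ hjne (by positivity) ?_
    rw [← norm_pow]
    exact (hφj x hx1).trans (le_self_pow₀ h2A hjne)
  have hφw : ‖φ x‖ ≤ (1 + A) * w x ^ β := by
    refine le_of_pow_le_pow_left₀ hjne (by positivity) ?_
    have e1 : (w x ^ β) ^ j = w x := by
      rw [← Real.rpow_natCast, ← Real.rpow_mul hwx.le, hβ, one_div,
        inv_mul_cancel₀ hj0.ne', Real.rpow_one]
    have e2 := norm_add_le (φ x ^ j - p x) (p x)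
    rw [sub_add_cancel] at e2
    rw [mul_pow, e1, ← norm_pow]
    calc ‖φ x ^ j‖ ≤ A * η + ‖p x‖ := e2.trans (by gcongr; exact h1 x hx1)
      _ ≤ A * w x + w x := by
          gcongr
          · exact hησ1.trans (hσw x)
          · exact hpw x
      _ = (1 + A) * w x := by ring
      _ ≤ (1 + A) ^ j * w x := by
          gcongr
          exact le_self_pow₀ (by linarith) hjne
  have hpφ : ‖φ x * p x - q x‖ ≤ 3 * A ^ 2 * η := by
    have e1 : φ x * p x - q x = (φ x ^ (j + 1) - q x) - φ x * (φ x ^ j - p x) := by ring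
    rw [e1]
    refine (norm_sub_le _ _).trans ?_
    rw [norm_mul]
    calc _ ≤ A * η + 2 * A * (A * η) := by
          gcongr
          · exact h2 x hx1
          · exact h1 x hx1
      _ ≤ A * A * η + 2 * A * (A * η) := by gcongr; nlinarith
      _ = _ := by ring
  have hWne : (W x : ℂ) ≠ 0 := by exact_mod_cast (hWpos x).ne'
  have hident : φ x - conj (p x) * q x * ((W x ^ (-1 : ℝ) : ℝ) : ℂ) =
      (conj (p x) * (φ x * p x - q x) + (σ : ℂ) ^ 2 * φ x) / (W x : ℂ) := by
    have e1 : (W x : ℂ) = p x * conj (p x) + (σ : ℂ) ^ 2 := by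
      rw [Complex.mul_conj, Complex.normSq_eq_norm_sq]
      simp [hW, regSq]
    rw [Real.rpow_neg_one, Complex.ofReal_inv, eq_div_iff hWne, sub_mul, mul_assoc _ _ (W x : ℂ),
      inv_mul_cancel₀ hWne, mul_one]
    rw [e1]; ring
  have hφF₁ : ‖φ x - conj (p x) * q x * ((W x ^ (-1 : ℝ) : ℝ) : ℂ)‖ ≤
      (3 * A ^ 2 + (1 + A)) * σ ^ (β / 4) := by
    rw [hident, norm_div, Complex.norm_real, Real.norm_of_nonneg (hWpos x).le]
    have e1 : ‖conj (p x) * (φ x * p x - q x) + (σ : ℂ) ^ 2 * φ x‖ ≤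
        w x * (3 * A ^ 2 * σ ^ 2) + σ ^ 2 * ((1 + A) * w x ^ β) := by
      refine (norm_add_le _ _).trans ?_
      rw [norm_mul, norm_mul, RCLike.norm_conj, norm_pow, Complex.norm_real,
        Real.norm_of_nonneg hσ.le]
      gcongr
      · exact hpw x
      · exact hpφ.trans (by gcongr)
    have e2 : w x * (3 * A ^ 2 * σ ^ 2) / W x ≤ 3 * A ^ 2 * σ := by
      rw [← hw2, div_le_iff₀ (by positivity)]
      calc w x * (3 * A ^ 2 * σ ^ 2) = 3 * A ^ 2 * σ * (σ * w x) := by ring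
        _ ≤ 3 * A ^ 2 * σ * (w x * w x) := by gcongr; exact hσw x
        _ = _ := by ring
    have e3 : σ ^ 2 * ((1 + A) * w x ^ β) / W x ≤ (1 + A) * σ ^ β := by
      have e4 : w x ^ (β - 2) ≤ σ ^ (β - 2) :=
        Real.rpow_le_rpow_of_nonpos hσ (hσw x) (by linarith)
      rw [Real.rpow_sub hwx, Real.rpow_sub hσ, Real.rpow_two, Real.rpow_two, hw2] at e4
      calc σ ^ 2 * ((1 + A) * w x ^ β) / W x = σ ^ 2 * (1 + A) * (w x ^ β / W x) := by ring
        _ ≤ σ ^ 2 * (1 + A) * (σ ^ β / σ ^ 2) := by gcongr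
        _ = _ := by field_simp
    calc _ ≤ (w x * (3 * A ^ 2 * σ ^ 2) + σ ^ 2 * ((1 + A) * w x ^ β)) / W x := by
          gcongr; exact (hWpos x).le
      _ ≤ 3 * A ^ 2 * σ + (1 + A) * σ ^ β := by rw [add_div]; exact add_le_add e2 e3
      _ ≤ 3 * A ^ 2 * σ ^ (β / 4) + (1 + A) * σ ^ (β / 4) := by gcongr
      _ = _ := by ring
  have hxb : (x : ℂ) ∈ ball (0 : ℂ) (1 / 80) := by simpa using hx
  have e := norm_add_le (φ x - conj (p x) * q x * ((W x ^ (-1 : ℝ) : ℝ) : ℂ))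
    (conj (p x) * q x * ((W x ^ (-1 : ℝ) : ℝ) : ℂ) - F x)
  rw [sub_add_sub_cancel] at e
  rw [hθ]
  have := (hF x hxb).2
  linarith

end DbarEstimates

lemma eventually_pow_le_of_rootsTendsto {m : ℕ → ℝ} (hpos : ∀ k, 0 < m k) (hr : RootsTendsto m)
    (L : ℝ) (hL : 0 ≤ L) : ∀ᶠ k in atTop, L ^ k ≤ m k := by
  filter_upwards [hr.eventually_ge_atTop L, eventually_ge_atTop 1] with k hk h1
  have h2 : (k : ℝ) ≠ 0 := by positivity
  calc L ^ k ≤ (m k ^ ((1 : ℝ) / k)) ^ k := by gcongr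
    _ = m k := by
      rw [← Real.rpow_natCast, ← Real.rpow_mul (hpos k).le, one_div, inv_mul_cancel₀ h2,
        Real.rpow_one]

lemma exists_pow_le_of_rootsTendsto {m : ℕ → ℝ} (hpos : ∀ k, 0 < m k) (hr : RootsTendsto m)
    (L : ℝ) (hL : 0 ≤ L) : ∃ D : ℝ, 0 < D ∧ ∀ k, L ^ k ≤ D * m k := by
  obtain ⟨N, hN⟩ := eventually_atTop.1 (eventually_pow_le_of_rootsTendsto hpos hr L hL)
  refine ⟨1 + ∑ k ∈ Finset.range N, L ^ k / m k, ?_, fun k => ?_⟩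
  · have : 0 ≤ ∑ k ∈ Finset.range N, L ^ k / m k :=
      Finset.sum_nonneg fun k _ => div_nonneg (by positivity) (hpos k).le
    linarith
  · have hnn : ∀ i ∈ Finset.range N, 0 ≤ L ^ i / m i := fun i _ =>
      div_nonneg (by positivity) (hpos i).le
    rcases lt_or_ge k N with h | h
    · have := Finset.single_le_sum hnn (Finset.mem_range.2 h)
      rw [← div_le_iff₀ (hpos k)]
      linarith
    · have := Finset.sum_nonneg hnn
      nlinarith [hN k h, hpos k]

lemma exists_forall_mul_pow_le {m : ℕ → ℝ} (hpos : ∀ k, 0 < m k) (hr : RootsTendsto m) {t : ℝ}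
    (ht : 0 < t) : ∃ n, ∀ k, m n * t ^ n ≤ m k * t ^ k := by
  have h : Tendsto (fun k => m k * t ^ k) cofinite atTop := by
    rw [Nat.cofinite_eq_atTop]
    refine tendsto_atTop_mono' _ ?_ (tendsto_pow_atTop_atTop_of_one_lt (one_lt_two (α := ℝ)))
    filter_upwards [eventually_pow_le_of_rootsTendsto hpos hr (2 / t) (by positivity)] with k hk
    calc (2 : ℝ) ^ k = (2 / t) ^ k * t ^ k := by rw [← mul_pow, div_mul_cancel₀ _ ht.ne']
      _ ≤ m k * t ^ k := by gcongr
  exact h.exists_forall_le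

lemma hfn_le {m : ℕ → ℝ} (hpos : ∀ k, 0 < m k) {t : ℝ} (ht : 0 < t) (k : ℕ) :
    hfn m t ≤ m k * t ^ k := by
  rw [hfn, if_neg ht.not_ge]
  exact ciInf_le ⟨0, by rintro _ ⟨i, rfl⟩; exact mul_nonneg (hpos i).le (by positivity)⟩ k

lemma exists_hfn_eq {m : ℕ → ℝ} (hpos : ∀ k, 0 < m k) (hr : RootsTendsto m) {t : ℝ}
    (ht : 0 < t) : ∃ n, hfn m t = m n * t ^ n := by
  obtain ⟨n, hn⟩ := exists_forall_mul_pow_le hpos hr ht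
  refine ⟨n, le_antisymm (hfn_le hpos ht n) ?_⟩
  rw [hfn, if_neg ht.not_ge]
  exact le_ciInf hn

lemma hfn_eq_gammaUpper {m : ℕ → ℝ} (hpos : ∀ k, 0 < m k) (hr : RootsTendsto m) {t : ℝ}
    (ht : 0 < t) : hfn m t = m (GammaUpper m t) * t ^ (GammaUpper m t) :=
  Nat.sInf_mem (s := {k | hfn m t = m k * t ^ k}) (exists_hfn_eq hpos hr ht)

lemma hfn_pos {m : ℕ → ℝ} (hpos : ∀ k, 0 < m k) (hr : RootsTendsto m) {t : ℝ}
    (ht : 0 < t) : 0 < hfn m t := by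
  rw [hfn_eq_gammaUpper hpos hr ht]
  exact mul_pos (hpos _) (by positivity)

lemma hfn_mono {m : ℕ → ℝ} (hpos : ∀ k, 0 < m k) (hr : RootsTendsto m) {s t : ℝ}
    (hs : 0 < s) (hst : s ≤ t) : hfn m s ≤ hfn m t := by
  obtain ⟨n, hn⟩ := exists_hfn_eq hpos hr (hs.trans_le hst)
  rw [hn]
  refine (hfn_le hpos hs n).trans ?_
  have := (hpos n).le
  gcongr

lemma hfn_le_one {m : ℕ → ℝ} (hpos : ∀ k, 0 < m k) (h0 : m 0 = 1) {t : ℝ}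
    (ht : 0 < t) : hfn m t ≤ 1 := by
  simpa [h0] using hfn_le hpos ht 0

lemma mul_pow_le_one_of_le_gammaLower {m : ℕ → ℝ} (hpos : ∀ k, 0 < m k) (h0 : m 0 = 1) {t : ℝ}
    (ht : 0 < t) {k : ℕ} (hk : k ≤ GammaLower m t) : m k * t ^ k ≤ 1 := by
  induction k with
  | zero => simp [h0]
  | succ k ih =>
    have h1 : ¬ 1 / t ≤ m (k + 1) / m k := Nat.notMem_of_lt_sInf
      (s := {k : ℕ | 1 / t ≤ m (k + 1) / m k}) hk
    rw [div_le_div_iff₀ ht (hpos k)] at h1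
    refine le_trans ?_ (ih (by omega))
    calc m (k + 1) * t ^ (k + 1) = m (k + 1) * t * t ^ k := by ring
      _ ≤ m k * t ^ k := by gcongr; linarith

lemma lc_pos {M : ℕ → ℝ} (hM : IsWeightSeq M) (k : ℕ) : 0 < lc M k :=
  div_pos (hM.pos k) (by positivity)

lemma lc_zero {M : ℕ → ℝ} (hM : IsWeightSeq M) : lc M 0 = 1 := by
  simp [lc, hM.first]

lemma exists_le_of_mg_lt_top {M : ℕ → ℝ} (hM : IsWeightSeq M) (hmg : mg M M < ⊤) :
    ∃ Q : ℝ, 1 ≤ Q ∧ ∀ i k, M (i + k) ≤ Q ^ (i + k) * (M i * M k) := by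
  refine ⟨max 1 (mg M M).toReal, le_max_left _ _, fun i k => ?_⟩
  have hi := hM.pos i
  have hk := hM.pos k
  have hik := hM.pos (i + k)
  rcases Nat.eq_zero_or_pos (i + k) with h | h
  · obtain ⟨rfl, rfl⟩ : i = 0 ∧ k = 0 := by omega
    simp [hM.first]
  · have h1 : ENNReal.ofReal ((M (i + k) / (M i * M k)) ^ (((i : ℝ) + (k : ℝ))⁻¹)) ≤ mg M M :=
      le_iSup_of_le i (le_iSup_of_le k (le_iSup_of_le h le_rfl))
    have h2 := (ENNReal.ofReal_le_iff_le_toReal hmg.ne).1 h1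
    have hne : (((i + k : ℕ) : ℝ)) ≠ 0 := by positivity
    have h3 : M (i + k) / (M i * M k) =
        ((M (i + k) / (M i * M k)) ^ (((i : ℝ) + (k : ℝ))⁻¹)) ^ (i + k) := by
      rw [← Real.rpow_natCast, ← Real.rpow_mul (by positivity), ← Nat.cast_add,
        inv_mul_cancel₀ hne, Real.rpow_one]
    rw [← div_le_iff₀ (by positivity), h3]
    gcongr
    exact h2.trans (le_max_right _ _)

lemma lc_add_le {M : ℕ → ℝ} (hM : IsWeightSeq M) {Q : ℝ} (hQ : 1 ≤ Q)
    (h : ∀ i k, M (i + k) ≤ Q ^ (i + k) * (M i * M k)) (i k : ℕ) :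
    lc M (i + k) ≤ Q ^ (i + k) * (lc M i * lc M k) := by
  have hi := hM.pos i
  have hk := hM.pos k
  have h1 : ((Nat.factorial i : ℝ) * Nat.factorial k) ≤ (Nat.factorial (i + k) : ℝ) := by
    exact_mod_cast Nat.le_of_dvd (Nat.factorial_pos _) (Nat.factorial_mul_factorial_dvd_factorial_add i k)
  unfold lc
  calc M (i + k) / (Nat.factorial (i + k) : ℝ)
      ≤ Q ^ (i + k) * (M i * M k) / ((Nat.factorial i : ℝ) * Nat.factorial k) := by
        gcongr; exact h i k
    _ = _ := by field_simp

lemma hfn_le_sq {m : ℕ → ℝ} (hpos : ∀ k, 0 < m k) (hr : RootsTendsto m) {Q : ℝ} (hQ : 1 ≤ Q)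
    (h : ∀ i k, m (i + k) ≤ Q ^ (i + k) * (m i * m k)) {t : ℝ} (ht : 0 < t) :
    hfn m t ≤ hfn m (Q * t) ^ 2 := by
  obtain ⟨n, hn⟩ := exists_hfn_eq hpos hr (show 0 < Q * t by positivity)
  rw [hn]
  calc hfn m t ≤ m (n + n) * t ^ (n + n) := hfn_le hpos ht _
    _ ≤ Q ^ (n + n) * (m n * m n) * t ^ (n + n) := by gcongr; exact h n n
    _ = _ := by rw [mul_pow Q]; ring

lemma exists_hfn_rpow_le {m : ℕ → ℝ} (hpos : ∀ k, 0 < m k) (h0 : m 0 = 1) (hr : RootsTendsto m)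
    {Q : ℝ} (hQ : 1 ≤ Q) (h : ∀ i k, m (i + k) ≤ Q ^ (i + k) * (m i * m k)) {θ : ℝ} (hθ : 0 < θ) :
    ∃ Q' : ℝ, 1 ≤ Q' ∧ ∀ t : ℝ, 0 < t → hfn m t ^ θ ≤ hfn m (Q' * t) := by
  have hiter : ∀ (n : ℕ) (t : ℝ), 0 < t → hfn m t ≤ hfn m (Q ^ n * t) ^ (2 ^ n) := by
    intro n
    induction n with
    | zero => intro t _; simp
    | succ n ih =>
      intro t ht
      refine (hfn_le_sq hpos hr hQ h ht).trans ?_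
      have := ih (Q * t) (by positivity)
      have hp := (hfn_pos hpos hr (show 0 < Q * t by positivity)).le
      calc hfn m (Q * t) ^ 2 ≤ (hfn m (Q ^ n * (Q * t)) ^ (2 ^ n)) ^ 2 := by gcongr
        _ = _ := by rw [← pow_mul, ← pow_succ, ← mul_assoc, ← pow_succ]
  obtain ⟨n, hn⟩ := pow_unbounded_of_one_lt (1 / θ) (one_lt_two (α := ℝ))
  refine ⟨Q ^ n, one_le_pow₀ hQ, fun t ht => ?_⟩
  have hQt : 0 < Q ^ n * t := by positivity
  have hp := hfn_pos hpos hr hQt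
  calc hfn m t ^ θ ≤ (hfn m (Q ^ n * t) ^ (2 ^ n)) ^ θ :=
        Real.rpow_le_rpow (hfn_pos hpos hr ht).le (hiter n t ht) hθ.le
    _ = hfn m (Q ^ n * t) ^ ((2 : ℝ) ^ n * θ) := by
        rw [← Real.rpow_natCast, ← Real.rpow_mul hp.le]; push_cast; rfl
    _ ≤ hfn m (Q ^ n * t) ^ (1 : ℝ) := by
        refine Real.rpow_le_rpow_of_exponent_ge hp (hfn_le_one hpos h0 hQt) ?_
        rw [div_lt_iff₀ hθ] at hn; exact hn.le
    _ = _ := Real.rpow_one _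

/-- `G` has Taylor-type expansions at `0`, on `(-r, r)`, with bounds given by `m`. -/
def TaylorBound (m : ℕ → ℝ) (A r : ℝ) (G : ℝ → ℂ) : Prop :=
  ∃ a : ℕ → ℂ, (∀ k, ‖a k‖ ≤ A * m k) ∧ ∀ (n : ℕ) (s : ℝ), |s| < r →
    ‖G s - ∑ k ∈ Finset.range n, a k * (s : ℂ) ^ k‖ ≤ A * m n * (2 * |s|) ^ n

lemma exists_polynomial_near_holomorphic {R : ℝ} (hR : 0 < R) (k : ℕ) :
    ∀ (g : ℂ → ℂ) (B : ℝ), DifferentiableOn ℂ g (ball 0 R) → (∀ z ∈ ball (0 : ℂ) R, ‖g z‖ ≤ B) →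
    ∃ P : Polynomial ℂ, P.degree < k ∧
      ∀ z ∈ ball (0 : ℂ) R, ‖g z - P.eval z‖ ≤ B * (2 * ‖z‖ / R) ^ k := by
  induction k with
  | zero =>
    intro g B _ hb
    exact ⟨0, by simp, fun z hz => by simpa using hb z hz⟩
  | succ k ih =>
    intro g B hg hb
    have h0 : (0 : ℂ) ∈ ball (0 : ℂ) R := mem_ball_self hR
    have hd : DifferentiableOn ℂ (dslope g 0) (ball 0 R) :=
      (Complex.differentiableOn_dslope (isOpen_ball.mem_nhds h0)).2 hg
    have hdb : ∀ z ∈ ball (0 : ℂ) R, ‖dslope g 0 z‖ ≤ 2 * B / R := fun z hz =>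
      Complex.norm_dslope_le_div_of_mapsTo_ball hg (fun w hw => by
        rw [mem_closedBall, dist_eq_norm]
        refine (norm_sub_le _ _).trans ?_
        linarith [hb w hw, hb 0 h0]) hz
    obtain ⟨P, hP, hPb⟩ := ih (dslope g 0) (2 * B / R) hd hdb
    refine ⟨Polynomial.C (g 0) + Polynomial.X * P, ?_, fun z hz => ?_⟩
    · refine (Polynomial.degree_add_le _ _).trans_lt (max_lt ?_ ?_)
      · exact Polynomial.degree_C_le.trans_lt (by exact_mod_cast Nat.succ_pos k)
      · rw [Polynomial.X_mul]
        rcases eq_or_ne P 0 with rfl | hne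
        · simp
        · rw [Polynomial.degree_mul_X, Polynomial.degree_eq_natDegree hne] at *
          have : P.natDegree < k := by exact_mod_cast hP
          exact_mod_cast Nat.succ_lt_succ this
    · have h1 : g z - (Polynomial.C (g 0) + Polynomial.X * P).eval z =
          z * (dslope g 0 z - P.eval z) := by
        have := sub_smul_dslope g 0 z
        simp only [sub_zero, smul_eq_mul] at this
        simp only [Polynomial.eval_add, Polynomial.eval_C, Polynomial.eval_mul, Polynomial.eval_X]
        rw [mul_sub, this]; ring
      rw [h1, norm_mul]
      calc _ ≤ ‖z‖ * (2 * B / R * (2 * ‖z‖ / R) ^ k) := by gcongr; exact hPb z hz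
        _ = _ := by ring

lemma exists_polynomial_of_taylorBound {M : ℕ → ℝ} (hM : IsWeightSeq M)
    (hroot : RootsTendsto (lc M)) {C₀ : ℝ} (hC₀ : 1 ≤ C₀)
    (hΓ : ∀ t : ℝ, 0 < t → GammaUpper (lc M) (C₀ * t) ≤ GammaLower (lc M) t)
    {A r t : ℝ} (hA : 0 ≤ A) {G : ℝ → ℂ}
    (hG : TaylorBound (lc M) A r G) (ht : 0 < t) (htr : t ≤ r) :
    ∃ p : ℂ → ℂ, Differentiable ℂ p ∧ (∀ z ∈ ball (0 : ℂ) 1, ‖p z‖ ≤ 2 * A) ∧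
      ∀ x : ℝ, |x| < 1 → ‖G (t / 2 * x) - p x‖ ≤ 2 * A * hfn (lc M) (C₀ * t) := by
  obtain ⟨a, ha, hT⟩ := hG
  have hm := lc_pos hM
  set n := GammaUpper (lc M) (C₀ * t) with hn
  refine ⟨fun z => ∑ k ∈ Finset.range n, a k * ((t / 2 : ℝ) * z) ^ k, ?_, fun z hz => ?_,
    fun x hx => ?_⟩
  · fun_prop
  · rw [mem_ball_zero_iff] at hz
    have hterm : ∀ k ∈ Finset.range n, ‖a k * ((t / 2 : ℝ) * z) ^ k‖ ≤ A * (1 / 2) ^ k := by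
      intro k hk
      have h1 := mul_pow_le_one_of_le_gammaLower hm (lc_zero hM) ht
        (k := k) ((Finset.mem_range.1 hk).le.trans (hΓ t ht))
      rw [norm_mul, norm_pow, norm_mul, Complex.norm_real, Real.norm_of_nonneg (by positivity)]
      have hmk := (hm k).le
      calc ‖a k‖ * (t / 2 * ‖z‖) ^ k ≤ A * lc M k * (t / 2 * 1) ^ k := by
            gcongr; exact ha k
        _ = A * (lc M k * t ^ k) * (1 / 2) ^ k := by
            rw [mul_one, div_eq_mul_one_div t, mul_pow]; ring
        _ ≤ A * 1 * (1 / 2) ^ k := by gcongr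
        _ = _ := by ring
    refine (norm_sum_le _ _).trans ((Finset.sum_le_sum hterm).trans ?_)
    rw [← Finset.mul_sum, mul_comm 2 A]
    gcongr
    exact (summable_geometric_two.sum_le_tsum _ fun i _ => by positivity).trans_eq
      tsum_geometric_two
  · have hs : |t / 2 * x| = t / 2 * |x| := by rw [abs_mul, abs_of_pos (by positivity)]
    have h1 := hT n (t / 2 * x) (by rw [hs]; nlinarith)
    have hmn := (hm n).le
    have h2 : (2 * |t / 2 * x|) ^ n ≤ (C₀ * t) ^ n := by
      rw [hs]
      refine pow_le_pow_left₀ (by positivity) ?_ n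
      nlinarith
    have h3 : A * lc M n * (2 * |t / 2 * x|) ^ n ≤ A * hfn (lc M) (C₀ * t) := by
      rw [hfn_eq_gammaUpper hm hroot (by positivity), ← hn, mul_assoc]
      gcongr
    have h4 : 0 ≤ A * hfn (lc M) (C₀ * t) :=
      mul_nonneg hA (hfn_pos hm hroot (by positivity)).le
    push_cast at h1 ⊢
    linarith

lemma exists_holomorphic_at_scale {M : ℕ → ℝ} (hM : IsWeightSeq M)
    (hroot : RootsTendsto (lc M)) {C₀ : ℝ} (hC₀ : 1 ≤ C₀)
    (hΓ : ∀ t : ℝ, 0 < t → GammaUpper (lc M) (C₀ * t) ≤ GammaLower (lc M) t)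
    (hmg : mg M M < ⊤) {j : ℕ} (hj : 1 ≤ j) :
    ∃ C₁ : ℝ, 1 ≤ C₁ ∧ ∀ A : ℝ, 1 ≤ A → ∃ A' : ℝ, 1 ≤ A' ∧ ∀ r : ℝ, ∀ φ : ℝ → ℂ,
      TaylorBound (lc M) A r (fun x => φ x ^ j) → TaylorBound (lc M) A r (fun x => φ x ^ (j + 1)) →
      ∀ t : ℝ, 0 < t → t ≤ r → ∃ F : ℂ → ℂ, DifferentiableOn ℂ F (ball 0 (t / 160)) ∧
        (∀ z ∈ ball (0 : ℂ) (t / 160), ‖F z‖ ≤ A') ∧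
        ∀ x : ℝ, |x| < t / 160 → ‖φ x - F x‖ ≤ A' * hfn (lc M) (C₁ * t) := by
  have hm := lc_pos hM
  obtain ⟨θ, hθ, hdisc⟩ := exists_holomorphic_approx_of_pow hj
  obtain ⟨Q, hQ, hQM⟩ := exists_le_of_mg_lt_top hM hmg
  obtain ⟨Q', hQ', hQh⟩ := exists_hfn_rpow_le hm (lc_zero hM) hroot hQ (lc_add_le hM hQ hQM) hθ
  refine ⟨Q' * C₀, one_le_mul_of_one_le_of_one_le hQ' hC₀, fun A hA => ?_⟩
  obtain ⟨A', hA', hd⟩ := hdisc (2 * A) (by linarith)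
  refine ⟨A' + 1, by linarith, fun r φ h1 h2 t ht htr => ?_⟩
  have hC₀t : 0 < C₀ * t := by positivity
  obtain ⟨p, hp, hpb, hpe⟩ :=
    exists_polynomial_of_taylorBound hM hroot hC₀ hΓ (by linarith) h1 ht htr
  obtain ⟨q, hq, hqb, hqe⟩ :=
    exists_polynomial_of_taylorBound hM hroot hC₀ hΓ (by linarith) h2 ht htr
  obtain ⟨F, hF, hFb, hFe⟩ := hd (hfn (lc M) (C₀ * t)) (hfn_pos hm hroot hC₀t)
    (hfn_le_one hm (lc_zero hM) hC₀t) p q hp hq hpb hqb (fun x => φ (t / 2 * x)) hpe hqe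
  have hmaps : MapsTo (fun z : ℂ => ((2 / t : ℝ) : ℂ) * z) (ball 0 (t / 160)) (ball 0 (1 / 80)) := by
    intro z hz
    rw [mem_ball_zero_iff] at hz ⊢
    rw [norm_mul, Complex.norm_real, Real.norm_of_nonneg (by positivity)]
    calc 2 / t * ‖z‖ < 2 / t * (t / 160) := by gcongr
      _ = 1 / 80 := by field_simp; norm_num
  refine ⟨fun z => F (((2 / t : ℝ) : ℂ) * z), hF.comp (by fun_prop) hmaps,
    fun z hz => (hFb _ (hmaps hz)).trans (by linarith), fun x hx => ?_⟩
  have hx' : |2 / t * x| < 1 / 80 := by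
    have := hmaps (show (x : ℂ) ∈ ball (0 : ℂ) (t / 160) by simpa using hx)
    rw [mem_ball_zero_iff] at this
    simpa [abs_mul, abs_div] using this
  have h3 := hFe (2 / t * x) hx'
  have h4 : t / 2 * (2 / t * x) = x := by field_simp
  rw [h4] at h3
  push_cast at h3 ⊢
  refine h3.trans ?_
  have h5 := hQh (C₀ * t) hC₀t
  rw [← mul_assoc] at h5
  have h6 := hfn_pos hm hroot (show 0 < Q' * C₀ * t by positivity)
  calc A' * hfn (lc M) (C₀ * t) ^ θ ≤ A' * hfn (lc M) (Q' * C₀ * t) := by gcongr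
    _ ≤ _ := by gcongr; linarith

lemma exists_polynomial_approx {M : ℕ → ℝ} (hM : IsWeightSeq M)
    (hroot : RootsTendsto (lc M)) {C₀ : ℝ} (hC₀ : 1 ≤ C₀)
    (hΓ : ∀ t : ℝ, 0 < t → GammaUpper (lc M) (C₀ * t) ≤ GammaLower (lc M) t)
    (hmg : mg M M < ⊤) {j : ℕ} (hj : 1 ≤ j) :
    ∃ B : ℝ, 1 ≤ B ∧ ∀ A : ℝ, 1 ≤ A → ∀ r : ℝ, 0 < r → ∃ A₁ : ℝ, 0 < A₁ ∧ ∀ φ : ℝ → ℂ,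
      TaylorBound (lc M) A r (fun x => φ x ^ j) → TaylorBound (lc M) A r (fun x => φ x ^ (j + 1)) →
      ∀ (k : ℕ) (ρ : ℝ), 0 < ρ → ρ < r / 5120 → ∃ P : Polynomial ℂ, P.degree < k ∧
        ∀ x : ℝ, |x| ≤ ρ → ‖φ x - P.eval (x : ℂ)‖ ≤ A₁ * B ^ k * lc M k * ρ ^ k := by
  have hm := lc_pos hM
  obtain ⟨C₁, hC₁, hscale⟩ := exists_holomorphic_at_scale hM hroot hC₀ hΓ hmg hj
  obtain ⟨Q, hQ, hQM⟩ := exists_le_of_mg_lt_top hM hmg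
  have hQm := lc_add_le hM hQ hQM
  obtain ⟨Q₂, hQ₂, hQ₂h⟩ := exists_hfn_rpow_le hm (lc_zero hM) hroot hQ hQm
    (θ := 1 / 2) (by norm_num)
  set C₂ : ℝ := Q₂ * C₁ with hC₂
  have hC₁₂ : C₁ ≤ C₂ := le_mul_of_one_le_left (by linarith) hQ₂
  have hC₂1 : 1 ≤ C₂ := hC₁.trans hC₁₂
  have hC₂Q : C₂ ≤ C₂ * Q := le_mul_of_one_le_right (by linarith) hQ
  refine ⟨10240 * (C₂ * Q), by nlinarith, fun A hA r hr => ?_⟩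
  obtain ⟨A', hA', hF⟩ := hscale A hA
  obtain ⟨D, hD, hDm⟩ := exists_pow_le_of_rootsTendsto hm hroot (320 / r) (by positivity)
  have hm1 := hm 1
  refine ⟨A' * (1 + D + 4 * r * Q * C₂ * lc M 1), by positivity, fun φ h1 h2 k ρ hρ hρr => ?_⟩
  have hmk := hm k
  set t : ℕ → ℝ := fun i => r * (1 / 2) ^ i with ht
  have htpos : ∀ i, 0 < t i := fun i => by positivity
  have htr : ∀ i, t i ≤ r := fun i =>
    mul_le_of_le_one_right hr.le (pow_le_one₀ (by norm_num) (by norm_num))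
  have htsucc : ∀ i, t (i + 1) = t i / 2 := fun i => by simp only [ht, pow_succ]; ring
  choose F hFd hFb hFe using fun i => hF r φ h1 h2 (t i) (htpos i) (htr i)
  have hg : ∀ i, ∀ z ∈ ball (0 : ℂ) (t i / 5120),
      ‖F (i + 1) z - F i z‖ ≤ 2 * A' * (lc M (k + 1) * (C₂ * t i) ^ (k + 1)) := by
    intro i z hz
    have hti := htpos i
    have hC₁t : 0 < C₁ * t i := by positivity
    have hsub : ball (0 : ℂ) (t i / 320) ⊆ ball 0 (t i / 160) := ball_subset_ball (by linarith)
    have hsub' : ball (0 : ℂ) (t i / 320) ⊆ ball 0 (t (i + 1) / 160) :=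
      ball_subset_ball (by rw [htsucc]; linarith)
    have hh := hfn_pos hm hroot hC₁t
    have h3 := two_constants (g := fun z => F (i + 1) z - F i z) (A := 2 * A')
      (η := 2 * A' * hfn (lc M) (C₁ * t i)) (R := t i / 320) (by positivity) (by positivity)
      (mul_le_of_le_one_right (by positivity) (hfn_le_one hm (lc_zero hM) hC₁t))
      (((hFd (i + 1)).mono hsub').sub ((hFd i).mono hsub))
      (fun w hw => (norm_sub_le _ _).trans (by
        linarith [hFb (i + 1) w (hsub' hw), hFb i w (hsub hw)]))
      (fun x hx => by
        have e1 := hFe i x (by linarith)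
        have e2 := hFe (i + 1) x (by rw [htsucc]; linarith)
        have e3 : hfn (lc M) (C₁ * t (i + 1)) ≤ hfn (lc M) (C₁ * t i) :=
          hfn_mono hm hroot (mul_pos (by linarith) (htpos _)) (by
            rw [htsucc]; gcongr; linarith)
        have e4 : F (i + 1) x - F i x = (φ x - F i x) - (φ x - F (i + 1) x) := by ring
        rw [e4]
        refine (norm_sub_le _ _).trans ?_
        nlinarith)
      (z := z) (by rw [mem_ball_zero_iff] at hz; linarith)
    refine h3.trans ?_
    rw [show 2 * A' * (2 * A' * hfn (lc M) (C₁ * t i)) = (2 * A') ^ 2 * hfn (lc M) (C₁ * t i) by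
      ring, Real.sqrt_mul (by positivity), Real.sqrt_sq (by positivity), Real.sqrt_eq_rpow]
    gcongr
    refine (hQ₂h _ hC₁t).trans ?_
    rw [← mul_assoc, ← hC₂]
    exact hfn_le hm (by positivity) _
  choose P hPd hPb using fun i => exists_polynomial_near_holomorphic
    (show 0 < t i / 5120 by have := htpos i; positivity) k (fun z => F (i + 1) z - F i z) _
    ((((hFd (i + 1)).mono (ball_subset_ball (by rw [htsucc]; linarith [htpos i]))).sub
      ((hFd i).mono (ball_subset_ball (by linarith [htpos i]))))) (hg i)
  obtain ⟨P₀, hP₀d, hP₀b⟩ := exists_polynomial_near_holomorphic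
    (show 0 < t 0 / 160 by have := htpos 0; positivity) k (F 0) _ (hFd 0) (hFb 0)
  have ht0 : t 0 = r := by simp [ht]
  obtain ⟨N, hN1, hN2⟩ := exists_nat_pow_near_of_lt_one (x := ρ / (r / 5120)) (y := (1 / 2 : ℝ))
    (by positivity) ((div_le_one (by positivity)).2 hρr.le) (by norm_num) (by norm_num)
  have hN1' : t N ≤ 10240 * ρ := by
    rw [lt_div_iff₀ (by positivity)] at hN1
    simp only [ht]
    rw [pow_succ] at hN1
    linarith
  have hN2' : ρ ≤ t N / 5120 := by
    rw [div_le_iff₀ (by positivity)] at hN2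
    simp only [ht]
    linarith
  refine ⟨P₀ + ∑ i ∈ Finset.range N, P i, ?_, fun x hx => ?_⟩
  · refine (Polynomial.degree_add_le _ _).trans_lt (max_lt hP₀d ?_)
    refine (Polynomial.degree_sum_le _ _).trans_lt ?_
    exact (Finset.sup_lt_iff (WithBot.bot_lt_coe k)).2 fun i _ => hPd i
  have hxn : ‖(x : ℂ)‖ ≤ ρ := by simpa using hx
  have hti : ∀ i ∈ Finset.range N, 2 * t N ≤ t i := by
    intro i hi
    have hi' : i + 1 ≤ N := Finset.mem_range.1 hi
    have : t N ≤ t (i + 1) := by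
      simp only [ht]
      gcongr ?_ * ?_
      exact pow_le_pow_of_le_one (by norm_num) (by norm_num) hi'
    rw [htsucc] at this
    linarith
  have hsplit : φ x - (P₀ + ∑ i ∈ Finset.range N, P i).eval (x : ℂ) =
      (φ x - F N x) + (F 0 x - P₀.eval (x : ℂ)) +
        ∑ i ∈ Finset.range N, ((F (i + 1) x - F i x) - (P i).eval (x : ℂ)) := by
    rw [Finset.sum_sub_distrib, Finset.sum_range_sub (fun i => F i x), Polynomial.eval_add,
      Polynomial.eval_finsetSum]
    ring
  have b1 : ‖φ x - F N x‖ ≤ A' * (lc M k * ((10240 * (C₂ * Q)) ^ k * ρ ^ k)) := by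
    have htN := htpos N
    refine (hFe N x (by linarith)).trans ?_
    gcongr
    refine (hfn_le hm (by positivity) k).trans ?_
    gcongr
    rw [← mul_pow]
    refine pow_le_pow_left₀ (by positivity) ?_ k
    calc C₁ * t N ≤ (C₂ * Q) * (10240 * ρ) := by gcongr; exact hC₁₂.trans hC₂Q
      _ = _ := by ring
  have hone : 1 ≤ (10240 * (C₂ * Q)) ^ k := one_le_pow₀ (by nlinarith)
  have b2 : ‖F 0 x - P₀.eval (x : ℂ)‖ ≤ A' * (D * (lc M k * ((10240 * (C₂ * Q)) ^ k * ρ ^ k))) := by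
    refine (hP₀b x (by rw [mem_ball_zero_iff, ht0]; linarith)).trans ?_
    gcongr
    rw [ht0]
    calc (2 * ‖(x : ℂ)‖ / (r / 160)) ^ k ≤ (2 * ρ / (r / 160)) ^ k := by gcongr
      _ = (320 / r) ^ k * ρ ^ k := by rw [← mul_pow]; congr 1; field_simp; norm_num
      _ ≤ D * lc M k * (1 * ρ ^ k) := by rw [one_mul]; gcongr; exact hDm k
      _ ≤ D * lc M k * ((10240 * (C₂ * Q)) ^ k * ρ ^ k) := by gcongr
      _ = _ := by ring
  have b3 : ‖∑ i ∈ Finset.range N, ((F (i + 1) x - F i x) - (P i).eval (x : ℂ))‖ ≤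
      A' * (4 * r * Q * C₂ * lc M 1 * (lc M k * ((10240 * (C₂ * Q)) ^ k * ρ ^ k))) := by
    have hterm : ∀ i ∈ Finset.range N, ‖(F (i + 1) x - F i x) - (P i).eval (x : ℂ)‖ ≤
        2 * A' * (Q * C₂ * lc M 1 * (lc M k * ((10240 * (C₂ * Q)) ^ k * ρ ^ k))) * t i := by
      intro i hi
      have hti0 := htpos i
      have htN := htpos N
      refine (hPb i x (by rw [mem_ball_zero_iff]; linarith [hti i hi])).trans ?_
      have hmk1 := (hm (k + 1)).le
      calc 2 * A' * (lc M (k + 1) * (C₂ * t i) ^ (k + 1)) * (2 * ‖(x : ℂ)‖ / (t i / 5120)) ^ k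
          ≤ 2 * A' * ((Q ^ (k + 1) * (lc M k * lc M 1)) * (C₂ * t i) ^ (k + 1)) *
            (2 * ρ / (t i / 5120)) ^ k := by
            gcongr
            exact hQm k 1
        _ = 2 * A' * (Q * C₂ * lc M 1 * (lc M k *
            ((Q * C₂ * t i * (2 * ρ / (t i / 5120))) ^ k))) * t i := by
            rw [mul_pow (Q * C₂ * t i)]; ring
        _ = _ := by
            rw [← mul_pow (10240 * (C₂ * Q))]
            congr 5; field_simp; norm_num
    refine (norm_sum_le _ _).trans ((Finset.sum_le_sum hterm).trans ?_)
    rw [← Finset.mul_sum]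
    have hsum : ∑ i ∈ Finset.range N, t i ≤ 2 * r := by
      simp only [ht]
      rw [← Finset.mul_sum, mul_comm 2 r]
      gcongr
      exact (summable_geometric_two.sum_le_tsum _ fun i _ => by positivity).trans_eq
        tsum_geometric_two
    calc _ ≤ 2 * A' * (Q * C₂ * lc M 1 * (lc M k * ((10240 * (C₂ * Q)) ^ k * ρ ^ k))) * (2 * r) := by
          gcongr
      _ = _ := by ring
  rw [hsplit]
  refine (norm_add_le _ _).trans ((add_le_add ((norm_add_le _ _).trans (add_le_add b1 b2)) b3).trans ?_)
  exact le_of_eq (by ring)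

/-- The `k`-th forward difference at `x` with step `h`. -/
def iterDiff {E F : Type*} [AddCommGroup E] [AddCommGroup F] (k : ℕ) (h : E) (f : E → F)
    (x : E) : F :=
  ∑ i ∈ Finset.range (k + 1), ((-1 : ℤ) ^ (k - i) * k.choose i) • f (x + i • h)

lemma norm_iterDiff_le {E F : Type*} [AddCommGroup E] [NormedAddCommGroup F] {k : ℕ} {h : E}
    {f : E → F} {x : E} {c : ℝ} (hf : ∀ i ≤ k, ‖f (x + i • h)‖ ≤ c) :
    ‖iterDiff k h f x‖ ≤ 2 ^ k * c := by
  have hsum : ((2 : ℝ) ^ k) = ∑ i ∈ Finset.range (k + 1), (k.choose i : ℝ) := by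
    exact_mod_cast (Nat.sum_range_choose k).symm
  rw [hsum, Finset.sum_mul]
  refine norm_sum_le_of_le _ fun i hi => ?_
  refine (norm_zsmul_le _ _).trans ?_
  have hn : ‖((-1 : ℤ) ^ (k - i) * k.choose i)‖ = k.choose i := by
    simp [norm_mul]
  rw [hn]
  gcongr
  exact hf i (Nat.lt_succ_iff.1 (Finset.mem_range.1 hi))

lemma iterDiff_sub {E F : Type*} [AddCommGroup E] [AddCommGroup F] (k : ℕ) (h : E) (f g : E → F)
    (x : E) : iterDiff k h (fun y => f y - g y) x = iterDiff k h f x - iterDiff k h g x := by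
  simp only [iterDiff, smul_sub, Finset.sum_sub_distrib]

lemma iterDiff_pow (k l : ℕ) (s : ℝ) (hl : l ≤ k) :
    iterDiff k s (fun x : ℝ => (x : ℂ) ^ l) 0 = if l = k then (k.factorial : ℂ) * (s : ℂ) ^ k else 0 := by
  have h1 : iterDiff k s (fun x : ℝ => (x : ℂ) ^ l) 0 =
      (s : ℂ) ^ l * (fwdDiff (1 : ℂ))^[k] (fun x : ℂ => x ^ l) 0 := by
    rw [fwdDiff_iter_eq_sum_shift, iterDiff, Finset.mul_sum]
    refine Finset.sum_congr rfl fun i _ => ?_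
    simp only [zero_add, nsmul_eq_mul, mul_one, zsmul_eq_mul]
    push_cast
    ring
  rw [h1]
  split_ifs with h
  · subst h
    rw [fwdDiff_iter_eq_factorial]
    simp [mul_comm]
  · rw [fwdDiff_iter_pow_eq_zero_of_lt (lt_of_le_of_ne hl h)]
    simp

lemma iterDiff_sum_mul_pow (k n : ℕ) (hn : n ≤ k + 1) (s : ℝ) (a : ℕ → ℂ) :
    iterDiff k s (fun x : ℝ => ∑ l ∈ Finset.range n, a l * (x : ℂ) ^ l) 0 =
      if n = k + 1 then a k * ((k.factorial : ℂ) * (s : ℂ) ^ k) else 0 := by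
  have h1 : iterDiff k s (fun x : ℝ => ∑ l ∈ Finset.range n, a l * (x : ℂ) ^ l) 0 =
      ∑ l ∈ Finset.range n, a l * iterDiff k s (fun x : ℝ => (x : ℂ) ^ l) 0 := by
    simp only [iterDiff, Finset.smul_sum, Finset.mul_sum]
    rw [Finset.sum_comm]
    refine Finset.sum_congr rfl fun i _ => Finset.sum_congr rfl fun l _ => ?_
    rw [mul_smul_comm]
  rw [h1]
  have h2 : ∀ l ∈ Finset.range n, a l * iterDiff k s (fun x : ℝ => (x : ℂ) ^ l) 0 =
      if l = k then a k * ((k.factorial : ℂ) * (s : ℂ) ^ k) else 0 := by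
    intro l hl
    rw [iterDiff_pow k l s (by have := Finset.mem_range.1 hl; omega)]
    split_ifs with h
    · rw [h]
    · simp
  rw [Finset.sum_congr rfl h2, Finset.sum_ite_eq']
  have : k ∈ Finset.range n ↔ n = k + 1 := by rw [Finset.mem_range]; omega
  simp only [this]

lemma iterDiff_polynomial {k : ℕ} {P : Polynomial ℂ} (hP : P.degree < k) (s : ℝ) :
    iterDiff k s (fun x : ℝ => P.eval (x : ℂ)) 0 = 0 := by
  by_cases hP0 : P = 0
  · simp [hP0, iterDiff]
  have h1 : ∀ x : ℂ, P.eval x = ∑ l ∈ Finset.range k, P.coeff l * x ^ l := fun x =>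
    Polynomial.eval_eq_sum_range' ((Polynomial.natDegree_lt_iff_degree_lt hP0).2 hP) x
  simp only [h1]
  rw [iterDiff_sum_mul_pow k k (by omega), if_neg (by omega)]

lemma exists_norm_iterDiff_le {M : ℕ → ℝ} (hM : IsWeightSeq M)
    (hroot : RootsTendsto (lc M)) {C₀ : ℝ} (hC₀ : 1 ≤ C₀)
    (hΓ : ∀ t : ℝ, 0 < t → GammaUpper (lc M) (C₀ * t) ≤ GammaLower (lc M) t)
    (hmg : mg M M < ⊤) {j : ℕ} (hj : 1 ≤ j) :
    ∃ B : ℝ, 1 ≤ B ∧ ∀ A : ℝ, 1 ≤ A → ∀ r : ℝ, 0 < r → ∃ A₁ : ℝ, 0 < A₁ ∧ ∀ φ : ℝ → ℂ,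
      TaylorBound (lc M) A r (fun x => φ x ^ j) → TaylorBound (lc M) A r (fun x => φ x ^ (j + 1)) →
      ∀ (k : ℕ) (s : ℝ), 0 < s → (k + 1) * s < r / 5120 →
        ‖iterDiff k s φ 0‖ ≤ A₁ * B ^ k * M k * s ^ k := by
  obtain ⟨B, hB, H⟩ := exists_polynomial_approx hM hroot hC₀ hΓ hmg hj
  have he1 : 1 ≤ Real.exp 1 := Real.one_le_exp (by norm_num)
  refine ⟨2 * Real.exp 1 * B, by nlinarith, fun A hA r hr => ?_⟩
  obtain ⟨A₁, hA₁, h⟩ := H A hA r hr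
  refine ⟨A₁ * Real.exp 1, by positivity, fun φ h1 h2 k s hs hks => ?_⟩
  obtain ⟨P, hPd, hP⟩ := h φ h1 h2 k ((k + 1) * s) (by positivity) hks
  have hfac : ((k : ℝ) + 1) ^ k ≤ Real.exp 1 * Real.exp 1 ^ k * k.factorial := by
    have := Real.pow_div_factorial_le_exp ((k : ℝ) + 1) (by positivity) k
    rw [div_le_iff₀ (by positivity)] at this
    refine this.trans_eq ?_
    rw [← Real.exp_nat_mul, ← Real.exp_add]
    ring_nf
  have hlc : 0 < lc M k := lc_pos hM k
  have hlcM : lc M k * k.factorial = M k := by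
    rw [lc]; field_simp
  have hd : iterDiff k s φ 0 = iterDiff k s (fun x => φ x - P.eval (x : ℂ)) 0 := by
    rw [iterDiff_sub, iterDiff_polynomial hPd, sub_zero]
  rw [hd]
  refine (norm_iterDiff_le (c := A₁ * B ^ k * lc M k * ((k + 1) * s) ^ k) fun i hi => ?_).trans ?_
  · refine hP _ ?_
    have : (i : ℝ) ≤ k := by exact_mod_cast hi
    rw [zero_add, nsmul_eq_mul, abs_of_nonneg (by positivity)]
    gcongr
    linarith
  calc 2 ^ k * (A₁ * B ^ k * lc M k * ((k + 1) * s) ^ k)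
      = 2 ^ k * A₁ * B ^ k * lc M k * s ^ k * ((k : ℝ) + 1) ^ k := by rw [mul_pow]; ring
    _ ≤ 2 ^ k * A₁ * B ^ k * lc M k * s ^ k * (Real.exp 1 * Real.exp 1 ^ k * k.factorial) := by
        gcongr
    _ = A₁ * Real.exp 1 * (2 * Real.exp 1 * B) ^ k * (lc M k * k.factorial) * s ^ k := by
        rw [mul_pow, mul_pow]; ring
    _ = _ := by rw [hlcM]

lemma hasDerivAt_sum_mul_pow_div_factorial (a : ℕ → ℂ) (n : ℕ) (s : ℝ) :
    HasDerivAt (fun s : ℝ => ∑ k ∈ Finset.range (n + 1), a k / k.factorial * (s : ℂ) ^ k)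
      (∑ k ∈ Finset.range n, a (k + 1) / k.factorial * (s : ℂ) ^ k) s := by
  have h : ∀ k ∈ Finset.range (n + 1), HasDerivAt (fun s : ℝ => a k / k.factorial * (s : ℂ) ^ k)
      (a k / k.factorial * (k * (s : ℂ) ^ (k - 1))) s := by
    intro k _
    exact ((hasDerivAt_pow k (s : ℂ)).comp_ofReal).const_mul _
  refine (HasDerivAt.fun_sum h).congr_deriv ?_
  rw [Finset.sum_range_succ']
  simp only [Nat.cast_zero, zero_mul, mul_zero, add_zero]
  refine Finset.sum_congr rfl fun k _ => ?_
  rw [Nat.factorial_succ, Nat.add_sub_cancel]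
  have : (k.factorial : ℂ) ≠ 0 := by exact_mod_cast k.factorial_ne_zero
  have h2 : ((k : ℂ) + 1) ≠ 0 := by exact_mod_cast k.succ_ne_zero
  push_cast
  field_simp

lemma norm_sub_taylor_le_of_nonneg {γ : ℕ → ℝ → ℂ} {r C : ℝ} (n : ℕ)
    (hγ : ∀ k, ∀ s : ℝ, |s| < r → HasDerivAt (γ k) (γ (k + 1) s) s)
    (hC : ∀ s : ℝ, |s| < r → ‖γ n s‖ ≤ C) {s : ℝ} (hs0 : 0 ≤ s) (hs : s < r) :
    ‖γ 0 s - ∑ k ∈ Finset.range n, γ k 0 / k.factorial * (s : ℂ) ^ k‖ ≤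
      C * s ^ n / n.factorial := by
  induction n generalizing γ s with
  | zero => simpa using hC s (by rwa [abs_of_nonneg hs0])
  | succ n ih =>
    have hlt : ∀ t ∈ Icc 0 s, |t| < r := fun t ht => by
      rw [abs_of_nonneg ht.1]; exact ht.2.trans_lt hs
    have hd : ∀ t ∈ Icc 0 s, HasDerivAt
        (fun t : ℝ => γ 0 t - ∑ k ∈ Finset.range (n + 1), γ k 0 / k.factorial * (t : ℂ) ^ k)
        (γ 1 t - ∑ k ∈ Finset.range n, γ (k + 1) 0 / k.factorial * (t : ℂ) ^ k) t := fun t ht =>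
      (hγ 0 t (hlt t ht)).sub (hasDerivAt_sum_mul_pow_div_factorial (fun k => γ k 0) n t)
    have hB : ∀ t : ℝ, HasDerivAt (fun t : ℝ => C * t ^ (n + 1) / (n + 1).factorial)
        (C * t ^ n / n.factorial) t := by
      intro t
      refine (((hasDerivAt_pow (n + 1) t).const_mul C).div_const _).congr_deriv ?_
      rw [Nat.factorial_succ, Nat.add_sub_cancel]
      push_cast
      field_simp
    refine image_norm_le_of_norm_deriv_right_le_deriv_boundary
      (fun t ht => (hd t ht).continuousAt.continuousWithinAt)
      (fun t ht => (hd t (Ico_subset_Icc_self ht)).hasDerivWithinAt) ?_ hB (fun t ht => ?_)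
      (right_mem_Icc.2 hs0)
    · rw [Finset.sum_range_succ']
      simp
    · exact ih (γ := fun k => γ (k + 1)) (fun k => hγ (k + 1)) hC ht.1 (ht.2.trans hs)

lemma norm_sub_taylor_le {γ : ℕ → ℝ → ℂ} {r C : ℝ} (n : ℕ)
    (hγ : ∀ k, ∀ s : ℝ, |s| < r → HasDerivAt (γ k) (γ (k + 1) s) s)
    (hC : ∀ s : ℝ, |s| < r → ‖γ n s‖ ≤ C) {s : ℝ} (hs : |s| < r) :
    ‖γ 0 s - ∑ k ∈ Finset.range n, γ k 0 / k.factorial * (s : ℂ) ^ k‖ ≤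
      C * |s| ^ n / n.factorial := by
  rcases le_total 0 s with h | h
  · rw [abs_of_nonneg h] at hs ⊢
    exact norm_sub_taylor_le_of_nonneg n hγ hC h hs
  · rw [abs_of_nonpos h] at hs ⊢
    have := norm_sub_taylor_le_of_nonneg (γ := fun k t => (-1) ^ k * γ k (-t)) (C := C) n
      (fun k t ht => ?_) (fun t ht => ?_) (neg_nonneg.2 h) hs
    · simp only [neg_neg, pow_zero, one_mul, neg_zero] at this
      refine (le_of_eq ?_).trans this
      congr 2
      refine Finset.sum_congr rfl fun k _ => ?_
      push_cast
      rw [neg_pow (s : ℂ)]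
      have h1 : ((-1 : ℂ) ^ k) * (-1) ^ k = 1 := by rw [← mul_pow]; simp
      linear_combination (-(γ k 0 / k.factorial * (s : ℂ) ^ k)) * h1
    · have := ((hγ k (-t) (by rwa [abs_neg])).scomp t (hasDerivAt_neg t)).const_mul ((-1 : ℂ) ^ k)
      refine this.congr_deriv ?_
      simp [pow_succ]
    · simpa using hC (-t) (by rwa [abs_neg])

/-- The derivatives of a smooth function along a line. -/
lemma hasDerivAt_iteratedFDerivWithin_line {E F : Type*} [NormedAddCommGroup E] [NormedSpace ℝ E]
    [NormedAddCommGroup F] [NormedSpace ℝ F] {U : Set E} (hU : IsOpen U) {g : E → F}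
    (hg : ContDiffOn ℝ (⊤ : ℕ∞) g U) {x w : E} {s : ℝ} (hs : x + s • w ∈ U) (k : ℕ) :
    HasDerivAt (fun s : ℝ => iteratedFDerivWithin ℝ k g U (x + s • w) fun _ => w)
      (iteratedFDerivWithin ℝ (k + 1) g U (x + s • w) fun _ => w) s := by
  have h1 : DifferentiableWithinAt ℝ (iteratedFDerivWithin ℝ k g U) U (x + s • w) :=
    hg.differentiableOn_iteratedFDerivWithin (by exact_mod_cast WithTop.coe_lt_top k)
      hU.uniqueDiffOn _ hs
  have h2 := (h1.hasFDerivWithinAt.hasFDerivAt (hU.mem_nhds hs))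
  have h3 : HasDerivAt (fun s : ℝ => x + s • w) w s := by
    simpa using ((hasDerivAt_id s).smul_const w).const_add x
  have h4 := h2.comp_hasDerivAt s h3
  have h5 := ((ContinuousMultilinearMap.apply ℝ (fun _ : Fin k => E) F fun _ => w).hasFDerivAt
    (x := iteratedFDerivWithin ℝ k g U (x + s • w))).comp_hasDerivAt s h4
  refine h5.congr_deriv ?_
  rw [iteratedFDerivWithin_succ_apply_left]
  rfl

lemma TaylorBound.mono {m : ℕ → ℝ} (hm : ∀ k, 0 < m k) {A A' r : ℝ} {G : ℝ → ℂ}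
    (h : TaylorBound m A r G) (hA : A ≤ A') : TaylorBound m A' r G := by
  obtain ⟨a, h1, h2⟩ := h
  refine ⟨a, fun k => (h1 k).trans ?_, fun n s hs => (h2 n s hs).trans ?_⟩
  · have := (hm k).le
    gcongr
  · have := (hm n).le
    gcongr

lemma exists_taylorBound_line {E : Type*} [NormedAddCommGroup E] [NormedSpace ℝ E]
    {M : ℕ → ℝ} (hM : IsWeightSeq M) {U : Set E} (hU : IsOpen U) {g : E → ℂ}
    (hg : ContDiffOn ℝ (⊤ : ℕ∞) g U) {x₀ : E} {R ρ : ℝ} (hR0 : 0 < R) (hρ : 0 < ρ)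
    (hR : closedBall x₀ (2 * R) ⊆ U) (hb : SeqBoundedOn M ρ g U (closedBall x₀ (2 * R))) :
    ∃ A : ℝ, 1 ≤ A ∧ ∀ x ∈ closedBall x₀ R, ∀ v : E, ‖v‖ ≤ 1 →
      TaylorBound (lc M) A (ρ * R) (fun s => g (x + s • ρ⁻¹ • v)) := by
  obtain ⟨C, hC⟩ := hb
  refine ⟨max C 1, le_max_right _ _, fun x hx v hv => ?_⟩
  have hw : ‖ρ⁻¹ • v‖ ≤ ρ⁻¹ := by
    rw [norm_smul, norm_inv, Real.norm_of_nonneg hρ.le]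
    exact mul_le_of_le_one_right (by positivity) hv
  have hmem : ∀ s : ℝ, |s| < ρ * R → x + s • ρ⁻¹ • v ∈ closedBall x₀ (2 * R) := by
    intro s hs
    have h1 : ‖s • ρ⁻¹ • v‖ ≤ R := by
      rw [norm_smul, Real.norm_eq_abs]
      calc |s| * ‖ρ⁻¹ • v‖ ≤ (ρ * R) * ρ⁻¹ := by gcongr
        _ = R := by field_simp
    rw [mem_closedBall_iff_norm] at hx ⊢
    calc ‖x + s • ρ⁻¹ • v - x₀‖ = ‖(x - x₀) + s • ρ⁻¹ • v‖ := by congr 1; abel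
      _ ≤ 2 * R := (norm_add_le _ _).trans (by linarith)
  set γ : ℕ → ℝ → ℂ := fun k s =>
    iteratedFDerivWithin ℝ k g U (x + s • ρ⁻¹ • v) (fun _ => ρ⁻¹ • v) with hγdef
  have hγ : ∀ k, ∀ s : ℝ, |s| < ρ * R → HasDerivAt (γ k) (γ (k + 1) s) s := fun k s hs =>
    hasDerivAt_iteratedFDerivWithin_line hU hg (hR (hmem s hs)) k
  have hγb : ∀ k, ∀ s : ℝ, |s| < ρ * R → ‖γ k s‖ ≤ max C 1 * M k := by
    intro k s hs
    have hMk := hM.pos k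
    refine (ContinuousMultilinearMap.le_opNorm _ _).trans ?_
    rw [Finset.prod_const, Finset.card_univ, Fintype.card_fin]
    calc ‖iteratedFDerivWithin ℝ k g U (x + s • ρ⁻¹ • v)‖ * ‖ρ⁻¹ • v‖ ^ k
        ≤ (max C 1 * ρ ^ k * M k) * ρ⁻¹ ^ k := by
          gcongr
          refine (hC _ (hmem s hs) k).trans ?_
          gcongr
          exact le_max_left _ _
      _ = max C 1 * M k := by rw [inv_pow]; field_simp
  refine ⟨fun k => γ k 0 / k.factorial, fun k => ?_, fun n s hs => ?_⟩
  · rw [norm_div, lc, Complex.norm_natCast, ← mul_div_assoc]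
    gcongr
    exact hγb k 0 (by rw [abs_zero]; positivity)
  · have h0 : γ 0 s = g (x + s • ρ⁻¹ • v) := by simp [hγdef]
    have hlc := lc_pos hM n
    simp only [← h0]
    refine (norm_sub_taylor_le n hγ (hγb n) hs).trans ?_
    calc max C 1 * M n * |s| ^ n / n.factorial = max C 1 * lc M n * |s| ^ n := by rw [lc]; ring
      _ ≤ _ := by
        gcongr
        linarith [abs_nonneg s]

lemma exists_norm_iterDiff_le_of_pow {E : Type*} [NormedAddCommGroup E] [NormedSpace ℝ E]
    [ProperSpace E] {M : ℕ → ℝ} (hM : IsWeightSeq M)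
    (hroot : RootsTendsto (lc M)) {C₀ : ℝ} (hC₀ : 1 ≤ C₀)
    (hΓ : ∀ t : ℝ, 0 < t → GammaUpper (lc M) (C₀ * t) ≤ GammaLower (lc M) t)
    (hmg : mg M M < ⊤) {j : ℕ} (hj : 1 ≤ j) {U : Set E} (hU : IsOpen U) {f : E → ℂ}
    (hf₁ : Beurling {M} U (fun x => f x ^ j)) (hf₂ : Beurling {M} U (fun x => f x ^ (j + 1))) :
    ∃ B : ℝ, 1 ≤ B ∧ ∀ (x₀ : E) (R : ℝ), 0 < R → closedBall x₀ (2 * R) ⊆ U → ∀ ρ : ℝ, 0 < ρ →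
      ∃ A : ℝ, 0 < A ∧ ∀ x ∈ closedBall x₀ R, ∀ v : E, ‖v‖ ≤ 1 → ∀ (k : ℕ) (s : ℝ), 0 < s →
        (k + 1) * s < R / 5120 → ‖iterDiff k (s • v) f x‖ ≤ A * (B * ρ) ^ k * M k * s ^ k := by
  obtain ⟨B, hB, H⟩ := exists_norm_iterDiff_le hM hroot hC₀ hΓ hmg hj
  refine ⟨B, hB, fun x₀ R hR hsub ρ hρ => ?_⟩
  have hK := isCompact_closedBall x₀ (2 * R)
  obtain ⟨A₁, hA₁, h₁⟩ := exists_taylorBound_line hM hU hf₁.1 hR hρ hsub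
    (hf₁.2 _ hsub hK M rfl ρ hρ)
  obtain ⟨A₂, hA₂, h₂⟩ := exists_taylorBound_line hM hU hf₂.1 hR hρ hsub
    (hf₂.2 _ hsub hK M rfl ρ hρ)
  obtain ⟨A, hA, h⟩ := H (max A₁ A₂) (hA₁.trans (le_max_left _ _)) (ρ * R) (by positivity)
  refine ⟨A, hA, fun x hx v hv k s hs hks => ?_⟩
  have := h (fun s => f (x + s • ρ⁻¹ • v))
    ((h₁ x hx v hv).mono (lc_pos hM) (le_max_left _ _))
    ((h₂ x hx v hv).mono (lc_pos hM) (le_max_right _ _)) k (ρ * s) (by positivity) (by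
      calc (k + 1) * (ρ * s) = ρ * ((k + 1) * s) := by ring
        _ < ρ * (R / 5120) := by gcongr
        _ = _ := by ring)
  have he : iterDiff k (ρ * s) (fun s => f (x + s • ρ⁻¹ • v)) 0 = iterDiff k (s • v) f x := by
    rw [iterDiff, iterDiff]
    refine Finset.sum_congr rfl fun i _ => ?_
    congr 3
    rw [zero_add, smul_assoc, smul_smul]
    congr 2
    field_simp
  rw [he] at this
  refine this.trans_eq ?_
  rw [mul_pow ρ, mul_pow B]
  ring

lemma continuousOn_of_pow {X : Type*} [TopologicalSpace X] {U : Set X} {f : X → ℂ} {j : ℕ}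
    (hj : 1 ≤ j) (h₁ : ContinuousOn (fun x => f x ^ j) U)
    (h₂ : ContinuousOn (fun x => f x ^ (j + 1)) U) : ContinuousOn f U := by
  have hj0 : j ≠ 0 := by omega
  intro x hx
  by_cases h0 : f x = 0
  · have h3 := (h₁ x hx).norm.rpow_const (p := ((j : ℝ)⁻¹)) (Or.inr (by positivity))
    have h4 : ∀ y, ‖f y ^ j‖ ^ ((j : ℝ)⁻¹) = ‖f y‖ := fun y => by
      rw [norm_pow, Real.pow_rpow_inv_natCast (norm_nonneg _) hj0]
    simp only [h4] at h3
    have h5 : Tendsto (fun y => ‖f y‖) (𝓝[U] x) (𝓝 0) := by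
      have := h3.tendsto
      rwa [h0, norm_zero] at this
    unfold ContinuousWithinAt
    rw [h0]
    exact tendsto_zero_iff_norm_tendsto_zero.2 h5
  · have h3 := (h₂ x hx).div (h₁ x hx) (pow_ne_zero j h0)
    refine h3.congr_of_eventuallyEq (Eventually.of_forall fun y => ?_) ?_
    all_goals
      simp only [Pi.div_apply]
      rcases eq_or_ne (f _) 0 with h | h
      · rw [h]; simp
      · rw [pow_succ]; field_simp

/-- A Landau type inequality. -/
lemma norm_fderiv_le_of_norm_le {E F : Type*} [NormedAddCommGroup E] [NormedSpace ℝ E]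
    [NormedAddCommGroup F] [NormedSpace ℝ F] {w : E → F} (hw : ContDiff ℝ 2 w) {x : E}
    {h ε b : ℝ} (hh : 0 < h) (hε : 0 ≤ ε) (hb0 : 0 ≤ b) (hwε : ∀ y ∈ closedBall x h, ‖w y‖ ≤ ε)
    (hb : ∀ y ∈ closedBall x h, ‖fderiv ℝ (fderiv ℝ w) y‖ ≤ b) :
    ‖fderiv ℝ w x‖ ≤ 2 * ε / h + b * h := by
  have hd : Differentiable ℝ w := hw.differentiable (by norm_num)
  have hd2 : Differentiable ℝ (fderiv ℝ w) :=
    (hw.fderiv_right (m := 1) (by norm_num)).differentiable (by norm_num)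
  have hx : x ∈ closedBall x h := mem_closedBall_self hh.le
  have h1 : ∀ y ∈ closedBall x h, ‖fderiv ℝ w y - fderiv ℝ w x‖ ≤ b * h := by
    intro y hy
    refine ((convex_closedBall x h).norm_image_sub_le_of_norm_fderiv_le
      (fun z _ => hd2 z) hb hx hy).trans ?_
    gcongr
    exact mem_closedBall_iff_norm.1 hy
  refine ContinuousLinearMap.opNorm_le_of_unit_norm (by positivity) fun e he => ?_
  have hy : x + h • e ∈ closedBall x h := by
    rw [mem_closedBall_iff_norm, add_sub_cancel_left, norm_smul, he, Real.norm_of_nonneg hh.le,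
      mul_one]
  have h2 := (convex_closedBall x h).norm_image_sub_le_of_norm_fderiv_le'
    (fun z _ => hd z) h1 hx hy
  rw [add_sub_cancel_left, map_smul, norm_smul h e, he, Real.norm_of_nonneg hh.le, mul_one] at h2
  have h3 : ‖h • fderiv ℝ w x e‖ ≤ 2 * ε + b * h * h := by
    have : h • fderiv ℝ w x e =
      (w (x + h • e) - w x) - (w (x + h • e) - w x - h • fderiv ℝ w x e) := by abel
    rw [this]
    refine (norm_sub_le _ _).trans (add_le_add ((norm_sub_le _ _).trans ?_) h2)
    linarith [hwε _ hy, hwε _ hx]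
  rw [norm_smul, Real.norm_of_nonneg hh.le] at h3
  have h4 : h * ‖fderiv ℝ w x e‖ ≤ h * (2 * ε / h + b * h) := by
    refine h3.trans_eq ?_
    field_simp
  exact le_of_mul_le_mul_left h4 hh

lemma exists_tendstoLocallyUniformlyOn_fderiv {E F : Type*} [NormedAddCommGroup E]
    [NormedSpace ℝ E] [ProperSpace E] [NormedAddCommGroup F] [NormedSpace ℝ F] [CompleteSpace F]
    {S : Set E} (hS : IsOpen S) {u : ℕ → E → F} {f : E → F} {b : ℝ}
    (hu : ∀ n, ContDiff ℝ 2 (u n)) (hb : ∀ n, ∀ x ∈ S, ‖fderiv ℝ (fderiv ℝ (u n)) x‖ ≤ b)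
    (hf : TendstoLocallyUniformlyOn u f atTop S) :
    ∃ f' : E → E →L[ℝ] F,
      TendstoLocallyUniformlyOn (fun n => fderiv ℝ (u n)) f' atTop S := by
  have hd : ∀ n, Differentiable ℝ (u n) := fun n => (hu n).differentiable (by norm_num)
  have hd2 : ∀ n, Differentiable ℝ (fderiv ℝ (u n)) := fun n =>
    ((hu n).fderiv_right (m := 1) (by norm_num)).differentiable (by norm_num)
  have key : ∀ x ∈ S, ∃ V ∈ 𝓝 x, V ⊆ S ∧
      UniformCauchySeqOn (fun n => fderiv ℝ (u n)) atTop V := by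
    intro x hx
    obtain ⟨δ, hδ, hδS⟩ := nhds_basis_closedBall.mem_iff.1 (hS.mem_nhds hx)
    have hb0 : 0 ≤ b := (norm_nonneg (fderiv ℝ (fderiv ℝ (u 0)) x)).trans (hb 0 x hx)
    have hunif : TendstoUniformlyOn u f atTop (closedBall x δ) :=
      (tendstoLocallyUniformlyOn_iff_forall_isCompact hS).1 hf _ hδS (isCompact_closedBall x δ)
    have hcau := Metric.uniformCauchySeqOn_iff.1 hunif.uniformCauchySeqOn
    refine ⟨closedBall x (δ / 2), closedBall_mem_nhds x (by positivity),
      (closedBall_subset_closedBall (by linarith)).trans hδS, Metric.uniformCauchySeqOn_iff.2 ?_⟩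
    intro η hη
    set h : ℝ := min (δ / 2) (η / (8 * (b + 1))) with hh
    have hhpos : 0 < h := by positivity
    obtain ⟨N, hN⟩ := hcau (h * η / 8) (by positivity)
    refine ⟨N, fun m hm n hn y hy => ?_⟩
    have hsub : closedBall y h ⊆ closedBall x δ := by
      refine closedBall_subset_closedBall' ?_
      have := mem_closedBall.1 hy
      have : h ≤ δ / 2 := min_le_left _ _
      linarith
    have hfd : fderiv ℝ (u m - u n) = fderiv ℝ (u m) - fderiv ℝ (u n) := by
      ext1 z
      exact fderiv_sub (hd m z) (hd n z)
    have hbound := norm_fderiv_le_of_norm_le (w := u m - u n) ((hu m).sub (hu n)) (x := y) hhpos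
      (ε := h * η / 8) (b := b + b) (by positivity) (by positivity)
      (fun z hz => by
        have := (hN m hm n hn z (hsub hz)).le
        rwa [dist_eq_norm] at this)
      (fun z hz => by
        have h2 := fderiv_sub (hd2 m z) (hd2 n z)
        rw [hfd, h2]
        exact (norm_sub_le (fderiv ℝ (fderiv ℝ (u m)) z) (fderiv ℝ (fderiv ℝ (u n)) z)).trans
          (add_le_add (hb m z (hδS (hsub hz))) (hb n z (hδS (hsub hz)))))
    rw [hfd] at hbound
    rw [dist_eq_norm]
    refine hbound.trans_lt ?_
    have h1 : 2 * (h * η / 8) / h = η / 4 := by field_simp; norm_num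
    have h2 : (b + b) * h ≤ η / 4 := by
      have h3 : h ≤ η / (8 * (b + 1)) := min_le_right _ _
      rw [le_div_iff₀ (by positivity)] at h3
      nlinarith
    linarith
  have hlim : ∀ x ∈ S, ∃ y, Tendsto (fun n => fderiv ℝ (u n) x) atTop (𝓝 y) := by
    intro x hx
    obtain ⟨V, hV, -, hVc⟩ := key x hx
    exact cauchySeq_tendsto_of_complete (hVc.cauchySeq (mem_of_mem_nhds hV))
  choose! f' hf' using hlim
  refine ⟨f', fun v hv x hx => ?_⟩
  obtain ⟨V, hV, hVS, hVc⟩ := key x hx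
  exact ⟨V, mem_nhdsWithin_of_mem_nhds hV,
    hVc.tendstoUniformlyOn_of_tendsto (fun y hy => hf' y (hVS hy)) v hv⟩

lemma contDiffOn_and_norm_iteratedFDerivWithin_le.{v} {E : Type v} [NormedAddCommGroup E]
    [NormedSpace ℝ E] [ProperSpace E] {S : Set E} (hS : IsOpen S) (k : ℕ) :
    ∀ {F : Type v} [NormedAddCommGroup F] [NormedSpace ℝ F] [CompleteSpace F]
    {u : ℕ → E → F} {f : E → F} {b : ℕ → ℝ}
    (_ : ∀ n, ContDiff ℝ (⊤ : ℕ∞) (u n))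
    (_ : ∀ n k, ∀ x ∈ S, ‖iteratedFDeriv ℝ k (u n) x‖ ≤ b k)
    (_ : TendstoLocallyUniformlyOn u f atTop S),
    ContDiffOn ℝ k f S ∧ ∀ x ∈ S, ‖iteratedFDerivWithin ℝ k f S x‖ ≤ b k := by
  induction k with
  | zero =>
    intro F _ _ _ u f b hu hb hf
    refine ⟨contDiffOn_zero.2 (hf.continuousOn (Frequently.of_forall fun n =>
      (hu n).continuous.continuousOn)), fun x hx => ?_⟩
    rw [norm_iteratedFDerivWithin_zero]
    refine le_of_tendsto (hf.tendsto_at hx).norm (Eventually.of_forall fun n => ?_)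
    simpa using hb n 0 x hx
  | succ k ih =>
    intro F _ _ _ u f b hu hb hf
    have hu2 : ∀ n, ContDiff ℝ 2 (u n) := fun n => (hu n).of_le (WithTop.coe_le_coe.2 (le_top : (2 : ℕ∞) ≤ ⊤))
    obtain ⟨f', hf'⟩ := exists_tendstoLocallyUniformlyOn_fderiv hS hu2 (b := b 2)
      (fun n x hx => by
        have := hb n 2 x hx
        rw [← norm_iteratedFDeriv_fderiv, ← norm_iteratedFDeriv_fderiv,
          norm_iteratedFDeriv_zero] at this
        exact this) hf
    have hder : ∀ x ∈ S, HasFDerivAt f (f' x) x := fun x hx =>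
      hasFDerivAt_of_tendstoLocallyUniformlyOn hS hf'
        (fun n x _ => ((hu2 n).differentiable (by norm_num) x).hasFDerivAt)
        (fun x hx => hf.tendsto_at hx) hx
    have hfd : ∀ x ∈ S, fderivWithin ℝ f S x = f' x := fun x hx =>
      (hder x hx).hasFDerivWithinAt.fderivWithin (hS.uniqueDiffWithinAt hx)
    obtain ⟨h1, h2⟩ := ih (u := fun n => fderiv ℝ (u n)) (f := f') (b := fun k => b (k + 1))
      (fun n => (hu n).fderiv_right (by exact_mod_cast le_top))
      (fun n k x hx => by rw [norm_iteratedFDeriv_fderiv]; exact hb n (k + 1) x hx) hf'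
    refine ⟨?_, fun x hx => ?_⟩
    · rw [Nat.cast_succ, contDiffOn_succ_iff_fderivWithin hS.uniqueDiffOn]
      refine ⟨fun x hx => (hder x hx).differentiableAt.differentiableWithinAt, by simp, ?_⟩
      exact h1.congr hfd
    · rw [← norm_iteratedFDerivWithin_fderivWithin hS.uniqueDiffOn hx,
        iteratedFDerivWithin_congr hfd hx]
      exact h2 x hx

lemma contDiff_iteratedFDeriv_apply {E F : Type*} [NormedAddCommGroup E] [NormedSpace ℝ E]
    [NormedAddCommGroup F] [NormedSpace ℝ F] {w : E → F} (hw : ContDiff ℝ (⊤ : ℕ∞) w) {n : ℕ}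
    (v : Fin n → E) : ContDiff ℝ (⊤ : ℕ∞) (fun y => iteratedFDeriv ℝ n w y v) :=
  (ContinuousMultilinearMap.apply ℝ (fun _ : Fin n => E) F v).contDiff.comp
    (hw.iteratedFDeriv_right (m := (⊤ : ℕ∞)) (by exact_mod_cast le_top))

lemma iteratedFDeriv_succ_apply_eq_fderiv {E F : Type*} [NormedAddCommGroup E] [NormedSpace ℝ E]
    [NormedAddCommGroup F] [NormedSpace ℝ F] {w : E → F} (hw : ContDiff ℝ (⊤ : ℕ∞) w) {n : ℕ}
    (x : E) (v : Fin (n + 1) → E) :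
    iteratedFDeriv ℝ (n + 1) w x v =
      fderiv ℝ (fun y => iteratedFDeriv ℝ n w y (Fin.tail v)) x (v 0) := by
  have h1 : Differentiable ℝ (iteratedFDeriv ℝ n w) :=
    hw.differentiable_iteratedFDeriv (by exact_mod_cast WithTop.coe_lt_top n)
  have h2 := (ContinuousMultilinearMap.apply ℝ (fun _ : Fin n => E) F
    (Fin.tail v)).hasFDerivAt.comp x (h1 x).hasFDerivAt
  have h3 : fderiv ℝ (fun y => iteratedFDeriv ℝ n w y (Fin.tail v)) x = _ := h2.fderiv
  rw [h3, iteratedFDeriv_succ_apply_left]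
  rfl

lemma iteratedFDeriv_comp_swap_succ {E F : Type*} [NormedAddCommGroup E] [NormedSpace ℝ E]
    [NormedAddCommGroup F] [NormedSpace ℝ F] {w : E → F} (hw : ContDiff ℝ (⊤ : ℕ∞) w) (n : ℕ)
    (i : Fin n) (x : E) (v : Fin (n + 1) → E) :
    iteratedFDeriv ℝ (n + 1) w x (v ∘ Equiv.swap i.castSucc i.succ) =
      iteratedFDeriv ℝ (n + 1) w x v := by
  induction n generalizing x with
  | zero => exact i.elim0
  | succ n ih =>
    refine Fin.cases ?_ (fun i => ?_) i
    · have key : ∀ v : Fin (n + 2) → E, iteratedFDeriv ℝ (n + 2) w x v =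
          fderiv ℝ (fderiv ℝ (fun y => iteratedFDeriv ℝ n w y (Fin.tail (Fin.tail v)))) x
            (v 0) (v 1) := by
        intro v
        rw [iteratedFDeriv_succ_apply_eq_fderiv hw]
        simp only [iteratedFDeriv_succ_apply_eq_fderiv hw]
        have h1 : Differentiable ℝ
            (fderiv ℝ (fun y => iteratedFDeriv ℝ n w y (Fin.tail (Fin.tail v)))) :=
          ((contDiff_iteratedFDeriv_apply hw _).fderiv_right (m := 1)
            (WithTop.coe_le_coe.2 le_top)).differentiable (by norm_num)
        have h2 := (ContinuousLinearMap.apply ℝ F (v 1)).hasFDerivAt.comp x (h1 x).hasFDerivAt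
        have h3 : fderiv ℝ (fun y => fderiv ℝ (fun y => iteratedFDeriv ℝ n w y
          (Fin.tail (Fin.tail v))) y (v 1)) x = _ := h2.fderiv
        exact DFunLike.congr_fun h3 (v 0)
      have htail : Fin.tail (Fin.tail (v ∘ Equiv.swap (Fin.castSucc (0 : Fin (n + 1)))
          (Fin.succ 0))) = Fin.tail (Fin.tail v) := by
        ext1 l
        simp only [Fin.tail, Function.comp]
        rw [Equiv.swap_apply_of_ne_of_ne]
        · simp [Fin.ext_iff]
        · simp [Fin.ext_iff]
      have hsymm : IsSymmSndFDerivAt ℝ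
          (fun y => iteratedFDeriv ℝ n w y (Fin.tail (Fin.tail v))) x :=
        (contDiff_iteratedFDeriv_apply hw _).contDiffAt.isSymmSndFDerivAt
          (by simpa using WithTop.coe_le_coe.2 (le_top : (2 : ℕ∞) ≤ ⊤))
      rw [key, key, htail, hsymm.eq]
      simp [Function.comp]
    · rw [iteratedFDeriv_succ_apply_eq_fderiv hw, iteratedFDeriv_succ_apply_eq_fderiv hw]
      have h0 : (v ∘ Equiv.swap i.succ.castSucc i.succ.succ) 0 = v 0 := by
        simp only [Function.comp]
        rw [Equiv.swap_apply_of_ne_of_ne]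
        · simp [Fin.ext_iff]
        · simp [Fin.ext_iff]
      have htail : Fin.tail (v ∘ Equiv.swap i.succ.castSucc i.succ.succ) =
          Fin.tail v ∘ Equiv.swap i.castSucc i.succ := by
        ext1 l
        simp only [Fin.tail, Function.comp]
        congr 1
        exact ((Fin.succ_injective (n + 1)).swap_apply i.castSucc i.succ l)
      rw [h0, htail]
      simp only [ih i]

lemma iteratedFDeriv_comp_perm {E F : Type*} [NormedAddCommGroup E] [NormedSpace ℝ E]
    [NormedAddCommGroup F] [NormedSpace ℝ F] {w : E → F} (hw : ContDiff ℝ (⊤ : ℕ∞) w) {n : ℕ}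
    (σ : Equiv.Perm (Fin n)) (x : E) (v : Fin n → E) :
    iteratedFDeriv ℝ n w x (v ∘ σ) = iteratedFDeriv ℝ n w x v := by
  cases n with
  | zero => congr 1; ext1 i; exact i.elim0
  | succ n =>
    have hσ : σ ∈ Submonoid.closure
        (Set.range fun i : Fin n => Equiv.swap i.castSucc i.succ) := by
      rw [Equiv.Perm.mclosure_swap_castSucc_succ]; trivial
    induction hσ using Submonoid.closure_induction generalizing v with
    | mem σ h =>
      obtain ⟨i, rfl⟩ := h
      exact iteratedFDeriv_comp_swap_succ hw n i x v
    | one => rfl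
    | mul σ τ _ _ h1 h2 =>
      have : v ∘ ⇑(σ * τ) = (v ∘ σ) ∘ τ := rfl
      rw [this, h2, h1]

/-- The polarization formula. -/
lemma sum_powerset_map_sum_compl {E F : Type*} [NormedAddCommGroup E] [NormedSpace ℝ E]
    [NormedAddCommGroup F] [NormedSpace ℝ F] {n : ℕ} (L : E [×n]→L[ℝ] F)
    (hL : ∀ (σ : Equiv.Perm (Fin n)) (v : Fin n → E), L (v ∘ σ) = L v) (v : Fin n → E) :
    ∑ T : Finset (Fin n), (-1 : ℤ) ^ T.card • L (fun _ => ∑ i ∈ Tᶜ, v i) =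
      n.factorial • L v := by
  have h1 : ∀ T : Finset (Fin n), (-1 : ℤ) ^ T.card • L (fun _ => ∑ i ∈ Tᶜ, v i) =
      ∑ r : Fin n → Fin n,
        (if T ⊆ (Finset.univ.image r)ᶜ then (-1 : ℤ) ^ T.card else 0) • L (v ∘ r) := by
    intro T
    have hset : ∀ r : Fin n → Fin n,
        r ∈ Fintype.piFinset (fun _ : Fin n => Tᶜ) ↔ T ⊆ (Finset.univ.image r)ᶜ := by
      intro r
      rw [Fintype.mem_piFinset, Finset.subset_compl_comm]
      simp [Finset.subset_iff]
    have hms := L.map_sum_finset (fun _ j => v j) (fun _ => Tᶜ)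
    rw [hms, Finset.smul_sum]
    have : Fintype.piFinset (fun _ : Fin n => Tᶜ) =
        Finset.univ.filter fun r => T ⊆ (Finset.univ.image r)ᶜ := by
      ext r; rw [hset]; simp
    rw [this, Finset.sum_filter]
    refine Finset.sum_congr rfl fun r _ => ?_
    split_ifs
    · rfl
    · simp
  rw [Finset.sum_congr rfl fun T _ => h1 T, Finset.sum_comm]
  have h2 : ∀ r : Fin n → Fin n, ∑ T : Finset (Fin n),
      (if T ⊆ (Finset.univ.image r)ᶜ then (-1 : ℤ) ^ T.card else 0) • L (v ∘ r) =
      if Function.Bijective r then L v else 0 := by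
    intro r
    rw [← Finset.sum_smul, ← Finset.sum_filter]
    have : (Finset.univ.filter fun T => T ⊆ (Finset.univ.image r)ᶜ) =
        ((Finset.univ.image r)ᶜ).powerset := by
      ext T; simp
    rw [this, Finset.sum_powerset_neg_one_pow_card]
    have hiff : (Finset.univ.image r)ᶜ = ∅ ↔ Function.Bijective r := by
      rw [← Finite.surjective_iff_bijective, Finset.compl_eq_empty_iff,
        Finset.eq_univ_iff_forall]
      simp [Function.Surjective]
    by_cases hr : Function.Bijective r
    · rw [if_pos (hiff.2 hr), if_pos hr, one_smul]
      exact hL (Equiv.ofBijective r hr) v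
    · rw [if_neg (mt hiff.1 hr), if_neg hr, zero_smul]
  rw [Finset.sum_congr rfl fun r _ => h2 r, ← Finset.sum_filter, Finset.sum_const]
  congr 1
  have : (Finset.univ.filter fun r : Fin n → Fin n => Function.Bijective r) =
      Finset.univ.image (fun σ : Equiv.Perm (Fin n) => (σ : Fin n → Fin n)) := by
    ext r
    simp only [Finset.mem_filter, Finset.mem_univ, true_and, Finset.mem_image]
    exact ⟨fun h => ⟨Equiv.ofBijective r h, rfl⟩, fun ⟨σ, hσ⟩ => hσ ▸ σ.bijective⟩
  rw [this, Finset.card_image_of_injective _ DFunLike.coe_injective, Finset.card_univ,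
    Fintype.card_perm, Fintype.card_fin]

lemma norm_le_of_norm_diag_le {E F : Type*} [NormedAddCommGroup E] [NormedSpace ℝ E]
    [NormedAddCommGroup F] [NormedSpace ℝ F] {n : ℕ} (L : E [×n]→L[ℝ] F)
    (hL : ∀ (σ : Equiv.Perm (Fin n)) (v : Fin n → E), L (v ∘ σ) = L v) {a : ℝ} (ha : 0 ≤ a)
    (h : ∀ e : E, ‖e‖ ≤ 1 → ‖L fun _ => e‖ ≤ a) : ‖L‖ ≤ (2 * Real.exp 1) ^ n * a := by
  rcases Nat.eq_zero_or_pos n with rfl | hn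
  · refine ContinuousMultilinearMap.opNorm_le_bound (by positivity) fun v => ?_
    have : v = fun _ => 0 := funext fun i => i.elim0
    simpa [this] using h 0 (by simp)
  have hn' : (0 : ℝ) < n := by exact_mod_cast hn
  have hdiag : ∀ w : E, ‖w‖ ≤ n → ‖L fun _ => w‖ ≤ (n : ℝ) ^ n * a := by
    intro w hw
    have h1 : (fun _ : Fin n => w) = fun i : Fin n => (fun _ => (n : ℝ)) i • ((n : ℝ)⁻¹ • w) := by
      ext1 i
      rw [smul_smul, mul_inv_cancel₀ hn'.ne', one_smul]
    rw [h1, L.map_smul_univ, norm_smul, Finset.prod_const, Finset.card_univ, Fintype.card_fin,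
      norm_pow, Real.norm_of_nonneg hn'.le]
    gcongr
    refine h _ ?_
    rw [norm_smul, norm_inv, Real.norm_of_nonneg hn'.le, inv_mul_le_iff₀ hn', mul_one]
    exact hw
  have hunit : ∀ u : Fin n → E, (∀ i, ‖u i‖ ≤ 1) → ‖L u‖ ≤ (2 * Real.exp 1) ^ n * a := by
    intro u hu
    have h1 : (n.factorial : ℝ) * ‖L u‖ ≤ 2 ^ n * ((n : ℝ) ^ n * a) := by
      have h2 := sum_powerset_map_sum_compl L hL u
      have h3 : (n.factorial : ℝ) * ‖L u‖ = ‖n.factorial • L u‖ := by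
        rw [← Nat.cast_smul_eq_nsmul ℝ, norm_smul]; simp
      rw [h3, ← h2]
      have h4 : (2 : ℝ) ^ n * ((n : ℝ) ^ n * a) =
          ∑ _T : Finset (Fin n), ((n : ℝ) ^ n * a) := by simp
      rw [h4]
      refine norm_sum_le_of_le _ fun T _ => (norm_zsmul_le _ _).trans ?_
      have h5 : ‖((-1 : ℤ) ^ T.card)‖ = 1 := by simp
      rw [h5, one_mul]
      refine hdiag _ ((norm_sum_le_of_le _ fun i _ => hu i).trans ?_)
      simp only [Finset.sum_const, nsmul_eq_mul, mul_one]
      exact_mod_cast (Finset.card_le_univ _).trans_eq (Fintype.card_fin n)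
    have h2 := Real.pow_div_factorial_le_exp (n : ℝ) hn'.le n
    have h3 : Real.exp (n : ℝ) = Real.exp 1 ^ n := by rw [← Real.exp_nat_mul, mul_one]
    rw [h3] at h2
    have hfac : (0 : ℝ) < n.factorial := by positivity
    calc ‖L u‖ ≤ 2 ^ n * ((n : ℝ) ^ n * a) / n.factorial := by
          rw [le_div_iff₀ hfac, mul_comm]; exact h1
      _ = 2 ^ n * ((n : ℝ) ^ n / n.factorial) * a := by ring
      _ ≤ 2 ^ n * Real.exp 1 ^ n * a := by gcongr
      _ = _ := by rw [mul_pow]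
  refine ContinuousMultilinearMap.opNorm_le_bound (by positivity) fun v => ?_
  have h1 : v = fun i => ‖v i‖ • (‖v i‖⁻¹ • v i) := by
    ext1 i
    rcases eq_or_ne (v i) 0 with h0 | h0
    · simp [h0]
    · rw [smul_smul, mul_inv_cancel₀ (norm_ne_zero_iff.2 h0), one_smul]
  have h2 : L v = (∏ i, ‖v i‖) • L fun i => ‖v i‖⁻¹ • v i := by
    conv_lhs => rw [h1]
    exact L.map_smul_univ (fun i => ‖v i‖) _
  rw [h2, norm_smul, mul_comm, Real.norm_of_nonneg (by positivity)]
  gcongr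
  refine hunit _ fun i => ?_
  rw [norm_smul, norm_inv, norm_norm]
  exact inv_mul_le_one

lemma norm_iteratedFDeriv_diag_le {E : Type*} [NormedAddCommGroup E] [NormedSpace ℝ E]
    {w : E → ℂ} (hw : ContDiff ℝ (⊤ : ℕ∞) w) {k : ℕ} {x e : E} {a s₀ : ℝ} (hs₀ : 0 < s₀)
    (h : ∀ s : ℝ, 0 < s → s < s₀ → ‖iterDiff k (s • e) w x‖ ≤ a * s ^ k) :
    ‖iteratedFDeriv ℝ k w x fun _ => e‖ ≤ a := by
  set γ : ℕ → ℝ → ℂ := fun i t => iteratedFDerivWithin ℝ i w univ (x + t • e) fun _ => e with hγdef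
  have hγ : ∀ i t, HasDerivAt (γ i) (γ (i + 1) t) t := fun i t =>
    hasDerivAt_iteratedFDerivWithin_line isOpen_univ hw.contDiffOn (mem_univ _) i
  obtain ⟨C, hC⟩ := (isCompact_Icc (a := (-1 : ℝ)) (b := 1)).exists_bound_of_continuousOn
    (f := γ (k + 1)) fun t _ => (hγ (k + 1) t).continuousAt.continuousWithinAt
  have hC0 : 0 ≤ C := (norm_nonneg _).trans (hC 0 (by norm_num))
  have hC' : ∀ t : ℝ, |t| < 1 → ‖γ (k + 1) t‖ ≤ C := fun t ht => hC t (abs_le.1 ht.le)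
  set D : ℝ := 2 ^ k * (C * (k : ℝ) ^ (k + 1) / (k + 1).factorial) with hD
  have hmain : ∀ s : ℝ, 0 < s → s < s₀ → k * s < 1 → ‖γ k 0‖ ≤ a + D * s := by
    intro s hs hss hks
    have hT : ‖iterDiff k s (fun t => γ 0 t -
        ∑ i ∈ Finset.range (k + 1), γ i 0 / i.factorial * (t : ℂ) ^ i) 0‖ ≤
        2 ^ k * (C * (k * s) ^ (k + 1) / (k + 1).factorial) := by
      refine norm_iterDiff_le fun i hi => ?_
      have hi' : (i : ℝ) * s ≤ k * s := by gcongr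
      have hi0 : 0 ≤ (i : ℝ) * s := by positivity
      have habs : |(0 : ℝ) + i • s| = i * s := by
        rw [zero_add, nsmul_eq_mul, abs_of_nonneg hi0]
      refine (norm_sub_taylor_le (r := 1) (k + 1) (fun i t _ => hγ i t) hC' ?_).trans ?_
      · rw [habs]; exact hi'.trans_lt hks
      · rw [habs]; gcongr
    rw [iterDiff_sub, iterDiff_sum_mul_pow k (k + 1) le_rfl s (fun i => γ i 0 / i.factorial),
      if_pos rfl] at hT
    have h0 : iterDiff k s (γ 0) 0 = iterDiff k (s • e) w x := by
      simp only [iterDiff]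
      refine Finset.sum_congr rfl fun i _ => ?_
      congr 1
      simp [hγdef, smul_smul, ← Nat.cast_smul_eq_nsmul ℝ]
    have hfac : (k.factorial : ℂ) ≠ 0 := by exact_mod_cast k.factorial_ne_zero
    have h1 : γ k 0 / k.factorial * ((k.factorial : ℂ) * (s : ℂ) ^ k) = γ k 0 * (s : ℂ) ^ k := by
      field_simp
    rw [h0, h1] at hT
    have h2 : ‖γ k 0 * (s : ℂ) ^ k‖ = ‖γ k 0‖ * s ^ k := by
      rw [norm_mul, norm_pow, Complex.norm_real, Real.norm_of_nonneg hs.le]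
    have h3 := norm_sub_norm_le (γ k 0 * (s : ℂ) ^ k) (iterDiff k (s • e) w x)
    rw [norm_sub_rev, h2] at h3
    have h4 := h s hs hss
    have h5 : 2 ^ k * (C * (k * s) ^ (k + 1) / (k + 1).factorial) = D * s * s ^ k := by
      rw [hD]; ring
    have hsk : 0 < s ^ k := pow_pos hs k
    refine le_of_mul_le_mul_right ?_ hsk
    rw [add_mul]
    linarith
  have hlim : Tendsto (fun s : ℝ => a + D * s) (𝓝[>] 0) (𝓝 a) := by
    have : Tendsto (fun s : ℝ => a + D * s) (𝓝 0) (𝓝 (a + D * 0)) := by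
      apply Continuous.tendsto; fun_prop
    simpa using this.mono_left nhdsWithin_le_nhds
  have hev : ∀ᶠ s : ℝ in 𝓝[>] 0, ‖γ k 0‖ ≤ a + D * s := by
    have e1 : ∀ᶠ s : ℝ in 𝓝[>] 0, s < s₀ := nhdsWithin_le_nhds (Iio_mem_nhds hs₀)
    have e2 : ∀ᶠ s : ℝ in 𝓝[>] 0, k * s < 1 := by
      have : Tendsto (fun s : ℝ => k * s) (𝓝 0) (𝓝 ((k : ℝ) * 0)) := by
        apply Continuous.tendsto; fun_prop
      exact nhdsWithin_le_nhds (this.eventually (Iio_mem_nhds (by simp)))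
    filter_upwards [e1, e2, self_mem_nhdsWithin] with s h1 h2 h3 using hmain s h3 h1 h2
  have := ge_of_tendsto hlim hev
  simpa [hγdef, iteratedFDerivWithin_univ] using this

section Mollification

open MeasureTheory Convolution ContinuousLinearMap

lemma iterDiff_convolution {E : Type*} [NormedAddCommGroup E] [NormedSpace ℝ E]
    [MeasurableSpace E] {μ : Measure E} {φ : E → ℝ} {g : E → ℂ}
    (hex : ConvolutionExists φ g (lsmul ℝ ℝ) μ) (k : ℕ) (h x : E) :
    iterDiff k h (φ ⋆[lsmul ℝ ℝ, μ] g) x = ∫ t, φ t • iterDiff k h g (x - t) ∂μ := by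
  simp only [iterDiff, Finset.smul_sum]
  have hint : ∀ i ∈ Finset.range (k + 1),
      Integrable (fun t => φ t • ((-1 : ℤ) ^ (k - i) * k.choose i) • g (x - t + i • h)) μ := by
    intro i _
    have := (hex (x + i • h)).integrable.smul (((-1 : ℤ) ^ (k - i) * k.choose i : ℤ) : ℝ)
    refine this.congr (ae_of_all _ fun t => ?_)
    simp only [Pi.smul_apply, lsmul_apply]
    rw [smul_comm, Int.cast_smul_eq_zsmul, add_sub_right_comm]
  rw [integral_finsetSum _ hint]
  refine Finset.sum_congr rfl fun i _ => ?_
  rw [convolution_def, ← Int.cast_smul_eq_zsmul ℝ, ← integral_smul]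
  refine integral_congr_ae (ae_of_all _ fun t => ?_)
  simp only [lsmul_apply]
  rw [smul_comm, Int.cast_smul_eq_zsmul, add_sub_right_comm]

lemma norm_iterDiff_normed_convolution_le {E : Type*} [NormedAddCommGroup E] [NormedSpace ℝ E]
    [FiniteDimensional ℝ E] [MeasurableSpace E] [BorelSpace E] {μ : Measure E}
    [μ.IsAddHaarMeasure] (φ : ContDiffBump (0 : E)) {g : E → ℂ} (hg : LocallyIntegrable g μ)
    {k : ℕ} {h x : E} {c : ℝ} (hc : ∀ t ∈ ball (0 : E) φ.rOut, ‖iterDiff k h g (x - t)‖ ≤ c) :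
    ‖iterDiff k h (φ.normed μ ⋆[lsmul ℝ ℝ, μ] g) x‖ ≤ c := by
  rw [iterDiff_convolution
    (φ.hasCompactSupport_normed.convolutionExists_left _ φ.continuous_normed hg)]
  have hint : Integrable (fun t => φ.normed μ t * c) μ := φ.integrable_normed.mul_const c
  refine (norm_integral_le_of_norm_le hint (ae_of_all _ fun t => ?_)).trans_eq ?_
  · rw [norm_smul, Real.norm_of_nonneg (φ.nonneg_normed t)]
    by_cases ht : t ∈ ball (0 : E) φ.rOut
    · exact mul_le_mul_of_nonneg_left (hc t ht) (φ.nonneg_normed t)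
    · rw [← φ.support_normed_eq (μ := μ), Function.notMem_support] at ht
      simp [ht]
  · rw [integral_mul_const, φ.integral_normed, one_mul]

lemma contDiffOn_and_norm_iteratedFDerivWithin_le_of_iterDiff {E : Type}
    [NormedAddCommGroup E] [NormedSpace ℝ E] [FiniteDimensional ℝ E]
    {f : E → ℂ} {x₀ : E} {R δ : ℝ} (hR : 0 < R) (hδ : 0 < δ) (hδR : δ ≤ R)
    (hf : ContinuousOn f (closedBall x₀ (2 * R)))
    {a : ℕ → ℝ} (ha : ∀ k, 0 ≤ a k)
    (hdiff : ∀ x ∈ closedBall x₀ R, ∀ v : E, ‖v‖ ≤ 1 → ∀ (k : ℕ) (s : ℝ), 0 < s →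
      (k + 1) * s < δ → ‖iterDiff k (s • v) f x‖ ≤ a k * s ^ k) (k : ℕ) :
    ContDiffOn ℝ k f (ball x₀ (R / 2)) ∧ ∀ x ∈ ball x₀ (R / 2),
      ‖iteratedFDerivWithin ℝ k f (ball x₀ (R / 2)) x‖ ≤ (2 * Real.exp 1) ^ k * a k := by
  borelize E
  have : ProperSpace E := FiniteDimensional.proper_real E
  let μ : Measure E := Measure.addHaar
  set g : E → ℂ := (closedBall x₀ (2 * R)).indicator f with hg
  have hgf : ∀ x ∈ closedBall x₀ (2 * R), g x = f x := fun x hx => indicator_of_mem hx f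
  have hgi : Integrable g μ :=
    (hf.integrableOn_compact (isCompact_closedBall _ _)).integrable_indicator
      measurableSet_closedBall
  let φ : ℕ → ContDiffBump (0 : E) := fun n =>
    ⟨R / (2 * (n + 2)), R / (2 * (n + 1)), by positivity, by gcongr; norm_num⟩
  have hφout : ∀ n, (φ n).rOut = R / (2 * (n + 1)) := fun n => rfl
  have hφle : ∀ n, (φ n).rOut ≤ R / 2 := fun n => by
    rw [hφout]
    gcongr
    have : (0 : ℝ) ≤ n := n.cast_nonneg
    linarith
  let u : ℕ → E → ℂ := fun n => (φ n).normed μ ⋆[lsmul ℝ ℝ, μ] g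
  have hu : ∀ n, ContDiff ℝ (⊤ : ℕ∞) (u n) := fun n =>
    (φ n).hasCompactSupport_normed.contDiff_convolution_left _ (φ n).contDiff_normed
      hgi.locallyIntegrable
  have hud : ∀ n, ∀ x ∈ ball x₀ (R / 2), ∀ v : E, ‖v‖ ≤ 1 → ∀ (k : ℕ) (s : ℝ), 0 < s →
      s < δ / (k + 1) → ‖iterDiff k (s • v) (u n) x‖ ≤ a k * s ^ k := by
    intro n x hx v hv k s hs hks
    have hks' : (k + 1) * s < δ := by
      rw [lt_div_iff₀ (by positivity)] at hks; linarith
    refine norm_iterDiff_normed_convolution_le (φ n) hgi.locallyIntegrable fun t ht => ?_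
    have hxt : x - t ∈ closedBall x₀ R := by
      rw [mem_ball, dist_eq_norm] at hx
      rw [mem_ball_zero_iff] at ht
      rw [mem_closedBall, dist_eq_norm]
      have h1 : x - t - x₀ = (x - x₀) - t := by abel
      rw [h1]
      linarith [norm_sub_le (x - x₀) t, hφle n]
    have heq : iterDiff k (s • v) g (x - t) = iterDiff k (s • v) f (x - t) := by
      refine Finset.sum_congr rfl fun i hi => ?_
      have hik : (i : ℝ) ≤ k := by exact_mod_cast Nat.lt_succ_iff.1 (Finset.mem_range.1 hi)
      rw [hgf]
      rw [mem_closedBall, dist_eq_norm] at hxt ⊢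
      have h1 : x - t + i • s • v - x₀ = (x - t - x₀) + i • s • v := by abel
      have h2 : ‖i • s • v‖ ≤ R := by
        rw [← Nat.cast_smul_eq_nsmul ℝ, norm_smul, norm_smul, Real.norm_of_nonneg hs.le,
          Real.norm_of_nonneg i.cast_nonneg]
        have h3 : s * ‖v‖ ≤ s := mul_le_of_le_one_right hs.le hv
        have h4 : (i : ℝ) * (s * ‖v‖) ≤ k * s := by gcongr
        linarith
      rw [h1]
      linarith [norm_add_le (x - t - x₀) (i • s • v)]
    rw [heq]
    exact hdiff _ hxt v hv k s hs hks'
  have hub : ∀ n k, ∀ x ∈ ball x₀ (R / 2),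
      ‖iteratedFDeriv ℝ k (u n) x‖ ≤ (2 * Real.exp 1) ^ k * a k := fun n k x hx =>
    norm_le_of_norm_diag_le _ (fun σ v => iteratedFDeriv_comp_perm (hu n) σ x v) (ha k)
      fun e he => norm_iteratedFDeriv_diag_le (hu n) (s₀ := δ / (k + 1)) (by positivity)
        fun s hs hss => hud n x hx e he k s hs hss
  have hlim : TendstoLocallyUniformlyOn u f atTop (ball x₀ (R / 2)) := by
    refine TendstoUniformlyOn.tendstoLocallyUniformlyOn ?_
    rw [Metric.tendstoUniformlyOn_iff]
    intro ε hε
    obtain ⟨η, hη, hηε⟩ := Metric.uniformContinuousOn_iff.1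
      ((isCompact_closedBall x₀ (2 * R)).uniformContinuousOn_of_continuous hf) (ε / 2)
      (half_pos hε)
    have hev : ∀ᶠ n in atTop, (φ n).rOut < η := by
      have h1 : Tendsto (fun n : ℕ => R / 2 * (1 / ((n : ℝ) + 1))) atTop (𝓝 (R / 2 * 0)) :=
        tendsto_one_div_add_atTop_nhds_zero_nat.const_mul _
      rw [mul_zero] at h1
      filter_upwards [h1.eventually (Iio_mem_nhds hη)] with n hn
      rw [hφout]
      refine lt_of_eq_of_lt ?_ hn
      field_simp
    filter_upwards [hev] with n hn x hx
    have hx2 : x ∈ closedBall x₀ (2 * R) := by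
      rw [mem_ball] at hx; rw [mem_closedBall]; linarith
    rw [dist_comm, ← hgf x hx2]
    refine lt_of_le_of_lt ?_ (half_lt_self hε)
    refine (φ n).dist_normed_convolution_le hgi.aestronglyMeasurable fun y hy => ?_
    have hy2 : y ∈ closedBall x₀ (2 * R) := by
      rw [mem_ball] at hx hy; rw [mem_closedBall]
      linarith [dist_triangle y x x₀, hφle n]
    rw [hgf x hx2, hgf y hy2]
    exact (hηε y hy2 x hx2 ((mem_ball.1 hy).trans hn)).le
  exact contDiffOn_and_norm_iteratedFDerivWithin_le isOpen_ball k hu hub hlim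

end Mollification

lemma exists_norm_iteratedFDerivWithin_le_of_pow {E : Type} [NormedAddCommGroup E]
    [NormedSpace ℝ E] [FiniteDimensional ℝ E] {M : ℕ → ℝ} (hM : IsWeightSeq M)
    (hroot : RootsTendsto (lc M)) {C₀ : ℝ} (hC₀ : 1 ≤ C₀)
    (hΓ : ∀ t : ℝ, 0 < t → GammaUpper (lc M) (C₀ * t) ≤ GammaLower (lc M) t)
    (hmg : mg M M < ⊤) {j : ℕ} (hj : 1 ≤ j) {U : Set E} (hU : IsOpen U) {f : E → ℂ}
    (hf₁ : Beurling {M} U (fun x => f x ^ j)) (hf₂ : Beurling {M} U (fun x => f x ^ (j + 1)))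
    {x₀ : E} (hx₀ : x₀ ∈ U) : ∃ r : ℝ, 0 < r ∧ ball x₀ r ⊆ U ∧
      ContDiffOn ℝ (⊤ : ℕ∞) f (ball x₀ r) ∧ ∀ ρ : ℝ, 0 < ρ → ∃ A : ℝ, 0 < A ∧
        ∀ x ∈ ball x₀ r, ∀ k : ℕ, ‖iteratedFDerivWithin ℝ k f U x‖ ≤ A * ρ ^ k * M k := by
  have : ProperSpace E := FiniteDimensional.proper_real E
  obtain ⟨B, hB, H⟩ := exists_norm_iterDiff_le_of_pow hM hroot hC₀ hΓ hmg hj hU hf₁ hf₂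
  have hcont : ContinuousOn f U :=
    continuousOn_of_pow hj hf₁.1.continuousOn hf₂.1.continuousOn
  obtain ⟨ε, hε, hεU⟩ := Metric.nhds_basis_closedBall.mem_iff.1 (hU.mem_nhds hx₀)
  have hR : 0 < ε / 2 := half_pos hε
  have hsub : closedBall x₀ (2 * (ε / 2)) ⊆ U := by rwa [mul_div_cancel₀ _ two_ne_zero]
  have hballU : ball x₀ (ε / 2 / 2) ⊆ U :=
    ((ball_subset_ball (by linarith)).trans ball_subset_closedBall).trans hsub
  have hB0 : 0 < B := one_pos.trans_le hB
  have key : ∀ ρ : ℝ, 0 < ρ → ∃ A : ℝ, 0 < A ∧ ∀ k : ℕ,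
      ContDiffOn ℝ k f (ball x₀ (ε / 2 / 2)) ∧ ∀ x ∈ ball x₀ (ε / 2 / 2),
        ‖iteratedFDerivWithin ℝ k f (ball x₀ (ε / 2 / 2)) x‖ ≤ A * ρ ^ k * M k := by
    intro ρ hρ
    obtain ⟨A, hA, h⟩ := H x₀ (ε / 2) hR hsub (ρ / (2 * Real.exp 1 * B)) (by positivity)
    refine ⟨A, hA, fun k => ?_⟩
    have h3 := contDiffOn_and_norm_iteratedFDerivWithin_le_of_iterDiff hR
      (δ := ε / 2 / 5120) (by positivity) (by linarith) (hcont.mono hsub)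
      (a := fun k => A * (B * (ρ / (2 * Real.exp 1 * B))) ^ k * M k)
      (fun k => by have := hM.1 k; positivity) h k
    refine ⟨h3.1, fun x hx => (h3.2 x hx).trans_eq ?_⟩
    have h4 : B * (ρ / (2 * Real.exp 1 * B)) = ρ / (2 * Real.exp 1) := by field_simp
    have h5 : (2 * Real.exp 1) ^ k * (ρ / (2 * Real.exp 1)) ^ k = ρ ^ k := by
      rw [← mul_pow, mul_div_cancel₀ _ (by positivity)]
    rw [h4, ← h5]
    ring
  refine ⟨ε / 2 / 2, by positivity, hballU, ?_, fun ρ hρ => ?_⟩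
  · obtain ⟨A, -, h⟩ := key 1 one_pos
    exact contDiffOn_infty.2 fun k => (h k).1
  · obtain ⟨A, hA, h⟩ := key ρ hρ
    refine ⟨A, hA, fun x hx k => ?_⟩
    have := (h k).2 x hx
    rwa [iteratedFDerivWithin_of_isOpen k isOpen_ball hx,
      ← iteratedFDerivWithin_of_isOpen k hU (hballU hx)] at this

/-- Joris' theorem for the Beurling Denjoy–Carleman class of a single weight sequence. -/
theorem statement3 {d : ℕ} (M : ℕ → ℝ) (hM : IsWeightSeq M)
    (hroot : RootsTendsto (lc M))
    (hGamma : ∃ C : ℝ, 1 ≤ C ∧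
      ∀ t : ℝ, 0 < t → GammaUpper (lc M) (C * t) ≤ GammaLower (lc M) t)
    (hmg : mg M M < ⊤)
    (U : Set (EuclideanSpace ℝ (Fin d))) (hU : IsOpen U)
    (j : ℕ) (hj : 1 ≤ j) (f : EuclideanSpace ℝ (Fin d) → ℂ)
    (h1 : Beurling {M} U (fun x => f x ^ j))
    (h2 : Beurling {M} U (fun x => f x ^ (j + 1))) :
    Beurling {M} U f := by
  obtain ⟨C₀, hC₀, hΓ⟩ := hGamma
  have hloc := fun x₀ (hx₀ : x₀ ∈ U) => exists_norm_iteratedFDerivWithin_le_of_pow hM hroot hC₀ hΓ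
    hmg hj hU h1 h2 hx₀
  refine ⟨fun x hx => ?_, fun K hKU hK N hN ρ hρ => ?_⟩
  · obtain ⟨r, hr, -, hcd, -⟩ := hloc x hx
    exact (hcd.contDiffAt (ball_mem_nhds x hr)).contDiffWithinAt
  · obtain rfl : N = M := hN
    have hmono : ∀ {A A' : ℝ}, A ≤ A' → ∀ k, A * ρ ^ k * N k ≤ A' * ρ ^ k * N k := by
      intro A A' hAA k
      have := (hM.1 k).le
      gcongr
    refine hK.induction_on (p := fun s => SeqBoundedOn N ρ f U s) ⟨0, by simp⟩ ?_ ?_ ?_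
    · rintro s t hst ⟨A, hA⟩
      exact ⟨A, fun x hx => hA x (hst hx)⟩
    · rintro s t ⟨A, hA⟩ ⟨A', hA'⟩
      refine ⟨max A A', fun x hx k => ?_⟩
      rcases hx with hx | hx
      · exact (hA x hx k).trans (hmono (le_max_left _ _) k)
      · exact (hA' x hx k).trans (hmono (le_max_right _ _) k)
    · intro x hx
      obtain ⟨r, hr, -, -, hb⟩ := hloc x (hKU hx)
      obtain ⟨A, -, hA⟩ := hb ρ hρ
      exact ⟨ball x r, mem_nhdsWithin_of_mem_nhds (ball_mem_nhds x hr), A, hA⟩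

end JorisPaper
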